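/- Let k and ℓ be fixed positive integers with 1 ≤ ℓ ≤ k and gcd(ℓ, k) = 1. Then there exists a constant C > 0 (depending on k) such that for all real x ≥ 16, |Σ_{2 ≤ n ≤ x, p(n) ≡ ℓ (mod k)} μ(n) ω(n) / n| ≤ C · (log log x)^{5/2} / √(log x). Consequently, Σ_{n ≥ 2, p(n) ≡ ℓ (mod k)} μ(n) ω(n) / n converges and equals 0, i.e., the partial sums tend to 0 as x → ∞. -/

import Mathlib

open MeasureTheory FourierTransform SchwartzMap in
/-- Plancherel for a function in `L¹ ∩ L²`. -/
lemma plancherel_aux {f : ℝ → ℂ} (hf1 : Integrable f) (hf2 : MemLp f 2) :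
    eLpNorm (𝓕 f) 2 volume = eLpNorm f 2 volume := by
  set F : Lp ℂ 2 (volume : Measure ℝ) := hf2.toLp f with hF
  have hcont : Continuous (𝓕 f) :=
    VectorFourier.fourierIntegral_continuous Real.continuous_fourierChar
      (by exact continuous_inner) hf1
  have key : ∀ᵐ x, (𝓕 F : Lp ℂ 2 (volume : Measure ℝ)) x = 𝓕 f x := by
    apply ae_eq_of_integral_contDiff_smul_eq
    · exact (Lp.memLp (𝓕 F)).locallyIntegrable (by norm_num)
    · exact hcont.locallyIntegrable
    · intro g hg hgs
      have hgs' : HasCompactSupport (fun x => (g x : ℂ)) :=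
        hgs.comp_left (g := fun x : ℝ => (x : ℂ)) (by simp)
      have hg' : ContDiff ℝ (⊤ : ℕ∞) (fun x => (g x : ℂ)) :=
        Complex.ofRealCLM.contDiff.comp hg
      let φ : 𝓢(ℝ, ℂ) := hgs'.toSchwartzMap hg'
      have hφ : ∀ x, φ x = (g x : ℂ) := fun x => rfl
      have h1 := Lp.fourier_toTemperedDistribution_eq F
      have h2 := congrArg (fun T => T φ) h1
      simp only [TemperedDistribution.fourier_apply, Lp.toTemperedDistribution_apply] at h2
      have h3 : ∫ x, (𝓕 φ) x • F x = ∫ x, (𝓕 φ) x • f x := by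
        apply integral_congr_ae
        filter_upwards [hf2.coeFn_toLp] with x hx
        rw [hF, hx]
      have h4 : ∫ x, (𝓕 φ) x • f x = ∫ x, φ x • 𝓕 f x := by
        have := VectorFourier.integral_fourierIntegral_smul_eq_flip (L := innerₗ ℝ)
          (μ := volume) (ν := volume) (e := Real.fourierChar) (f := φ) (g := f)
          Real.continuous_fourierChar (by exact continuous_inner) φ.integrable hf1
        rw [SchwartzMap.fourier_coe]
        rw [flip_innerₗ] at this
        exact this
      have e1 : ∫ x, g x • (𝓕 F : Lp ℂ 2 (volume : Measure ℝ)) x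
          = ∫ x, φ x • (𝓕 F : Lp ℂ 2 (volume : Measure ℝ)) x := by
        congr 1
      have e2 : ∫ x, g x • 𝓕 f x = ∫ x, φ x • 𝓕 f x := by
        congr 1
      rw [e1, e2, ← h2, h3, h4]
  have h5 := Lp.norm_fourier_eq F
  rw [Lp.norm_def, Lp.norm_def, ENNReal.toReal_eq_toReal_iff' (Lp.eLpNorm_ne_top _) (Lp.eLpNorm_ne_top _)] at h5
  rw [eLpNorm_congr_ae (f := f) (g := F) hf2.coeFn_toLp.symm, ← h5]
  exact (eLpNorm_congr_ae key).symm


noncomputable section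

/-- Euler-Maclaurin remainder terms for `(s-1) ζ(s)`. -/
def emh (n : ℕ) (s : ℂ) : ℂ :=
  (s - 1) * (n : ℂ) ^ (-s) - ((n : ℂ) ^ (1 - s) - ((n + 1 : ℕ) : ℂ) ^ (1 - s))

lemma emh_differentiable {n : ℕ} (hn : 1 ≤ n) : Differentiable ℂ (emh n) := by
  have h1 : (n : ℂ) ≠ 0 := by exact_mod_cast (by omega : n ≠ 0)
  have h2 : ((n + 1 : ℕ) : ℂ) ≠ 0 := by exact_mod_cast (by omega : n + 1 ≠ 0)
  unfold emh
  intro s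
  refine DifferentiableAt.sub (DifferentiableAt.mul (by fun_prop) ?_) (DifferentiableAt.sub ?_ ?_)
  · exact (differentiableAt_id.neg).const_cpow (Or.inl h1)
  · exact (by fun_prop : DifferentiableAt ℂ (fun s : ℂ => 1 - s) s).const_cpow (Or.inl h1)
  · exact (by fun_prop : DifferentiableAt ℂ (fun s : ℂ => 1 - s) s).const_cpow (Or.inl h2)

lemma cpow_neg_sub_le {n : ℕ} (hn : 1 ≤ n) {s : ℂ} (hs : 0 < s.re) {x : ℝ}
    (hx : x ∈ Set.Icc (n : ℝ) (n + 1)) :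
    ‖(x : ℂ) ^ (-s) - (n : ℂ) ^ (-s)‖ ≤ ‖s‖ * (n : ℝ) ^ (-s.re - 1) := by
  have hn0 : (0 : ℝ) < n := by exact_mod_cast hn
  have hs0 : s ≠ 0 := by intro h; simp [h] at hs
  have key := norm_image_sub_le_of_norm_deriv_le_segment' (a := (n : ℝ)) (b := (n : ℝ) + 1)
    (f := fun x : ℝ => (x : ℂ) ^ (-s)) (f' := fun x : ℝ => (-s) * (x : ℂ) ^ (-s - 1))
    (C := ‖s‖ * (n : ℝ) ^ (-s.re - 1)) ?_ ?_ x hx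
  · refine key.trans ?_
    have : 0 ≤ ‖s‖ * (n : ℝ) ^ (-s.re - 1) := by positivity
    nlinarith [hx.2]
  · intro y hy
    have hy0 : 0 < y := lt_of_lt_of_le hn0 hy.1
    exact (hasDerivAt_ofReal_cpow_const (x := y) hy0.ne' (r := -s) (by simpa using hs0)).hasDerivWithinAt
  · intro y hy
    have hy0 : 0 < y := lt_of_lt_of_le hn0 hy.1
    rw [norm_mul, norm_neg, Complex.norm_cpow_eq_rpow_re_of_pos hy0]
    apply mul_le_mul_of_nonneg_left _ (norm_nonneg _)
    simp only [Complex.sub_re, Complex.neg_re, Complex.one_re]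
    exact Real.rpow_le_rpow_of_nonpos hn0 hy.1 (by linarith)

lemma emh_norm_le {n : ℕ} (hn : 1 ≤ n) {s : ℂ} (hs : 0 < s.re) :
    ‖emh n s‖ ≤ ‖s - 1‖ * ‖s‖ * (n : ℝ) ^ (-s.re - 1) := by
  have hn0 : (0 : ℝ) < n := by exact_mod_cast hn
  by_cases hs1 : s = 1
  · subst hs1; simp [emh]
  have hs1' : 1 - s ≠ 0 := sub_ne_zero.mpr (Ne.symm hs1)
  have key := norm_image_sub_le_of_norm_deriv_le_segment' (a := (n : ℝ)) (b := (n : ℝ) + 1)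
    (f := fun x : ℝ => (x : ℂ) ^ (1 - s) + (s - 1) * (n : ℂ) ^ (-s) * x)
    (f' := fun x : ℝ => (1 - s) * (x : ℂ) ^ (-s) + (s - 1) * (n : ℂ) ^ (-s))
    (C := ‖s - 1‖ * ‖s‖ * (n : ℝ) ^ (-s.re - 1)) ?_ ?_ ((n : ℝ) + 1) ⟨by linarith, le_rfl⟩
  · have e : emh n s = ((((n : ℝ) + 1 : ℝ) : ℂ) ^ (1 - s) + (s - 1) * (n : ℂ) ^ (-s) * (((n : ℝ) + 1 : ℝ) : ℂ))
        - ((((n : ℝ)) : ℂ) ^ (1 - s) + (s - 1) * (n : ℂ) ^ (-s) * (((n : ℝ)) : ℂ)) := by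
      unfold emh; push_cast; ring
    rw [e]
    simpa using key
  · intro y hy
    have hy0 : 0 < y := lt_of_lt_of_le hn0 hy.1
    have h1 := hasDerivAt_ofReal_cpow_const (x := y) hy0.ne' (r := 1 - s) hs1'
    have h2 := (h1.add
      ((Complex.ofRealCLM.hasDerivAt (x := y)).const_mul ((s - 1) * (n : ℂ) ^ (-s))))
    have h3 := h2.hasDerivWithinAt (s := Set.Icc (n : ℝ) (n + 1))
    have e : 1 - s - 1 = -s := by ring
    rw [e] at h3
    simp only [Complex.ofRealCLM_apply, Complex.ofReal_one, mul_one] at h3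
    exact h3
  · intro y hy
    have e : (1 - s) * (y : ℂ) ^ (-s) + (s - 1) * (n : ℂ) ^ (-s)
      = (1 - s) * ((y : ℂ) ^ (-s) - (n : ℂ) ^ (-s)) := by ring
    rw [e, norm_mul, norm_sub_rev, mul_assoc]
    exact mul_le_mul_of_nonneg_left (cpow_neg_sub_le hn hs ⟨hy.1, hy.2.le⟩) (norm_nonneg _)

lemma emh_sum (N : ℕ) (s : ℂ) : ∑ n ∈ Finset.range N, emh (n + 1) s
    = (s - 1) * ∑ n ∈ Finset.range N, ((n + 1 : ℕ) : ℂ) ^ (-s) - (1 - ((N + 1 : ℕ) : ℂ) ^ (1 - s)) := by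
  induction N with
  | zero => simp
  | succ N ih =>
    rw [Finset.sum_range_succ, ih, Finset.sum_range_succ, emh]
    push_cast; ring

lemma emh_summable {s : ℂ} (hs : 0 < s.re) : Summable (fun n : ℕ => emh (n + 1) s) := by
  have h : Summable (fun n : ℕ => ((n + 1 : ℕ) : ℝ) ^ (-s.re - 1)) :=
    (summable_nat_add_iff 1 (f := fun n : ℕ => (n : ℝ) ^ (-s.re - 1))).mpr
      (Real.summable_nat_rpow.mpr (by linarith))
  refine Summable.of_norm_bounded (h.mul_left (‖s - 1‖ * ‖s‖)) ?_
  intro n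
  exact emh_norm_le (by omega) hs

lemma zeta1_eq_of_one_lt {s : ℂ} (hs : 1 < s.re) :
    riemannZeta₁ s = 1 + ∑' n : ℕ, emh (n + 1) s := by
  have hs1 : s ≠ 1 := by intro h; simp [h] at hs
  have h1 : Filter.Tendsto (fun N => ∑ n ∈ Finset.range N, emh (n + 1) s) Filter.atTop
      (nhds (∑' n : ℕ, emh (n + 1) s)) :=
    (emh_summable (by linarith)).hasSum.tendsto_sum_nat
  have hsum : Summable (fun n : ℕ => 1 / ((n : ℂ) + 1) ^ s) := by
    have := (summable_nat_add_iff 1).mpr (Complex.summable_one_div_nat_cpow.mpr hs)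
    simpa using this
  have h2 : Filter.Tendsto (fun N => ∑ n ∈ Finset.range N, ((n + 1 : ℕ) : ℂ) ^ (-s)) Filter.atTop
      (nhds (riemannZeta s)) := by
    rw [zeta_eq_tsum_one_div_nat_add_one_cpow hs]
    have := hsum.hasSum.tendsto_sum_nat
    refine this.congr ?_
    intro N
    apply Finset.sum_congr rfl
    intro n _
    rw [Complex.cpow_neg]; push_cast; rw [one_div]
  have h3 : Filter.Tendsto (fun N : ℕ => ((N + 1 : ℕ) : ℂ) ^ (1 - s)) Filter.atTop (nhds 0) := by
    rw [tendsto_zero_iff_norm_tendsto_zero]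
    have : Filter.Tendsto (fun x : ℝ => x ^ (-(s.re - 1))) Filter.atTop (nhds 0) :=
      tendsto_rpow_neg_atTop (by linarith)
    have h4 := this.comp ((tendsto_natCast_atTop_atTop (R := ℝ)).comp (Filter.tendsto_add_atTop_nat 1))
    refine h4.congr ?_
    intro N
    have : (0 : ℝ) < ((N + 1 : ℕ) : ℝ) := by positivity
    simp only [Function.comp]
    rw [← Complex.ofReal_natCast, Complex.norm_cpow_eq_rpow_re_of_pos this]
    simp
  have h4 := (h2.const_mul (s - 1)).sub ((tendsto_const_nhds (x := (1 : ℂ))).sub h3)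
  have h5 := tendsto_nhds_unique h1 (h4.congr (fun N => (emh_sum N s).symm))
  rw [h5, riemannZeta_eq_inv_sub_mul hs1]
  have : s - 1 ≠ 0 := sub_ne_zero.mpr hs1
  field_simp
  ring

lemma zeta1_eq {s : ℂ} (hs : 0 < s.re) :
    riemannZeta₁ s = 1 + ∑' n : ℕ, emh (n + 1) s := by
  have hU : IsOpen {z : ℂ | 0 < z.re} := isOpen_lt continuous_const Complex.continuous_re
  have hd : DifferentiableOn ℂ (fun z : ℂ => 1 + ∑' n : ℕ, emh (n + 1) z) {z : ℂ | 0 < z.re} := by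
    apply DifferentiableOn.const_add
    intro z hz
    simp only [Set.mem_ofPred_eq] at hz
    have hV : IsOpen ({w : ℂ | z.re / 2 < w.re} ∩ Metric.ball 0 (‖z‖ + 1)) :=
      (isOpen_lt continuous_const Complex.continuous_re).inter Metric.isOpen_ball
    have hzV : z ∈ {w : ℂ | z.re / 2 < w.re} ∩ Metric.ball 0 (‖z‖ + 1) := by
      constructor
      · simp only [Set.mem_ofPred_eq]; linarith
      · simp
    have := Complex.differentiableOn_tsum_of_summable_norm (F := fun (n : ℕ) (w : ℂ) => emh (n + 1) w)
      (U := {w : ℂ | z.re / 2 < w.re} ∩ Metric.ball 0 (‖z‖ + 1))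
      (u := fun n : ℕ => ((‖z‖ + 2) * (‖z‖ + 1)) * ((n + 1 : ℕ) : ℝ) ^ (-(z.re / 2) - 1)) ?_ ?_ hV ?_
    · exact (this.differentiableAt (hV.mem_nhds hzV)).differentiableWithinAt
    · have h : Summable (fun n : ℕ => ((n + 1 : ℕ) : ℝ) ^ (-(z.re / 2) - 1)) :=
        (summable_nat_add_iff 1 (f := fun n : ℕ => (n : ℝ) ^ (-(z.re / 2) - 1))).mpr
          (Real.summable_nat_rpow.mpr (by linarith))
      exact h.mul_left _
    · intro n
      exact (emh_differentiable (by omega)).differentiableOn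
    · rintro n w ⟨hw1, hw2⟩
      simp only [Set.mem_ofPred_eq] at hw1
      have hw3 : ‖w‖ < ‖z‖ + 1 := by simpa using hw2
      refine (emh_norm_le (by omega) (by linarith)).trans ?_
      have h1 : ‖w - 1‖ ≤ ‖z‖ + 2 := by
        have := norm_sub_le w 1
        simp only [norm_one] at this
        linarith
      have hn1 : (1 : ℝ) ≤ ((n + 1 : ℕ) : ℝ) := by push_cast; linarith [(Nat.cast_nonneg n : (0:ℝ) ≤ n)]
      have h2 : ((n + 1 : ℕ) : ℝ) ^ (-w.re - 1) ≤ ((n + 1 : ℕ) : ℝ) ^ (-(z.re / 2) - 1) :=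
        Real.rpow_le_rpow_of_exponent_le hn1 (by linarith)
      gcongr
  have h1 : AnalyticOnNhd ℂ riemannZeta₁ {z : ℂ | 0 < z.re} :=
    fun z _ => differentiable_riemannZeta₁.analyticAt z
  have h2 := hd.analyticOnNhd hU
  have hpre : IsPreconnected {z : ℂ | 0 < z.re} := (convex_halfSpace_re_gt 0).isPreconnected
  have := h1.eqOn_of_preconnected_of_eventuallyEq h2 hpre (z₀ := 2) (by simp) ?_
  · exact this hs
  · have : {z : ℂ | 1 < z.re} ∈ nhds (2 : ℂ) :=
      (isOpen_lt continuous_const Complex.continuous_re).mem_nhds (by simp)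
    filter_upwards [this] with z hz
    exact zeta1_eq_of_one_lt hz
end


lemma zeta1_growth : ∃ C > (0 : ℝ), ∀ s : ℂ, 1 - 1 / 256 ≤ s.re → s.re ≤ 3 →
    ‖riemannZeta₁ s‖ ≤ C * (2 + |s.im|) ^ ((1 : ℝ) + 1 / 32) := by
  have hA : Summable (fun n : ℕ => ((n + 1 : ℕ) : ℝ) ^ (-(1 : ℝ) - 1 / 256)) :=
    (summable_nat_add_iff 1 (f := fun n : ℕ => (n : ℝ) ^ (-(1 : ℝ) - 1 / 256))).mpr
      (Real.summable_nat_rpow.mpr (by norm_num))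
  have hB : Summable (fun n : ℕ => ((n + 1 : ℕ) : ℝ) ^ (-(5 : ℝ) / 4)) :=
    (summable_nat_add_iff 1 (f := fun n : ℕ => (n : ℝ) ^ (-(5 : ℝ) / 4))).mpr
      (Real.summable_nat_rpow.mpr (by norm_num))
  set A := ∑' n : ℕ, ((n + 1 : ℕ) : ℝ) ^ (-(1 : ℝ) - 1 / 256) with hAdef
  set B := ∑' n : ℕ, ((n + 1 : ℕ) : ℝ) ^ (-(5 : ℝ) / 4) with hBdef
  have hA0 : 0 ≤ A := tsum_nonneg (fun n => by positivity)
  have hB0 : 0 ≤ B := tsum_nonneg (fun n => by positivity)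
  refine ⟨2 * A + 2 + 2 * B, by positivity, ?_⟩
  intro s hs1 hs2
  set T := 2 + |s.im| with hT
  have hT2 : 2 ≤ T := by have := abs_nonneg s.im; linarith
  have hT0 : 0 < T := by linarith
  set M := ⌈T ^ 4⌉₊ with hM
  have hM1 : T ^ 4 ≤ ((M + 1 : ℕ) : ℝ) := by
    push_cast; have := Nat.le_ceil (T ^ 4); linarith
  have hM2 : ((M + 1 : ℕ) : ℝ) ≤ 2 * T ^ 4 := by
    have := Nat.ceil_lt_add_one (a := T ^ 4) (by positivity)
    have h16 : (2 : ℝ) ^ 4 ≤ T ^ 4 := by gcongr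
    push_cast; norm_num at h16; linarith
  have hM0 : (0 : ℝ) < ((M + 1 : ℕ) : ℝ) := by positivity
  have hMge1 : (1 : ℝ) ≤ ((M + 1 : ℕ) : ℝ) := by
    push_cast; have : (0 : ℝ) ≤ M := Nat.cast_nonneg _
    linarith
  have hpow : ∀ e : ℝ, 0 ≤ e → e ≤ 1 → ((M + 1 : ℕ) : ℝ) ^ e ≤ 2 * T ^ (4 * e) := by
    intro e he he1
    calc ((M + 1 : ℕ) : ℝ) ^ e ≤ (2 * T ^ 4) ^ e := Real.rpow_le_rpow hM0.le hM2 he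
      _ = 2 ^ e * T ^ (4 * e) := by
          rw [Real.mul_rpow (by norm_num) (by positivity), ← Real.rpow_natCast T 4, ← Real.rpow_mul hT0.le]
          norm_num
      _ ≤ 2 * T ^ (4 * e) := by
          gcongr
          calc (2 : ℝ) ^ e ≤ 2 ^ (1 : ℝ) := Real.rpow_le_rpow_of_exponent_le (by norm_num) he1
            _ = 2 := by norm_num
  have hre0 : 0 < s.re := by linarith
  have hn1 : ‖s - 1‖ ≤ T := by
    have := Complex.norm_le_abs_re_add_abs_im (s - 1)
    simp only [Complex.sub_re, Complex.one_re, Complex.sub_im, Complex.one_im, sub_zero] at this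
    have h3 : |s.re - 1| ≤ 2 := abs_le.mpr ⟨by linarith, by linarith⟩
    linarith
  have hn2 : ‖s‖ ≤ 2 * T := by
    have := Complex.norm_le_abs_re_add_abs_im s
    have h3 : |s.re| ≤ 3 := abs_le.mpr ⟨by linarith, by linarith⟩
    linarith
  have heq : riemannZeta₁ s = (s - 1) * ∑ n ∈ Finset.range M, ((n + 1 : ℕ) : ℂ) ^ (-s)
      + ((M + 1 : ℕ) : ℂ) ^ (1 - s) + ∑' n : ℕ, emh (n + M + 1) s := by
    rw [zeta1_eq hre0, ← (emh_summable hre0).sum_add_tsum_nat_add M, emh_sum]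
    ring
  have b1 : ‖∑ n ∈ Finset.range M, ((n + 1 : ℕ) : ℂ) ^ (-s)‖ ≤ 2 * T ^ ((1 : ℝ) / 32) * A := by
    calc ‖∑ n ∈ Finset.range M, ((n + 1 : ℕ) : ℂ) ^ (-s)‖
        ≤ ∑ n ∈ Finset.range M, ((M + 1 : ℕ) : ℝ) ^ ((1 : ℝ) / 128) * ((n + 1 : ℕ) : ℝ) ^ (-(1 : ℝ) - 1 / 256) := by
          apply norm_sum_le_of_le
          intro n hn
          have hn' := Finset.mem_range.mp hn
          have h0 : (0 : ℝ) < ((n + 1 : ℕ) : ℝ) := by positivity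
          have h1 : (1 : ℝ) ≤ ((n + 1 : ℕ) : ℝ) := by
            push_cast; have : (0 : ℝ) ≤ n := Nat.cast_nonneg _
            linarith
          rw [← Complex.ofReal_natCast, Complex.norm_cpow_eq_rpow_re_of_pos h0]
          calc ((n + 1 : ℕ) : ℝ) ^ (-s).re ≤ ((n + 1 : ℕ) : ℝ) ^ ((1 : ℝ) / 128 + (-(1 : ℝ) - 1 / 256)) := by
                apply Real.rpow_le_rpow_of_exponent_le h1
                simp only [Complex.neg_re]; linarith
            _ = ((n + 1 : ℕ) : ℝ) ^ ((1 : ℝ) / 128) * ((n + 1 : ℕ) : ℝ) ^ (-(1 : ℝ) - 1 / 256) :=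
                Real.rpow_add h0 _ _
            _ ≤ _ := by
                gcongr
      _ = ((M + 1 : ℕ) : ℝ) ^ ((1 : ℝ) / 128) * ∑ n ∈ Finset.range M, ((n + 1 : ℕ) : ℝ) ^ (-(1 : ℝ) - 1 / 256) := by
          rw [Finset.mul_sum]
      _ ≤ (2 * T ^ ((1 : ℝ) / 32)) * A := by
          gcongr
          · have := hpow (1 / 128) (by norm_num) (by norm_num)
            norm_num at this ⊢
            exact this
          · exact hA.sum_le_tsum _ (fun n _ => by positivity)
  have b2 : ‖((M + 1 : ℕ) : ℂ) ^ (1 - s)‖ ≤ 2 * T ^ ((1 : ℝ) + 1 / 32) := by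
    rw [← Complex.ofReal_natCast, Complex.norm_cpow_eq_rpow_re_of_pos hM0]
    calc ((M + 1 : ℕ) : ℝ) ^ (1 - s).re ≤ ((M + 1 : ℕ) : ℝ) ^ ((1 : ℝ) / 256) := by
          apply Real.rpow_le_rpow_of_exponent_le hMge1
          simp only [Complex.sub_re, Complex.one_re]; linarith
      _ ≤ 2 * T ^ (4 * ((1 : ℝ) / 256)) := hpow _ (by norm_num) (by norm_num)
      _ ≤ 2 * T ^ ((1 : ℝ) + 1 / 32) := by
          gcongr 2 * ?_
          exact Real.rpow_le_rpow_of_exponent_le (by linarith) (by norm_num)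
  have b3 : ‖∑' n : ℕ, emh (n + M + 1) s‖ ≤ 2 * T * B := by
    rw [hBdef, ← tsum_mul_left]
    refine tsum_of_norm_bounded (hB.mul_left (2 * T)).hasSum ?_
    intro n
    have h0 : (0 : ℝ) < ((n + M + 1 : ℕ) : ℝ) := by positivity
    have h1 : (1 : ℝ) ≤ ((n + M + 1 : ℕ) : ℝ) := by
      exact_mod_cast (by omega : 1 ≤ n + M + 1)
    have h2 : ((n + M + 1 : ℕ) : ℝ) ^ (-s.re - 1) ≤ T⁻¹ * ((n + 1 : ℕ) : ℝ) ^ (-(5 : ℝ) / 4) := by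
      calc ((n + M + 1 : ℕ) : ℝ) ^ (-s.re - 1) ≤ ((n + M + 1 : ℕ) : ℝ) ^ (-(1 : ℝ) / 4 + -(5 : ℝ) / 4) :=
            Real.rpow_le_rpow_of_exponent_le h1 (by linarith)
        _ = ((n + M + 1 : ℕ) : ℝ) ^ (-(1 : ℝ) / 4) * ((n + M + 1 : ℕ) : ℝ) ^ (-(5 : ℝ) / 4) :=
            Real.rpow_add h0 _ _
        _ ≤ T⁻¹ * ((n + 1 : ℕ) : ℝ) ^ (-(5 : ℝ) / 4) := by
            gcongr ?_ * ?_
            · calc ((n + M + 1 : ℕ) : ℝ) ^ (-(1 : ℝ) / 4) ≤ (T ^ 4) ^ (-(1 : ℝ) / 4) := by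
                    apply Real.rpow_le_rpow_of_nonpos (by positivity) _ (by norm_num)
                    refine hM1.trans ?_
                    exact_mod_cast (by omega : M + 1 ≤ n + M + 1)
                _ = T⁻¹ := by
                    rw [← Real.rpow_natCast T 4, ← Real.rpow_mul hT0.le]
                    norm_num
                    exact Real.rpow_neg_one T
            · apply Real.rpow_le_rpow_of_nonpos (by positivity) _ (by norm_num)
              exact_mod_cast (by omega : n + 1 ≤ n + M + 1)
    calc ‖emh (n + M + 1) s‖ ≤ ‖s - 1‖ * ‖s‖ * ((n + M + 1 : ℕ) : ℝ) ^ (-s.re - 1) :=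
          emh_norm_le (by omega) hre0
      _ ≤ T * (2 * T) * (T⁻¹ * ((n + 1 : ℕ) : ℝ) ^ (-(5 : ℝ) / 4)) := by gcongr
      _ = 2 * T * ((n + 1 : ℕ) : ℝ) ^ (-(5 : ℝ) / 4) := by field_simp
  have hTT : T * T ^ ((1 : ℝ) / 32) = T ^ ((1 : ℝ) + 1 / 32) := by
    rw [Real.rpow_add hT0, Real.rpow_one]
  have hTle : T ≤ T ^ ((1 : ℝ) + 1 / 32) := by
    calc T = T ^ (1 : ℝ) := (Real.rpow_one T).symm
      _ ≤ _ := Real.rpow_le_rpow_of_exponent_le (by linarith) (by norm_num)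
  rw [heq]
  calc _ ≤ ‖s - 1‖ * ‖∑ n ∈ Finset.range M, ((n + 1 : ℕ) : ℂ) ^ (-s)‖ + ‖((M + 1 : ℕ) : ℂ) ^ (1 - s)‖
        + ‖∑' n : ℕ, emh (n + M + 1) s‖ := by
        refine (norm_add_le _ _).trans ?_
        gcongr
        refine (norm_add_le _ _).trans ?_
        rw [norm_mul]
    _ ≤ T * (2 * T ^ ((1 : ℝ) / 32) * A) + 2 * T ^ ((1 : ℝ) + 1 / 32) + 2 * T * B := by gcongr
    _ = 2 * A * (T * T ^ ((1 : ℝ) / 32)) + 2 * T ^ ((1 : ℝ) + 1 / 32) + 2 * T * B := by ring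
    _ ≤ 2 * A * T ^ ((1 : ℝ) + 1 / 32) + 2 * T ^ ((1 : ℝ) + 1 / 32) + 2 * T ^ ((1 : ℝ) + 1 / 32) * B := by
        rw [hTT]; gcongr
    _ = _ := by ring

lemma zeta1_deriv_growth : ∃ C > (0 : ℝ), ∀ s : ℂ, 1 ≤ s.re → s.re ≤ 2 →
    ‖riemannZeta₁ s‖ ≤ C * (2 + |s.im|) ^ ((1 : ℝ) + 1 / 32) ∧
    ‖deriv riemannZeta₁ s‖ ≤ C * (2 + |s.im|) ^ ((1 : ℝ) + 1 / 32) ∧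
    ‖deriv (deriv riemannZeta₁) s‖ ≤ C * (2 + |s.im|) ^ ((1 : ℝ) + 1 / 32) := by
  obtain ⟨C, hC, h⟩ := zeta1_growth
  refine ⟨C * 4 * 2 * 256 ^ 2, by positivity, ?_⟩
  intro s h1 h2
  set T := 2 + |s.im| with hT
  have hT2 : 2 ≤ T := by have := abs_nonneg s.im; linarith
  have hT0 : 0 < T := by linarith
  have hP : 0 < T ^ ((1 : ℝ) + 1 / 32) := by positivity
  have hsph : ∀ z ∈ Metric.sphere s (1 / 256), ‖riemannZeta₁ z‖ ≤ C * 4 * T ^ ((1 : ℝ) + 1 / 32) := by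
    intro z hz
    have hz' : ‖z - s‖ = 1 / 256 := by simpa [dist_eq_norm] using hz
    have hre := (Complex.abs_re_le_norm (z - s)).trans hz'.le
    have him := (Complex.abs_im_le_norm (z - s)).trans hz'.le
    simp only [Complex.sub_re, Complex.sub_im] at hre him
    rw [abs_le] at hre
    have := h z (by linarith [hre.1]) (by linarith [hre.2])
    refine this.trans ?_
    have hle : 2 + |z.im| ≤ 2 * T := by
      have : |z.im| ≤ |z.im - s.im| + |s.im| := by
        have := abs_add_le (z.im - s.im) s.im; simpa using this
      linarith
    calc C * (2 + |z.im|) ^ ((1 : ℝ) + 1 / 32) ≤ C * (2 * T) ^ ((1 : ℝ) + 1 / 32) := by gcongr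
      _ = C * ((2 : ℝ) ^ ((1 : ℝ) + 1 / 32) * T ^ ((1 : ℝ) + 1 / 32)) := by
          rw [Real.mul_rpow (by norm_num) hT0.le]
      _ ≤ C * ((2 : ℝ) ^ (2 : ℝ) * T ^ ((1 : ℝ) + 1 / 32)) := by
          gcongr <;> norm_num
      _ = _ := by norm_num; ring
  have hd : DiffContOnCl ℂ riemannZeta₁ (Metric.ball s (1 / 256)) :=
    differentiable_riemannZeta₁.diffContOnCl
  have k1 := Complex.norm_iteratedDeriv_le_of_forall_mem_sphere_norm_le 1 (by norm_num) hd hsph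
  have k2 := Complex.norm_iteratedDeriv_le_of_forall_mem_sphere_norm_le 2 (by norm_num) hd hsph
  rw [iteratedDeriv_one] at k1
  rw [iteratedDeriv_succ, iteratedDeriv_one] at k2
  have hCP : 0 < C * T ^ ((1 : ℝ) + 1 / 32) := by positivity
  refine ⟨?_, ?_, ?_⟩
  · have := h s (by linarith) (by linarith)
    refine this.trans ?_
    rw [← hT]
    nlinarith
  · refine k1.trans ?_
    simp only [Nat.factorial]
    push_cast
    rw [div_le_iff₀ (by norm_num)]
    nlinarith
  · refine k2.trans ?_
    simp only [Nat.factorial]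
    push_cast
    rw [div_le_iff₀ (by norm_num)]
    nlinarith

open Complex in
lemma zeta1_341 : ∃ c > (0 : ℝ), ∀ x t : ℝ, 0 < x → x ≤ 1 → 1 ≤ |t| →
    c * x ^ 3 * (2 + |t|) ^ ((4 : ℝ) - 1 / 32) ≤ ‖riemannZeta₁ (1 + x + I * t)‖ ^ 4 := by
  obtain ⟨C, hC, h⟩ := zeta1_deriv_growth
  refine ⟨1 / ((4 * C) ^ 3 * 81 * (8 * C)), by positivity, ?_⟩
  intro x t hx hx1 ht
  have key := DirichletCharacter.norm_LFunction_product_ge_one (N := 1) 1 hx t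
  rw [DirichletCharacter.LFunctionTrivChar, DirichletCharacter.LFunction_modOne_eq, DirichletCharacter.LFunction_modOne_eq] at key
  have ht0 : t ≠ 0 := by rintro rfl; simp at ht; linarith
  set T := 2 + |t| with hT
  have hT0 : 0 < T := by positivity
  have hT3 : T ≤ 3 * |t| := by rw [hT]; linarith
  have e1 : (1 + (x : ℂ)) ≠ 1 := by
    simp [hx.ne']
  have e2 : (1 + (x : ℂ) + I * t) ≠ 1 := by
    intro hh
    have := congrArg Complex.im hh
    simp at this; exact ht0 this
  have e3 : (1 + (x : ℂ) + 2 * I * t) ≠ 1 := by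
    intro hh
    have := congrArg Complex.im hh
    simp at this; exact ht0 this
  rw [riemannZeta_eq_inv_sub_mul e1, riemannZeta_eq_inv_sub_mul e2, riemannZeta_eq_inv_sub_mul e3] at key
  simp only [norm_mul, norm_pow, norm_inv] at key
  have n1 : ‖(1 : ℂ) + x - 1‖ = x := by
    simp [abs_of_pos hx]
  have n2 : |t| ≤ ‖(1 : ℂ) + x + I * t - 1‖ := by
    have := Complex.abs_im_le_norm ((1 : ℂ) + x + I * t - 1)
    simpa using this
  have n3 : 2 * |t| ≤ ‖(1 : ℂ) + x + 2 * I * t - 1‖ := by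
    have := Complex.abs_im_le_norm ((1 : ℂ) + x + 2 * I * t - 1)
    simpa [abs_mul] using this
  have g1 : ‖riemannZeta₁ (1 + x)‖ ≤ 4 * C := by
    have := (h (1 + x) (by simp; linarith) (by simp; linarith)).1
    refine this.trans ?_
    have h2 : (2 : ℝ) ^ ((1 : ℝ) + 1 / 32) ≤ 2 ^ (2 : ℝ) :=
      Real.rpow_le_rpow_of_exponent_le (by norm_num) (by norm_num)
    simp only [add_im, one_im, ofReal_im, add_zero, abs_zero]
    norm_num at h2 ⊢
    nlinarith
  have g3 : ‖riemannZeta₁ (1 + x + 2 * I * t)‖ ≤ 4 * C * T ^ ((1 : ℝ) + 1 / 32) := by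
    have := (h (1 + x + 2 * I * t) (by simp; linarith) (by simp; linarith)).1
    refine this.trans ?_
    have h2 : (2 : ℝ) ^ ((1 : ℝ) + 1 / 32) ≤ 2 ^ (2 : ℝ) :=
      Real.rpow_le_rpow_of_exponent_le (by norm_num) (by norm_num)
    have him : (1 + (x : ℂ) + 2 * I * t).im = 2 * t := by simp
    rw [him]
    calc C * (2 + |2 * t|) ^ ((1 : ℝ) + 1 / 32) ≤ C * (2 * T) ^ ((1 : ℝ) + 1 / 32) := by
          gcongr
          rw [hT, abs_mul]; norm_num; linarith
      _ = C * ((2 : ℝ) ^ ((1 : ℝ) + 1 / 32) * T ^ ((1 : ℝ) + 1 / 32)) := by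
          rw [Real.mul_rpow (by norm_num) hT0.le]
      _ ≤ C * ((2 : ℝ) ^ (2 : ℝ) * T ^ ((1 : ℝ) + 1 / 32)) := by gcongr
      _ = _ := by norm_num; ring
  have i2 : ‖(1 : ℂ) + x + I * t - 1‖⁻¹ ≤ 3 / T := by
    rw [inv_le_comm₀ (by linarith) (by positivity), inv_div]
    linarith
  have i3 : ‖(1 : ℂ) + x + 2 * I * t - 1‖⁻¹ ≤ 2 / T := by
    rw [inv_le_comm₀ (by linarith) (by positivity), inv_div]
    linarith
  rw [n1] at key
  set g := ‖riemannZeta₁ (1 + x + I * t)‖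
  have key2 : 1 ≤ (x⁻¹ * (4 * C)) ^ 3 * (3 / T * g) ^ 4 * (2 / T * (4 * C * T ^ ((1 : ℝ) + 1 / 32))) := by
    refine le_trans key ?_
    gcongr
  have hTe : T ^ ((1 : ℝ) + 1 / 32) * T ^ ((4 : ℝ) - 1 / 32) = T ^ 5 := by
    rw [← Real.rpow_add hT0]; norm_num
  have hP : 0 < T ^ ((4 : ℝ) - 1 / 32) := by positivity
  have : x ^ 3 * T ^ ((4 : ℝ) - 1 / 32) ≤ ((4 * C) ^ 3 * 81 * (8 * C)) * g ^ 4 := by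
    calc x ^ 3 * T ^ ((4 : ℝ) - 1 / 32) ≤ (x ^ 3 * T ^ ((4 : ℝ) - 1 / 32)) * ((x⁻¹ * (4 * C)) ^ 3 * (3 / T * g) ^ 4 * (2 / T * (4 * C * T ^ ((1 : ℝ) + 1 / 32)))) := le_mul_of_one_le_right (by positivity) key2
      _ = ((4 * C) ^ 3 * 81 * (8 * C)) * g ^ 4 * (T ^ ((1 : ℝ) + 1 / 32) * T ^ ((4 : ℝ) - 1 / 32)) / T ^ 5 := by
        field_simp
        ring
      _ = _ := by rw [hTe]; field_simp
  rw [one_div, mul_assoc, inv_mul_le_iff₀ (by positivity)]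
  exact this

open Complex in
lemma zeta1_lower : ∃ c > (0 : ℝ), ∀ s : ℂ, 1 < s.re → s.re ≤ 2 →
    c * (2 + |s.im|) ^ ((7 : ℝ) / 8) ≤ ‖riemannZeta₁ s‖ := by
  obtain ⟨C, hC, h⟩ := zeta1_deriv_growth
  obtain ⟨c, hc, h341⟩ := zeta1_341
  -- compact part
  have hcomp : ∃ δ > (0 : ℝ), ∀ s : ℂ, 1 ≤ s.re → s.re ≤ 2 → |s.im| ≤ 1 → δ ≤ ‖riemannZeta₁ s‖ := by
    have hK : IsCompact (Set.Icc (1 : ℝ) 2 ×ℂ Set.Icc (-1 : ℝ) 1) :=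
      isCompact_Icc.reProdIm isCompact_Icc
    obtain ⟨s0, hs0, hmin⟩ := hK.exists_isMinOn (f := fun s => ‖riemannZeta₁ s‖)
      ⟨1, by simp [Complex.mem_reProdIm]⟩
      differentiable_riemannZeta₁.continuous.norm.continuousOn
    refine ⟨‖riemannZeta₁ s0‖, ?_, ?_⟩
    · rw [gt_iff_lt, norm_pos_iff]
      by_cases h1 : s0 = 1
      · rw [h1, riemannZeta₁_one]; exact one_ne_zero
      · intro h0
        have := riemannZeta_eq_inv_sub_mul h1
        rw [h0, mul_zero] at this
        rw [Complex.mem_reProdIm] at hs0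
        exact riemannZeta_ne_zero_of_one_le_re hs0.1.1 this
    · intro s h1 h2 h3
      apply hmin
      rw [Complex.mem_reProdIm]
      exact ⟨⟨h1, h2⟩, abs_le.mp h3⟩
  obtain ⟨δ, hδ, hcomp⟩ := hcomp
  set c1 := c ^ ((1 : ℝ) / 4) with hc1
  have hc1p : 0 < c1 := by positivity
  have hc14 : c1 ^ 4 = c := by
    rw [hc1, ← Real.rpow_natCast, ← Real.rpow_mul hc.le]; norm_num
  set d := min 1 (c1 / (2 * C)) with hd
  have hd0 : 0 < d := by rw [hd]; positivity
  have hd1 : d ≤ 1 := min_le_left _ _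
  have hd2 : C * d ≤ c1 / 2 := by
    have : d ≤ c1 / (2 * C) := min_le_right _ _
    calc C * d ≤ C * (c1 / (2 * C)) := by gcongr
      _ = c1 / 2 := by field_simp
  -- large x bound
  have hbig : ∀ x t : ℝ, 0 < x → x ≤ 1 → 1 ≤ |t| → d ^ 4 * (2 + |t|) ^ (-(5 : ℝ) / 32) ≤ x →
      c1 * d ^ 3 * (2 + |t|) ^ ((7 : ℝ) / 8) ≤ ‖riemannZeta₁ (1 + x + I * t)‖ := by
    intro x t hx hx1 ht hxx
    have := h341 x t hx hx1 ht
    set T := 2 + |t| with hT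
    have hT0 : 0 < T := by positivity
    have h4 : (c1 * d ^ 3 * T ^ ((7 : ℝ) / 8)) ^ 4 ≤ ‖riemannZeta₁ (1 + x + I * t)‖ ^ 4 := by
      refine le_trans ?_ this
      calc (c1 * d ^ 3 * T ^ ((7 : ℝ) / 8)) ^ 4 = c * (d ^ 4 * T ^ (-(5 : ℝ) / 32)) ^ 3 * T ^ ((4 : ℝ) - 1 / 32) := by
            rw [mul_pow, mul_pow, hc14, mul_pow, ← Real.rpow_natCast (T ^ ((7 : ℝ) / 8)),
              ← Real.rpow_natCast (T ^ (-(5 : ℝ) / 32)), ← Real.rpow_mul hT0.le, ← Real.rpow_mul hT0.le]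
            have : T ^ ((7 : ℝ) / 8 * (4 : ℕ)) = T ^ (-(5 : ℝ) / 32 * (3 : ℕ)) * T ^ ((4 : ℝ) - 1 / 32) := by
              rw [← Real.rpow_add hT0]; norm_num
            rw [this]; ring
        _ ≤ _ := by gcongr
    exact le_of_pow_le_pow_left₀ (by norm_num) (norm_nonneg _) h4
  refine ⟨min (δ / 3) (c1 * d ^ 3 / 2), by positivity, ?_⟩
  intro s hs1 hs2
  set T := 2 + |s.im| with hT
  have hT0 : 0 < T := by positivity
  have hT1 : 1 ≤ T := by rw [hT]; linarith [abs_nonneg s.im]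
  rcases le_total |s.im| 1 with ht | ht
  · calc min (δ / 3) (c1 * d ^ 3 / 2) * T ^ ((7 : ℝ) / 8) ≤ δ / 3 * T ^ (1 : ℝ) := by
          gcongr
          · exact min_le_left _ _
          · norm_num
      _ ≤ δ / 3 * 3 := by
          rw [Real.rpow_one]; gcongr; rw [hT]; linarith
      _ = δ := by ring
      _ ≤ _ := hcomp s hs1.le hs2 ht
  set x0 := d ^ 4 * T ^ (-(5 : ℝ) / 32) with hx0
  have hx0p : 0 < x0 := by positivity
  have hx01 : x0 ≤ 1 := by
    have : T ^ (-(5 : ℝ) / 32) ≤ 1 := Real.rpow_le_one_of_one_le_of_nonpos hT1 (by norm_num)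
    have h4 : d ^ 4 ≤ 1 := pow_le_one₀ hd0.le hd1
    rw [hx0]
    calc _ ≤ (1 : ℝ) * 1 := by gcongr
      _ = 1 := one_mul 1
  have hs : s = 1 + ((s.re - 1 : ℝ) : ℂ) + I * s.im := by
    apply Complex.ext <;> simp
  have hP : 0 < T ^ ((7 : ℝ) / 8) := by positivity
  rcases le_total x0 (s.re - 1) with hx | hx
  · have := hbig (s.re - 1) s.im (by linarith) (by linarith) ht hx
    rw [← hs] at this
    refine le_trans ?_ this
    gcongr
    refine (min_le_right _ _).trans ?_
    have : 0 < c1 * d ^ 3 := by positivity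
    linarith
  · have hb := hbig x0 s.im hx0p hx01 ht le_rfl
    set s1 : ℂ := 1 + x0 + I * s.im with hs1'
    have hs1re : s1.re = 1 + x0 := by simp [hs1']
    have hs1im : s1.im = s.im := by simp [hs1']
    have hdiff : ‖riemannZeta₁ s1 - riemannZeta₁ s‖ ≤ C * T ^ ((1 : ℝ) + 1 / 32) * ‖s1 - s‖ := by
      apply Convex.norm_image_sub_le_of_norm_deriv_le (s := segment ℝ s s1) (𝕜 := ℂ)
      · intro z _; exact differentiable_riemannZeta₁ z
      · intro z hz
        have hzim : z.im = s.im := by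
          obtain ⟨a, b, ha, hb, hab, rfl⟩ := hz
          simp [hs1im, ← add_mul, hab]
        have hzre : 1 ≤ z.re ∧ z.re ≤ 2 := by
          obtain ⟨a, b, ha, hb, hab, rfl⟩ := hz
          simp only [add_re, real_smul, mul_re, ofReal_re, ofReal_im, zero_mul, sub_zero, hs1re]
          constructor <;> nlinarith
        have := (h z hzre.1 hzre.2).2.1
        rwa [hzim] at this
      · exact convex_segment _ _
      · exact left_mem_segment _ _ _
      · exact right_mem_segment _ _ _
    have hn : ‖s1 - s‖ ≤ x0 := by
      have : s1 - s = ((x0 - (s.re - 1) : ℝ) : ℂ) := by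
        apply Complex.ext
        · simp [hs1re]; ring
        · simp [hs1im]
      rw [this, Complex.norm_real, Real.norm_eq_abs, abs_of_nonneg (by linarith)]
      linarith
    have hd3 : C * T ^ ((1 : ℝ) + 1 / 32) * ‖s1 - s‖ ≤ c1 * d ^ 3 / 2 * T ^ ((7 : ℝ) / 8) := by
      calc _ ≤ C * T ^ ((1 : ℝ) + 1 / 32) * x0 := by gcongr
        _ = (C * d) * d ^ 3 * T ^ ((7 : ℝ) / 8) := by
            have : T ^ ((7 : ℝ) / 8) = T ^ ((1 : ℝ) + 1 / 32) * T ^ (-(5 : ℝ) / 32) := by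
              rw [← Real.rpow_add hT0]; norm_num
            rw [this, hx0]; ring
        _ ≤ (c1 / 2) * d ^ 3 * T ^ ((7 : ℝ) / 8) := by gcongr
        _ = _ := by ring
    have htri : ‖riemannZeta₁ s1‖ ≤ ‖riemannZeta₁ s1 - riemannZeta₁ s‖ + ‖riemannZeta₁ s‖ := by
      have := norm_add_le (riemannZeta₁ s1 - riemannZeta₁ s) (riemannZeta₁ s)
      simpa using this
    calc min (δ / 3) (c1 * d ^ 3 / 2) * T ^ ((7 : ℝ) / 8) ≤ (c1 * d ^ 3 / 2) * T ^ ((7 : ℝ) / 8) := by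
          gcongr
          exact min_le_right _ _
      _ ≤ _ := by linarith

open Complex in
/-- second derivative of `1/G` along vertical lines -/
lemma inv_zeta1_deriv2 : ∃ C > (0 : ℝ), ∀ σ : ℝ, 0 < σ → σ ≤ 1 → ∀ ξ : ℝ,
    ‖iteratedDeriv 2 (fun ξ : ℝ => (riemannZeta₁ (1 + σ + 2 * Real.pi * I * ξ))⁻¹) ξ‖
      ≤ C * (1 + |ξ|) ^ (-(9 : ℝ) / 16) := by
  obtain ⟨C, hC, h⟩ := zeta1_deriv_growth
  obtain ⟨c, hc, hl⟩ := zeta1_lower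
  set B : ℝ := (2 * Real.pi) ^ 2 * (2 * C ^ 2 / c ^ 3 + C / c ^ 2) with hB
  refine ⟨B, by positivity, ?_⟩
  intro σ hσ hσ1 ξ
  set G := riemannZeta₁
  set z : ℝ → ℂ := fun ξ => 1 + σ + 2 * Real.pi * I * ξ with hz
  have zre : ∀ ξ, (z ξ).re = 1 + σ := by intro ξ; simp [hz]
  have zim : ∀ ξ, (z ξ).im = 2 * Real.pi * ξ := by intro ξ; simp [hz]
  have hzd : ∀ ξ, HasDerivAt z (2 * Real.pi * I) ξ := by
    intro ξ
    have h1 : HasDerivAt (fun y : ℝ => (y : ℂ)) 1 ξ := Complex.ofRealCLM.hasDerivAt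
    have h2 := (h1.const_mul (2 * Real.pi * I)).const_add (1 + σ : ℂ)
    rw [mul_one] at h2
    exact h2
  have hG0 : ∀ ξ, G (z ξ) ≠ 0 := by
    intro ξ h0
    have := hl (z ξ) (by rw [zre]; linarith) (by rw [zre]; linarith)
    change _ ≤ ‖G (z ξ)‖ at this
    rw [h0, norm_zero] at this
    have : 0 < c * (2 + |(z ξ).im|) ^ ((7 : ℝ) / 8) := by positivity
    linarith
  have dG : Differentiable ℂ G := differentiable_riemannZeta₁
  have dG' : Differentiable ℂ (deriv G) := dG.deriv
  have hGd : ∀ ξ, HasDerivAt (fun ξ => G (z ξ)) (deriv G (z ξ) * (2 * Real.pi * I)) ξ := fun ξ =>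
    (dG (z ξ)).hasDerivAt.comp ξ (hzd ξ)
  have hGd' : ∀ ξ, HasDerivAt (fun ξ => deriv G (z ξ)) (deriv (deriv G) (z ξ) * (2 * Real.pi * I)) ξ := fun ξ =>
    (dG' (z ξ)).hasDerivAt.comp ξ (hzd ξ)
  have d1 : deriv (fun ξ => (G (z ξ))⁻¹) = fun ξ => -(deriv G (z ξ) * (2 * Real.pi * I)) / (G (z ξ)) ^ 2 := by
    funext ξ
    exact ((hGd ξ).inv (hG0 ξ)).deriv
  rw [iteratedDeriv_succ, iteratedDeriv_one, d1]
  have d2 := (((hGd' ξ).mul_const (2 * Real.pi * I : ℂ)).neg).div ((hGd ξ).pow 2) (pow_ne_zero 2 (hG0 ξ))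
  have d3 : deriv (fun ξ => -(deriv G (z ξ) * (2 * Real.pi * I)) / (G (z ξ)) ^ 2) ξ
      = (2 * Real.pi * I) ^ 2 * (2 * (deriv G (z ξ)) ^ 2 / (G (z ξ)) ^ 3 - deriv (deriv G) (z ξ) / (G (z ξ)) ^ 2) := by
    refine d2.deriv.trans ?_
    have := hG0 ξ
    simp only [Pi.pow_apply, Pi.neg_apply, Nat.cast_ofNat]
    field_simp
    ring
  rw [d3]
  obtain ⟨-, u1, u2⟩ := h (z ξ) (by rw [zre]; linarith) (by rw [zre]; linarith)
  have lo := hl (z ξ) (by rw [zre]; linarith) (by rw [zre]; linarith)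
  set T := 2 + |(z ξ).im| with hT
  have hT0 : 0 < T := by positivity
  have hT1 : 1 + |ξ| ≤ T := by
    rw [hT, zim, abs_mul, abs_of_pos (by positivity : (0 : ℝ) < 2 * Real.pi)]
    have := Real.pi_gt_three
    nlinarith [abs_nonneg ξ]
  have hTone : 1 ≤ T := by linarith [abs_nonneg ξ]
  have hlo : 0 < c * T ^ ((7 : ℝ) / 8) := by positivity
  have b1 : ‖2 * (deriv G (z ξ)) ^ 2 / (G (z ξ)) ^ 3‖ ≤ 2 * C ^ 2 / c ^ 3 * T ^ (-(9 : ℝ) / 16) := by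
    rw [norm_div, norm_mul, norm_pow, norm_pow]
    calc ‖(2 : ℂ)‖ * ‖deriv G (z ξ)‖ ^ 2 / ‖G (z ξ)‖ ^ 3 ≤ 2 * (C * T ^ ((1 : ℝ) + 1 / 32)) ^ 2 / (c * T ^ ((7 : ℝ) / 8)) ^ 3 := by
          gcongr
          · simp
      _ = _ := by
          have : (T ^ ((1 : ℝ) + 1 / 32)) ^ 2 = T ^ (-(9 : ℝ) / 16) * (T ^ ((7 : ℝ) / 8)) ^ 3 := by
            rw [← Real.rpow_natCast, ← Real.rpow_natCast, ← Real.rpow_mul hT0.le, ← Real.rpow_mul hT0.le, ← Real.rpow_add hT0]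
            norm_num
          rw [mul_pow, mul_pow, this]
          field_simp
  have b2 : ‖deriv (deriv G) (z ξ) / (G (z ξ)) ^ 2‖ ≤ C / c ^ 2 * T ^ (-(9 : ℝ) / 16) := by
    rw [norm_div, norm_pow]
    calc ‖deriv (deriv G) (z ξ)‖ / ‖G (z ξ)‖ ^ 2 ≤ (C * T ^ ((1 : ℝ) + 1 / 32)) / (c * T ^ ((7 : ℝ) / 8)) ^ 2 := by
          gcongr
      _ ≤ (C * (T ^ (-(9 : ℝ) / 16) * (T ^ ((7 : ℝ) / 8)) ^ 2)) / (c * T ^ ((7 : ℝ) / 8)) ^ 2 := by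
          gcongr
          rw [← Real.rpow_natCast, ← Real.rpow_mul hT0.le, ← Real.rpow_add hT0]
          apply Real.rpow_le_rpow_of_exponent_le hTone
          norm_num
      _ = _ := by
          rw [mul_pow]
          field_simp
  have n1 : ‖(2 * Real.pi * I : ℂ) ^ 2‖ = (2 * Real.pi) ^ 2 := by
    rw [norm_pow]; simp [abs_of_pos Real.pi_pos]
  rw [norm_mul, n1]
  calc _ ≤ (2 * Real.pi) ^ 2 * (2 * C ^ 2 / c ^ 3 * T ^ (-(9 : ℝ) / 16) + C / c ^ 2 * T ^ (-(9 : ℝ) / 16)) := by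
        gcongr
        exact (norm_sub_le _ _).trans (add_le_add b1 b2)
    _ = B * T ^ (-(9 : ℝ) / 16) := by rw [hB]; ring
    _ ≤ B * (1 + |ξ|) ^ (-(9 : ℝ) / 16) := by
        gcongr ?_ * ?_
        apply Real.rpow_le_rpow_of_nonpos (by positivity) hT1 (by norm_num)


/-- partial sums of `μ(n)/n` -/
noncomputable def mm (y : ℝ) : ℝ :=
  ∑ n ∈ Finset.Icc 1 ⌊y⌋₊, (ArithmeticFunction.moebius n : ℝ) / n

lemma factor_split (Q : ℕ → Prop) (n : ℕ) (hn : n ≠ 0) : ∃ a b : ℕ, n = a * b ∧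
    (∀ p ∈ a.primeFactors, Q p) ∧ (∀ p ∈ b.primeFactors, ¬ Q p) := by
  induction n using induction_on_primes with
  | zero => exact absurd rfl hn
  | one => exact ⟨1, 1, by simp⟩
  | prime_mul p m hp ih =>
    obtain ⟨a, b, h, ha, hb⟩ := ih (by rintro rfl; simp at hn)
    have hm0 : m ≠ 0 := by rintro rfl; simp at hn
    have ha0 : a ≠ 0 := by rintro rfl; simp at h; exact hm0 h
    have hb0 : b ≠ 0 := by rintro rfl; simp at h; exact hm0 h
    by_cases hQ : Q p
    · refine ⟨p * a, b, by rw [h]; ring, ?_, hb⟩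
      intro q hq
      rw [Nat.primeFactors_mul hp.ne_zero ha0, Finset.mem_union, hp.primeFactors,
        Finset.mem_singleton] at hq
      rcases hq with rfl | hq
      · exact hQ
      · exact ha q hq
    · refine ⟨a, p * b, by rw [h]; ring, ha, ?_⟩
      intro q hq
      rw [Nat.primeFactors_mul hp.ne_zero hb0, Finset.mem_union, hp.primeFactors,
        Finset.mem_singleton] at hq
      rcases hq with rfl | hq
      · exact hQ
      · exact hb q hq

open Classical in
lemma sum_divisors_moebius_Q (Q : ℕ → Prop) (n : ℕ) (hn : n ≠ 0) :
    ∑ d ∈ n.divisors.filter (fun d => ∀ p ∈ d.primeFactors, Q p), ArithmeticFunction.moebius d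
      = 0 ∨ ∑ d ∈ n.divisors.filter (fun d => ∀ p ∈ d.primeFactors, Q p),
      ArithmeticFunction.moebius d = 1 := by
  obtain ⟨a, b, h, ha, hb⟩ := factor_split Q n hn
  have ha0 : a ≠ 0 := by rintro rfl; simp at h; exact hn h
  have hb0 : b ≠ 0 := by rintro rfl; simp at h; exact hn h
  have : n.divisors.filter (fun d => ∀ p ∈ d.primeFactors, Q p) = a.divisors := by
    ext d
    simp only [Finset.mem_filter, Nat.mem_divisors]
    constructor
    · rintro ⟨⟨h1, -⟩, h2⟩
      refine ⟨?_, ha0⟩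
      have hd0 : d ≠ 0 := by rintro rfl; simp at h1; exact hn h1
      rw [h] at h1
      apply Nat.Coprime.dvd_of_dvd_mul_right _ h1
      rw [← Nat.disjoint_primeFactors hd0 hb0, Finset.disjoint_left]
      intro p hp hp'
      exact hb p hp' (h2 p hp)
    · rintro ⟨h1, -⟩
      refine ⟨⟨h ▸ Dvd.dvd.mul_right h1 b, hn⟩, ?_⟩
      intro p hp
      exact ha p (Nat.primeFactors_mono h1 ha0 hp)
  rw [this]
  have h1 : ∑ d ∈ a.divisors, ArithmeticFunction.moebius d = if a = 1 then 1 else 0 := by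
    have := ArithmeticFunction.coe_mul_zeta_apply (f := ArithmeticFunction.moebius) (x := a)
    rw [← this, ArithmeticFunction.moebius_mul_coe_zeta, ArithmeticFunction.one_apply]
  rw [h1]
  split_ifs <;> simp

open Classical in
/-- For any set of primes the restricted sums of `μ(n)/n` are bounded by 2. -/
lemma abs_sum_moebius_Q_le (Q : ℕ → Prop) (y : ℝ) :
    |∑ n ∈ (Finset.Icc 1 ⌊y⌋₊).filter (fun n => ∀ p ∈ n.primeFactors, Q p),
      (ArithmeticFunction.moebius n : ℝ) / n| ≤ 2 := by
  set N := ⌊y⌋₊ with hN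
  set S := (Finset.Icc 1 N).filter (fun n => ∀ p ∈ n.primeFactors, Q p) with hS
  rcases Nat.eq_zero_or_pos N with h0 | hNpos
  · simp [hS, h0]
  have h1 : ∑ d ∈ S, ArithmeticFunction.moebius d * ((N / d : ℕ) : ℤ) =
      ∑ n ∈ Finset.Icc 1 N, ∑ d ∈ n.divisors.filter (fun d => ∀ p ∈ d.primeFactors, Q p),
        ArithmeticFunction.moebius d := by
    have : ∀ d ∈ S, ArithmeticFunction.moebius d * ((N / d : ℕ) : ℤ) =
        ∑ n ∈ (Finset.Icc 1 N).filter (fun n => d ∣ n), ArithmeticFunction.moebius d := by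
      intro d hd
      rw [Finset.sum_const, nsmul_eq_mul, mul_comm]
      congr 2
      have := Nat.Ioc_filter_dvd_card_eq_div N d
      rw [← this]
      congr 1
    rw [Finset.sum_congr rfl this]
    apply Finset.sum_comm'
    intro d n
    simp only [hS, Finset.mem_filter, Finset.mem_Icc, Nat.mem_divisors]
    constructor
    · rintro ⟨⟨⟨a1, a2⟩, a3⟩, ⟨a4, a5⟩, a6⟩
      exact ⟨⟨⟨a6, by omega⟩, a3⟩, a4, a5⟩
    · rintro ⟨⟨⟨a6, -⟩, a3⟩, a4, a5⟩
      have := Nat.le_of_dvd (by omega) a6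
      have := Nat.pos_of_dvd_of_pos a6 (by omega)
      exact ⟨⟨⟨by omega, by omega⟩, a3⟩, ⟨a4, a5⟩, a6⟩
  have h2 : |∑ d ∈ S, ArithmeticFunction.moebius d * ((N / d : ℕ) : ℤ)| ≤ N := by
    rw [h1]
    refine (Finset.abs_sum_le_sum_abs _ _).trans ?_
    calc _ ≤ ∑ n ∈ Finset.Icc 1 N, (1 : ℤ) := by
          apply Finset.sum_le_sum
          intro n hn
          rcases sum_divisors_moebius_Q Q n (by have := Finset.mem_Icc.mp hn; omega) with h | h <;>
          · rw [h]; norm_num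
      _ = N := by simp
  have h2' : |∑ d ∈ S, (ArithmeticFunction.moebius d : ℝ) * ((N / d : ℕ) : ℝ)| ≤ N := by
    have h2c := (Int.cast_le (R := ℝ)).mpr h2
    simp only [Int.cast_abs, Int.cast_sum, Int.cast_mul, Int.cast_natCast] at h2c
    exact h2c
  have h3 : |∑ d ∈ S, (ArithmeticFunction.moebius d : ℝ) * ((N : ℝ) / d - ((N / d : ℕ) : ℝ))| ≤ N := by
    refine (Finset.abs_sum_le_sum_abs _ _).trans ?_
    calc _ ≤ ∑ n ∈ S, (1 : ℝ) := by
          apply Finset.sum_le_sum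
          intro d hd
          have hd1 : 1 ≤ d := by
            simp only [hS, Finset.mem_filter, Finset.mem_Icc] at hd; omega
          rw [abs_mul]
          have m1 : |(ArithmeticFunction.moebius d : ℝ)| ≤ 1 := by
            exact_mod_cast ArithmeticFunction.abs_moebius_le_one
          have m2 : |((N : ℝ) / d - ((N / d : ℕ) : ℝ))| ≤ 1 := by
            have e : ((N / d : ℕ) : ℝ) = (⌊(N : ℝ) / d⌋₊ : ℝ) := by
              rw [Nat.floor_div_eq_div]
            rw [e]
            have h1 := Nat.floor_le (show 0 ≤ (N : ℝ) / d by positivity)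
            have h2 := Nat.lt_floor_add_one ((N : ℝ) / d)
            rw [abs_le]; constructor <;> linarith
          calc _ ≤ (1 : ℝ) * 1 := by gcongr
            _ = 1 := one_mul 1
      _ = (S.card : ℝ) := by simp
      _ ≤ N := by
          have := Finset.card_filter_le (Finset.Icc 1 N) (fun n => ∀ p ∈ n.primeFactors, Q p)
          rw [Nat.card_Icc] at this
          exact_mod_cast this
  have h4 : (N : ℝ) * ∑ n ∈ S, (ArithmeticFunction.moebius n : ℝ) / n =
      ∑ d ∈ S, (ArithmeticFunction.moebius d : ℝ) * ((N / d : ℕ) : ℝ) +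
      ∑ d ∈ S, (ArithmeticFunction.moebius d : ℝ) * ((N : ℝ) / d - ((N / d : ℕ) : ℝ)) := by
    rw [← Finset.sum_add_distrib, Finset.mul_sum]
    apply Finset.sum_congr rfl
    intro d _
    ring
  have hNr : (0 : ℝ) < N := by exact_mod_cast hNpos
  have h5 : (N : ℝ) * |∑ n ∈ S, (ArithmeticFunction.moebius n : ℝ) / n| ≤ N * 2 := by
    rw [← abs_of_pos hNr, ← abs_mul, abs_of_pos hNr, h4]
    refine (abs_add_le _ _).trans ?_
    linarith
  exact le_of_mul_le_mul_left h5 hNr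

lemma abs_mm_le (y : ℝ) : |mm y| ≤ 2 := by
  have := abs_sum_moebius_Q_le (fun _ => True) y
  simpa [mm] using this

lemma mm_eq_zero {y : ℝ} (hy : y < 1) : mm y = 0 := by
  have : ⌊y⌋₊ = 0 := Nat.floor_eq_zero.mpr hy
  simp [mm, this]

lemma mm_sub_le {v u : ℝ} (hv : 1 ≤ v) (hvu : v ≤ u) : |mm u - mm v| ≤ (u - v + 1) / v := by
  have hfl : ⌊v⌋₊ ≤ ⌊u⌋₊ := Nat.floor_le_floor hvu
  have h1 : mm u - mm v = ∑ n ∈ Finset.Ioc ⌊v⌋₊ ⌊u⌋₊, (ArithmeticFunction.moebius n : ℝ) / n := by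
    unfold mm
    rw [sub_eq_iff_eq_add']
    have := Finset.sum_Ioc_consecutive (fun n : ℕ => (ArithmeticFunction.moebius n : ℝ) / n)
      (Nat.zero_le ⌊v⌋₊) hfl
    exact this.symm
  rw [h1]
  refine (Finset.abs_sum_le_sum_abs _ _).trans ?_
  calc _ ≤ ∑ n ∈ Finset.Ioc ⌊v⌋₊ ⌊u⌋₊, 1 / v := by
        apply Finset.sum_le_sum
        intro n hn
        rw [Finset.mem_Ioc] at hn
        have hvn : v ≤ n := (Nat.floor_lt (by linarith)).mp hn.1 |>.le
        rw [abs_div]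
        have m1 : |(ArithmeticFunction.moebius n : ℝ)| ≤ 1 := by
            exact_mod_cast ArithmeticFunction.abs_moebius_le_one
        rw [Nat.abs_cast]
        gcongr
    _ = ((⌊u⌋₊ : ℝ) - ⌊v⌋₊) / v := by
        rw [Finset.sum_const, Nat.card_Ioc, nsmul_eq_mul, Nat.cast_sub hfl]; ring
    _ ≤ _ := by
        have a1 := Nat.floor_le (show 0 ≤ u by linarith)
        have a2 := Nat.lt_floor_add_one v
        gcongr
        linarith


open MeasureTheory in
lemma integrable_poly_exp_bound {f : ℝ → ℂ} (hf : AEStronglyMeasurable f) {K σ : ℝ} (hK : 0 ≤ K)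
    (hσ : 0 < σ) (n : ℕ) (hb : ∀ u, ‖f u‖ ≤ K * ((1 + |u|) ^ n * Real.exp (-(σ * |u|)))) :
    Integrable f := by
  have h2 : Integrable (fun u : ℝ => (1 + ‖u‖) ^ (-(2 : ℝ))) :=
    integrable_one_add_norm (by simp)
  refine Integrable.mono' (h2.const_mul (K * ((n + 2).factorial * Real.exp σ / σ ^ (n + 2)))) hf ?_
  refine Filter.Eventually.of_forall fun u => ?_
  refine (hb u).trans ?_
  rw [mul_assoc]
  refine mul_le_mul_of_nonneg_left ?_ hK
  have hu : 0 < 1 + |u| := by positivity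
  have h := Real.pow_div_factorial_le_exp (x := σ * (1 + |u|)) (by positivity) (n + 2)
  have e1 : (1 + ‖u‖) ^ (-(2 : ℝ)) = ((1 + |u|) ^ 2)⁻¹ := by
    rw [Real.rpow_neg (by positivity), Real.norm_eq_abs]; norm_cast
  rw [e1, Real.exp_neg]
  rw [div_le_iff₀ (by positivity), mul_pow, mul_add, mul_one, Real.exp_add] at h
  rw [div_mul_eq_mul_div, le_div_iff₀ (by positivity), ← div_eq_mul_inv, div_mul_eq_mul_div,
    div_le_iff₀ (by positivity), ← div_eq_mul_inv, div_mul_eq_mul_div, le_div_iff₀ (by positivity)]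
  calc (1 + |u|) ^ n * σ ^ (n + 2) * (1 + |u|) ^ 2 = σ ^ (n + 2) * (1 + |u|) ^ (n + 2) := by ring
    _ ≤ _ := by linarith

lemma measurable_mm : Measurable mm := by
  have : mm = (fun n : ℕ => ∑ n ∈ Finset.Icc 1 n, (ArithmeticFunction.moebius n : ℝ) / n) ∘ Nat.floor := rfl
  rw [this]
  exact (measurable_from_nat).comp Nat.measurable_floor

open MeasureTheory Complex in
lemma mellin_mm {s : ℂ} (hs : 0 < s.re) :
    mellin (fun t => (mm t : ℂ)) (-s) = (riemannZeta₁ (1 + s))⁻¹ := by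
  have hs0 : s ≠ 0 := by rintro rfl; simp at hs
  set f : ℕ → ℂ := fun n => (ArithmeticFunction.moebius n : ℂ) / n with hf
  have hterm : ∀ n, LSeries.term f s n = LSeries.term (fun n => (ArithmeticFunction.moebius n : ℂ)) (1 + s) n := by
    intro n
    rcases eq_or_ne n 0 with rfl | hn
    · simp
    · rw [LSeries.term_of_ne_zero hn, LSeries.term_of_ne_zero hn, hf,
        Complex.cpow_add _ _ (Nat.cast_ne_zero.mpr hn), Complex.cpow_one, div_div]
  have h1s : 1 < (1 + s).re := by simp [hs]
  have hsum : LSeriesSummable f s := by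
    have := ArithmeticFunction.LSeriesSummable_moebius_iff.mpr h1s
    unfold LSeriesSummable at this ⊢
    convert this using 1
    funext n; exact hterm n
  have hL : LSeries f s = LSeries (fun n => (ArithmeticFunction.moebius n : ℂ)) (1 + s) := by
    unfold LSeries
    exact tsum_congr hterm
  have hsumeq : ∀ N : ℕ, ∑ k ∈ Finset.Icc 1 N, f k = ((mm N : ℝ) : ℂ) := by
    intro N; simp [mm, hf]
  have hO : (fun n : ℕ => ∑ k ∈ Finset.Icc 1 n, f k) =O[Filter.atTop] fun n => (n : ℝ) ^ (0 : ℝ) := by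
    apply Asymptotics.IsBigO.of_bound 2
    refine Filter.Eventually.of_forall fun n => ?_
    rw [hsumeq]
    simpa using abs_mm_le n
  have key := LSeries_eq_mul_integral f le_rfl hs hsum hO
  have hz := ArithmeticFunction.LSeries_zeta_mul_Lseries_moebius h1s
  rw [ArithmeticFunction.LSeries_zeta_eq_riemannZeta h1s, ← hL, key,
    riemannZeta_eq_inv_sub_mul (by simpa using hs0)] at hz
  have h_integ : mellin (fun t => (mm t : ℂ)) (-s) =
      ∫ t in Set.Ioi (1 : ℝ), (∑ k ∈ Finset.Icc 1 ⌊t⌋₊, f k) * (t : ℂ) ^ (-(s + 1)) := by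
    unfold mellin
    have hsub : Set.Ioi (1 : ℝ) ⊆ Set.Ioi 0 := Set.Ioi_subset_Ioi zero_le_one
    rw [setIntegral_eq_of_subset_of_ae_sdiff_eq_zero (s := Set.Ioi (1 : ℝ)) (t := Set.Ioi 0)
      measurableSet_Ioi.nullMeasurableSet hsub]
    · apply setIntegral_congr_fun measurableSet_Ioi
      intro t ht
      dsimp only
      rw [hsumeq, smul_eq_mul, mul_comm]
      have : mm (⌊t⌋₊ : ℝ) = mm t := by simp [mm]
      rw [this]
      congr 2
      ring
    · have : ∀ᵐ t : ℝ, t ≠ 1 := by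
        simp [ae_iff]
      filter_upwards [this] with t ht hmem
      have : t < 1 := by
        have h2 := hmem.2
        simp only [Set.mem_Ioi, not_lt] at h2
        exact lt_of_le_of_ne h2 ht
      rw [mm_eq_zero this]; simp
  rw [h_integ]
  have e : (1 + s - 1) = s := by ring
  rw [e] at hz
  symm
  apply inv_eq_of_mul_eq_one_right
  refine Eq.trans ?_ hz
  field_simp

open MeasureTheory Complex FourierTransform in
lemma mm_plancherel : ∃ K : ENNReal, K < ⊤ ∧ ∀ σ : ℝ, 0 < σ → σ ≤ 1 →
    eLpNorm (fun u : ℝ => (-2 * Real.pi * I * u) ^ 2 • ((Real.exp (σ * u) * mm (Real.exp (-u)) : ℝ) : ℂ)) 2 volume ≤ K := by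
  obtain ⟨C, hC, h⟩ := inv_zeta1_deriv2
  refine ⟨eLpNorm (fun ξ : ℝ => C * (1 + |ξ|) ^ (-(9 : ℝ) / 16)) 2 volume, ?_, ?_⟩
  · have : MemLp (fun ξ : ℝ => C * (1 + |ξ|) ^ (-(9 : ℝ) / 16)) 2 volume := by
      rw [memLp_two_iff_integrable_sq_norm (by
        apply Measurable.aestronglyMeasurable; fun_prop)]
      have h2 : Integrable (fun u : ℝ => (1 + ‖u‖) ^ (-((9 : ℝ) / 8))) :=
        integrable_one_add_norm (by simp; norm_num)
      refine (h2.const_mul (C ^ 2)).congr (Filter.Eventually.of_forall fun u => ?_)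
      have hu : 0 < 1 + |u| := by positivity
      simp only [Real.norm_eq_abs]
      rw [sq_abs, mul_pow, ← Real.rpow_natCast ((1 + |u|) ^ (-(9 : ℝ) / 16)), ← Real.rpow_mul hu.le]
      norm_num
    exact this.2
  intro σ hσ hσ1
  set F : ℝ → ℂ := fun u => ((Real.exp (σ * u) * mm (Real.exp (-u)) : ℝ) : ℂ) with hF
  have hFm : Measurable F := by
    apply Complex.measurable_ofReal.comp
    exact (by fun_prop : Measurable fun u : ℝ => Real.exp (σ * u)).mul
      (measurable_mm.comp (by fun_prop))
  have hFb : ∀ u, ‖F u‖ ≤ 2 * Real.exp (-(σ * |u|)) := by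
    intro u
    rw [hF]
    simp only [Complex.norm_real, Real.norm_eq_abs, abs_mul, Real.abs_exp]
    rcases le_or_gt u 0 with hu | hu
    · rw [abs_of_nonpos hu]
      have := abs_mm_le (Real.exp (-u))
      have e : -(σ * -u) = σ * u := by ring
      rw [e]
      nlinarith [Real.exp_pos (σ * u)]
    · rw [mm_eq_zero (by rw [Real.exp_lt_one_iff]; linarith)]
      simp; positivity
  have h_integ : ∀ n : ℕ, Integrable (fun u : ℝ => u ^ n • F u) := by
    intro n
    apply integrable_poly_exp_bound (K := 2) (σ := σ) _ (by norm_num) hσ n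
    · intro u
      rw [norm_smul, norm_pow, Real.norm_eq_abs]
      calc |u| ^ n * ‖F u‖ ≤ (1 + |u|) ^ n * (2 * Real.exp (-(σ * |u|))) := by
            gcongr
            · linarith
            · exact hFb u
        _ = _ := by ring
    · apply Measurable.aestronglyMeasurable
      exact (by fun_prop : Measurable fun u : ℝ => u ^ n).smul hFm
  have hder := Real.iteratedDeriv_fourier (f := F) (N := 2) (n := 2) (fun n _ => h_integ n) le_rfl
  have hFF : 𝓕 F = fun ξ : ℝ => (riemannZeta₁ (1 + σ + 2 * Real.pi * I * (-ξ : ℝ)))⁻¹ := by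
    funext ξ
    have h1 := mellin_mm (s := σ - 2 * Real.pi * I * ξ) (by simp [hσ])
    rw [mellin_eq_fourier] at h1
    have e1 : (-(σ - 2 * Real.pi * I * ξ : ℂ)).re = -σ := by simp
    have e2 : (-(σ - 2 * Real.pi * I * ξ : ℂ)).im / (2 * Real.pi) = ξ := by
      simp
    rw [e1, e2] at h1
    have e3 : (fun u : ℝ => Real.exp (- -σ * u) • ((mm (Real.exp (-u)) : ℝ) : ℂ)) = F := by
      funext u; simp [hF]
    rw [e3] at h1
    rw [h1]
    congr 2
    push_cast; ring
  set H : ℝ → ℂ := fun u : ℝ => (-2 * Real.pi * I * u) ^ 2 • F u with hH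
  have hHm : AEStronglyMeasurable H := by
    apply Measurable.aestronglyMeasurable
    exact (by fun_prop : Measurable fun u : ℝ => (-2 * Real.pi * I * u : ℂ) ^ 2).smul hFm
  have hHnorm : ∀ u, ‖H u‖ = (2 * Real.pi) ^ 2 * (u ^ 2 * ‖F u‖) := by
    intro u
    simp [hH, abs_of_pos Real.pi_pos, mul_pow]
    ring
  have hH1 : Integrable H := by
    have := (h_integ 2).norm.const_mul ((2 * Real.pi) ^ 2)
    refine this.mono' hHm (Filter.Eventually.of_forall fun u => ?_)
    rw [hHnorm, norm_smul]
    simp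
  have hH2 : MemLp H 2 := by
    rw [memLp_two_iff_integrable_sq_norm hHm]
    have := (h_integ 4).norm.const_mul ((2 * Real.pi) ^ 4 * 2)
    refine this.mono' (hHm.norm.pow 2) (Filter.Eventually.of_forall fun u => ?_)
    rw [hHnorm, norm_smul]
    have b : ‖F u‖ ≤ 2 := by
      refine (hFb u).trans ?_
      have : Real.exp (-(σ * |u|)) ≤ 1 := by
        rw [Real.exp_le_one_iff]; have := abs_nonneg u; nlinarith
      linarith
    have hu4 : ‖u ^ 4‖ = u ^ 4 := by rw [Real.norm_eq_abs, abs_of_nonneg (by positivity)]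
    rw [hu4, Real.norm_eq_abs, abs_of_nonneg (by positivity)]
    calc ((2 * Real.pi) ^ 2 * (u ^ 2 * ‖F u‖)) ^ 2 = (2 * Real.pi) ^ 4 * (u ^ 4 * (‖F u‖ * ‖F u‖)) := by ring
      _ ≤ (2 * Real.pi) ^ 4 * (u ^ 4 * (2 * ‖F u‖)) := by gcongr
      _ = _ := by ring
  have hpl := plancherel_aux hH1 hH2
  change eLpNorm H 2 volume ≤ _
  rw [← hpl]
  apply eLpNorm_mono
  intro ξ
  have : 𝓕 H ξ = iteratedDeriv 2 (𝓕 F) ξ := by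
    rw [hder]
  rw [this, hFF]
  have hneg := iteratedDeriv_comp_neg 2 (fun ξ : ℝ => (riemannZeta₁ (1 + σ + 2 * Real.pi * I * ξ))⁻¹) ξ
  rw [hneg]
  have hb := h σ hσ hσ1 (-ξ)
  rw [abs_neg] at hb
  rw [norm_smul]
  have hpos : 0 ≤ C * (1 + |ξ|) ^ (-(9 : ℝ) / 16) := by positivity
  rw [Real.norm_eq_abs (C * _), abs_of_nonneg hpos]
  simpa using hb

open MeasureTheory Complex in
theorem mm_bound : ∃ C > (0 : ℝ), ∀ v : ℝ, 1 ≤ v → |mm v| ≤ C * (1 + Real.log v) ^ (-(4 : ℝ) / 3) := by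
  obtain ⟨K, hK, h⟩ := mm_plancherel
  set A : ℝ := (K ^ (2 : ℝ)).toReal with hA
  have hA0 : 0 ≤ A := ENNReal.toReal_nonneg
  -- cubic bound
  have hcub : ∀ u0 : ℝ, 1 ≤ u0 → 4 / Real.exp u0 ≤ |mm (Real.exp u0)| →
      |mm (Real.exp u0)| ^ 3 * u0 ^ 4 ≤ 32 * Real.exp 4 * A := by
    intro u0 hu0 hη
    set η := |mm (Real.exp u0)| with hηd
    have hη0 : 0 < η := lt_of_lt_of_le (by positivity) hη
    have hη2 : η ≤ 2 := abs_mm_le _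
    set σ := 1 / u0 with hσ
    have hu0p : 0 < u0 := by linarith
    have hσ0 : 0 < σ := by positivity
    have hσ1 : σ ≤ 1 := by rw [hσ, div_le_one hu0p]; exact hu0
    set ε : ℝ := u0 ^ 2 * Real.exp (-2) * (η / 2) with hε
    have hε0 : 0 < ε := by positivity
    have h2 := h σ hσ0 hσ1
    set H : ℝ → ℂ := fun u : ℝ => (-2 * Real.pi * I * u) ^ 2 • ((Real.exp (σ * u) * mm (Real.exp (-u)) : ℝ) : ℂ) with hH
    have hHm : AEStronglyMeasurable H := by
      apply Measurable.aestronglyMeasurable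
      refine (by fun_prop : Measurable fun u : ℝ => (-2 * Real.pi * I * u : ℂ) ^ 2).smul ?_
      apply Complex.measurable_ofReal.comp
      exact (by fun_prop : Measurable fun u : ℝ => Real.exp (σ * u)).mul
        (measurable_mm.comp (by fun_prop))
    have hlow : ∀ u ∈ Set.Icc (-u0 - η / 8) (-u0), ε ≤ ‖H u‖ := by
      intro u hu
      obtain ⟨h1, h2⟩ := hu
      have hn : ‖H u‖ = (2 * Real.pi) ^ 2 * (u ^ 2 * (Real.exp (σ * u) * |mm (Real.exp (-u))|)) := by
        simp only [hH, norm_smul, norm_pow, norm_mul, Complex.norm_real, Real.norm_eq_abs, Complex.norm_I, Real.abs_exp, norm_neg, Complex.norm_ofNat, mul_one, abs_of_pos Real.pi_pos, mul_pow, sq_abs]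
        ring
      rw [hn]
      have hsq : u0 ^ 2 ≤ u ^ 2 := by nlinarith
      have hexp : Real.exp (-2) ≤ Real.exp (σ * u) := by
        rw [Real.exp_le_exp, hσ, div_mul_eq_mul_div, one_mul, le_div_iff₀ hu0p]
        linarith
      have hmmd := mm_sub_le (v := Real.exp u0) (u := Real.exp (-u)) (Real.one_le_exp (by linarith))
        (Real.exp_le_exp.mpr (by linarith))
      have hrat : (Real.exp (-u) - Real.exp u0 + 1) / Real.exp u0 ≤ η / 2 := by
        have e1 : (Real.exp (-u) - Real.exp u0 + 1) / Real.exp u0 = Real.exp (-u - u0) - 1 + (4 / Real.exp u0) / 4 := by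
          rw [Real.exp_sub]; field_simp
        have hx1 : |-u - u0| ≤ 1 := by rw [abs_le]; constructor <;> linarith
        have := Real.abs_exp_sub_one_le hx1
        have e2 : |-u - u0| = -u - u0 := abs_of_nonneg (by linarith)
        rw [e2] at this
        have := (abs_le.mp this).2
        rw [e1]; linarith
      have hmm : η / 2 ≤ |mm (Real.exp (-u))| := by
        have := abs_sub_abs_le_abs_sub (mm (Real.exp u0)) (mm (Real.exp (-u)))
        rw [abs_sub_comm] at this
        linarith
      have hpi : 1 ≤ (2 * Real.pi) ^ 2 := by nlinarith [Real.pi_gt_three]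
      calc ε = 1 * (u0 ^ 2 * (Real.exp (-2) * (η / 2))) := by rw [hε]; ring
        _ ≤ _ := by gcongr
    have hcheb := mul_meas_ge_le_pow_eLpNorm' (p := 2) volume (by norm_num) (by norm_num) hHm (ENNReal.ofReal ε)
    have hmeas : ENNReal.ofReal (η / 8) ≤ volume {x | ENNReal.ofReal ε ≤ ‖H x‖ₑ} := by
      have e : ENNReal.ofReal (η / 8) = volume (Set.Icc (-u0 - η / 8) (-u0)) := by
        rw [Real.volume_Icc]; congr 1; ring
      rw [e]
      apply measure_mono
      intro u hu
      have := hlow u hu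
      change ENNReal.ofReal ε ≤ ‖H u‖ₑ
      rw [← ofReal_norm]
      exact ENNReal.ofReal_le_ofReal this
    have hfin : ENNReal.ofReal (ε ^ 2 * (η / 8)) ≤ K ^ (2 : ℝ) := by
      have e2 : (2 : ENNReal).toReal = 2 := by simp
      rw [e2] at hcheb
      calc ENNReal.ofReal (ε ^ 2 * (η / 8)) = ENNReal.ofReal ε ^ (2 : ℝ) * ENNReal.ofReal (η / 8) := by
            rw [ENNReal.ofReal_mul (by positivity), ENNReal.ofReal_rpow_of_pos hε0]; norm_cast
        _ ≤ ENNReal.ofReal ε ^ (2 : ℝ) * volume {x | ENNReal.ofReal ε ≤ ‖H x‖ₑ} := by gcongr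
        _ ≤ eLpNorm H 2 volume ^ (2 : ℝ) := hcheb
        _ ≤ K ^ (2 : ℝ) := by gcongr
    have hKfin : K ^ (2 : ℝ) ≠ ⊤ := (ENNReal.rpow_lt_top_of_nonneg (by norm_num) hK.ne).ne
    have hfin2 : ε ^ 2 * (η / 8) ≤ A := (ENNReal.ofReal_le_iff_le_toReal hKfin).mp hfin
    have e4 : Real.exp 4 * Real.exp (-2) ^ 2 = 1 := by
      rw [← Real.exp_nat_mul, ← Real.exp_add]; norm_num
    calc η ^ 3 * u0 ^ 4 = 32 * (Real.exp 4 * Real.exp (-2) ^ 2) * (u0 ^ 4 * (η / 2) ^ 2 * (η / 8)) := by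
          rw [e4]; ring
      _ = 32 * Real.exp 4 * (ε ^ 2 * (η / 8)) := by rw [hε]; ring
      _ ≤ _ := by gcongr
  set B : ℝ := 32 * Real.exp 4 * A with hB
  have hB0 : 0 ≤ B := by positivity
  set D : ℝ := 4 * (1 + B + 500) with hD
  have hD0 : 0 < D := by positivity
  refine ⟨D, hD0, ?_⟩
  intro v hv
  have hlog : 0 ≤ Real.log v := Real.log_nonneg hv
  set u0 := Real.log v with hu0
  have hv' : v = Real.exp u0 := (Real.exp_log (by linarith)).symm
  have hη2 : |mm v| ≤ 2 := abs_mm_le v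
  set η := |mm v| with hη
  have hη0 : 0 ≤ η := abs_nonneg _
  have hP : 0 < (1 + u0) ^ (-(4 : ℝ) / 3) := by positivity
  -- cube comparison
  have hcube : η ^ 3 * (1 + u0) ^ 4 ≤ D ^ 3 := by
    have hDD : 4 * (1 + B + 500) * 16 ≤ D ^ 3 := by
      have : (16 : ℝ) ≤ D ^ 2 := by nlinarith
      calc 4 * (1 + B + 500) * 16 ≤ D * D ^ 2 := by rw [← hD]; gcongr
        _ = D ^ 3 := by ring
    rcases le_total u0 1 with h1 | h1
    · calc η ^ 3 * (1 + u0) ^ 4 ≤ 2 ^ 3 * (1 + 1) ^ 4 := by gcongr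
        _ ≤ _ := by nlinarith
    · have h16 : (1 + u0) ^ 4 ≤ 16 * u0 ^ 4 := by
        calc (1 + u0) ^ 4 ≤ (2 * u0) ^ 4 := by gcongr; linarith
          _ = _ := by ring
      rcases le_total (4 / Real.exp u0) η with h2 | h2
      · have := hcub u0 h1 (by rw [hη, hv'] at h2; exact h2)
        rw [← hv', ← hη] at this
        calc η ^ 3 * (1 + u0) ^ 4 ≤ η ^ 3 * (16 * u0 ^ 4) := by gcongr
          _ = 16 * (η ^ 3 * u0 ^ 4) := by ring
          _ ≤ 16 * B := by gcongr
          _ ≤ _ := by nlinarith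
      · have h3 := Real.pow_div_factorial_le_exp (x := u0) hlog 4
        simp only [Nat.factorial] at h3
        norm_num at h3
        have h4 : η * u0 ^ 4 ≤ 96 := by
          have hp := Real.exp_pos u0
          calc η * u0 ^ 4 ≤ 4 / Real.exp u0 * (24 * Real.exp u0) := by
                gcongr; linarith
            _ = 96 := by field_simp; norm_num
        calc η ^ 3 * (1 + u0) ^ 4 ≤ η ^ 3 * (16 * u0 ^ 4) := by gcongr
          _ = 16 * (η ^ 2 * (η * u0 ^ 4)) := by ring
          _ ≤ 16 * (2 ^ 2 * 96) := by gcongr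
          _ ≤ _ := by nlinarith
  have h0 : 0 < 1 + u0 := by linarith
  apply le_of_pow_le_pow_left₀ (n := 3) (by norm_num) (by positivity)
  rw [mul_pow, ← Real.rpow_natCast ((1 + u0) ^ (-(4 : ℝ) / 3)), ← Real.rpow_mul h0.le]
  have e5 : (1 + u0) ^ (-(4 : ℝ) / 3 * (3 : ℕ)) = ((1 + u0) ^ 4)⁻¹ := by
    have : (-(4 : ℝ) / 3 * (3 : ℕ)) = -((4 : ℕ) : ℝ) := by norm_num
    rw [this, Real.rpow_neg h0.le, Real.rpow_natCast]
  rw [e5, ← div_eq_mul_inv, le_div_iff₀ (by positivity)]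
  exact hcube


/-- Abel summation with bounded partial sums and antitone weights. -/
lemma abel_bound (c : ℕ → ℂ) (g : ℕ → ℝ) (M : ℕ) (B : ℝ)
    (hg : ∀ m n, M + 1 ≤ m → m ≤ n → g n ≤ g m) (hg0 : ∀ n, M + 1 ≤ n → 0 ≤ g n)
    (hB : ∀ j, ‖∑ n ∈ Finset.Ioc M j, c n‖ ≤ B) (N : ℕ) :
    ‖∑ n ∈ Finset.Ioc M N, c n * (g n : ℂ)‖ ≤ B * g (M + 1) := by
  have hB0 : 0 ≤ B := (norm_nonneg _).trans (hB 0)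
  rcases le_or_gt N M with h | h
  · rw [Finset.Ioc_eq_empty (by omega)]
    simp
    exact mul_nonneg hB0 (hg0 _ le_rfl)
  have key : ‖∑ n ∈ Finset.Ioc M N, c n * (g n : ℂ) - (g N : ℂ) * ∑ n ∈ Finset.Ioc M N, c n‖
      ≤ B * (g (M + 1) - g N) := by
    induction N, h using Nat.le_induction with
    | base => simp [mul_comm]
    | succ N hN ih =>
      have hMN : M ≤ N := by omega
      rw [Finset.sum_Ioc_succ_top hMN, Finset.sum_Ioc_succ_top hMN]
      have e : ∑ n ∈ Finset.Ioc M N, c n * (g n : ℂ) + c (N + 1) * (g (N + 1) : ℂ) -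
          (g (N + 1) : ℂ) * (∑ n ∈ Finset.Ioc M N, c n + c (N + 1)) =
          (∑ n ∈ Finset.Ioc M N, c n * (g n : ℂ) - (g N : ℂ) * ∑ n ∈ Finset.Ioc M N, c n)
          + ((g N - g (N + 1) : ℝ) : ℂ) * ∑ n ∈ Finset.Ioc M N, c n := by push_cast; ring
      rw [e]
      have hd : 0 ≤ g N - g (N + 1) := sub_nonneg.mpr (hg N (N + 1) hN (by omega))
      calc _ ≤ B * (g (M + 1) - g N) + (g N - g (N + 1)) * B := by
            refine (norm_add_le _ _).trans (add_le_add ih ?_)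
            rw [norm_mul, Complex.norm_real, Real.norm_eq_abs, abs_of_nonneg hd]
            exact mul_le_mul_of_nonneg_left (hB N) hd
        _ = _ := by ring
  have h2 : ‖(g N : ℂ) * ∑ n ∈ Finset.Ioc M N, c n‖ ≤ g N * B := by
    rw [norm_mul, Complex.norm_real, Real.norm_eq_abs, abs_of_nonneg (hg0 N h)]
    exact mul_le_mul_of_nonneg_left (hB N) (hg0 N h)
  have h3 := norm_add_le (∑ n ∈ Finset.Ioc M N, c n * (g n : ℂ) - (g N : ℂ) * ∑ n ∈ Finset.Ioc M N, c n)
    ((g N : ℂ) * ∑ n ∈ Finset.Ioc M N, c n)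
  rw [sub_add_cancel] at h3
  linarith

lemma abel_bound_real (c : ℕ → ℝ) (g : ℕ → ℝ) (M : ℕ) (B : ℝ)
    (hg : ∀ m n, M + 1 ≤ m → m ≤ n → g n ≤ g m) (hg0 : ∀ n, M + 1 ≤ n → 0 ≤ g n)
    (hB : ∀ j, |∑ n ∈ Finset.Ioc M j, c n| ≤ B) (N : ℕ) :
    |∑ n ∈ Finset.Ioc M N, c n * g n| ≤ B * g (M + 1) := by
  have := abel_bound (fun n => (c n : ℂ)) g M B hg hg0 (by
    intro j
    rw [← Complex.ofReal_sum, Complex.norm_real]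
    exact hB j) N
  have e : ∑ n ∈ Finset.Ioc M N, ((c n : ℂ)) * (g n : ℂ) = ((∑ n ∈ Finset.Ioc M N, c n * g n : ℝ) : ℂ) := by
    push_cast; rfl
  rw [e, Complex.norm_real] at this
  exact this

lemma char_sum_range {k : ℕ} [NeZero k] (χ : DirichletCharacter ℂ k) (hχ : χ ≠ 1) (N : ℕ) :
    ‖∑ n ∈ Finset.range N, χ (n : ZMod k)‖ ≤ k := by
  have hk : 0 < k := Nat.pos_of_ne_zero (NeZero.ne k)
  have hper : ∀ a : ℕ, ∑ n ∈ Finset.range k, χ ((a * k + n : ℕ) : ZMod k) = 0 := by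
    intro a
    have h0 := MulChar.sum_eq_zero_of_ne_one hχ
    rw [← h0]
    refine Finset.sum_bij' (fun n _ => (n : ZMod k)) (fun x _ => x.val) ?_ ?_ ?_ ?_ ?_
    · intro n _; exact Finset.mem_univ _
    · intro x _; exact Finset.mem_range.mpr (ZMod.val_lt x)
    · intro n hn
      exact ZMod.val_cast_of_lt (Finset.mem_range.mp hn)
    · intro x _
      exact ZMod.natCast_zmod_val x
    · intro n _
      simp
  have hblock : ∀ a : ℕ, ∑ n ∈ Finset.range (a * k), χ (n : ZMod k) = 0 := by
    intro a
    induction a with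
    | zero => simp
    | succ a ih =>
      rw [Nat.add_mul, one_mul, Finset.sum_range_add, ih, zero_add]
      exact hper a
  conv_lhs => rw [← Nat.div_add_mod' N k, Finset.sum_range_add, hblock, zero_add]
  refine (norm_sum_le_of_le (f := fun n => χ ((N / k * k + n : ℕ) : ZMod k)) (n := fun _ => 1) _ (fun n _ => χ.norm_le_one _)).trans ?_
  simp
  exact (Nat.mod_lt N hk).le

lemma char_sum_Ioc {k : ℕ} [NeZero k] (χ : DirichletCharacter ℂ k) (hχ : χ ≠ 1) (M N : ℕ) :
    ‖∑ n ∈ Finset.Ioc M N, χ (n : ZMod k)‖ ≤ 2 * k := by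
  rcases le_or_gt N M with h | h
  · rw [Finset.Ioc_eq_empty (by omega)]; simp
  have e : ∑ n ∈ Finset.Ioc M N, χ (n : ZMod k) = ∑ n ∈ Finset.range (N + 1), χ (n : ZMod k)
      - ∑ n ∈ Finset.range (M + 1), χ (n : ZMod k) := by
    have : Finset.Ioc M N = Finset.Ico (M + 1) (N + 1) := by
        ext; simp only [Finset.mem_Ioc, Finset.mem_Ico, Finset.mem_range, Finset.mem_insert]; omega
    rw [this, Finset.sum_Ico_eq_sub _ (by omega)]
  rw [e]
  refine (norm_sub_le _ _).trans ?_
  have := char_sum_range χ hχ (N + 1)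
  have := char_sum_range χ hχ (M + 1)
  linarith

/-- tail bound for `L(s,χ)`, `s > 1` real -/
lemma char_L_tail {k : ℕ} [NeZero k] (χ : DirichletCharacter ℂ k) (hχ : χ ≠ 1) (M : ℕ) :
    ‖χ.LFunction 1 - ∑ n ∈ Finset.Ioc 0 M, χ (n : ZMod k) / n‖ ≤ 2 * k / (M + 1) := by
  have hs : ∀ s : ℝ, 1 < s → ‖χ.LFunction s - ∑ n ∈ Finset.Ioc 0 M, χ (n : ZMod k) * ((((n : ℝ) ^ (-s)) : ℝ) : ℂ)‖ ≤ 2 * k / (M + 1) := by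
    intro s hs
    have hb : ∀ N, ‖∑ n ∈ Finset.Ioc M N, χ (n : ZMod k) * ((((n : ℝ) ^ (-s)) : ℝ) : ℂ)‖ ≤ 2 * k / (M + 1) := by
      intro N
      refine (abel_bound (fun n => χ (n : ZMod k)) (fun n => (n : ℝ) ^ (-s)) M (2 * k) ?_ ?_ (fun j => char_sum_Ioc χ hχ M j) N).trans ?_
      · intro m n hm hmn
        apply Real.rpow_le_rpow_of_nonpos (by exact_mod_cast (by omega : 0 < m)) (by exact_mod_cast hmn) (by linarith)
      · intro n _; positivity
      · rw [div_eq_mul_inv]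
        gcongr
        push_cast
        rw [← Real.rpow_neg_one]
        apply Real.rpow_le_rpow_of_exponent_le _ (by linarith)
        have : (0 : ℝ) ≤ M := Nat.cast_nonneg _
        linarith
    have hsum := (DirichletCharacter.LSeriesSummable_of_one_lt_re χ (s := s) (by simpa using hs)).hasSum.tendsto_sum_nat
    have hL : χ.LFunction s = ∑' n, LSeries.term (fun n => χ (n : ZMod k)) s n :=
      DirichletCharacter.LFunction_eq_LSeries χ (by simpa using hs)
    rw [← hL] at hsum
    have hsum2 := (hsum.comp (Filter.tendsto_add_atTop_nat 1)).sub_const (∑ n ∈ Finset.Ioc 0 M, χ (n : ZMod k) * ((((n : ℝ) ^ (-s)) : ℝ) : ℂ))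
    refine le_of_tendsto hsum2.norm ?_
    filter_upwards [Filter.eventually_ge_atTop M] with N hN
    have e : ∑ i ∈ Finset.range (N + 1), LSeries.term (fun n => χ (n : ZMod k)) s i
        = ∑ n ∈ Finset.Ioc 0 N, χ (n : ZMod k) * ((((n : ℝ) ^ (-s)) : ℝ) : ℂ) := by
      have hr : Finset.range (N + 1) = insert 0 (Finset.Ioc 0 N) := by
        ext; simp only [Finset.mem_Ioc, Finset.mem_Ico, Finset.mem_range, Finset.mem_insert]; omega
      rw [hr, Finset.sum_insert (by simp), LSeries.term_zero, zero_add]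
      apply Finset.sum_congr rfl
      intro n hn
      have hn0 : n ≠ 0 := by have := Finset.mem_Ioc.mp hn; omega
      rw [LSeries.term_of_ne_zero hn0, Complex.ofReal_cpow (Nat.cast_nonneg n), div_eq_mul_inv,
        ← Complex.cpow_neg]
      push_cast; rfl
    simp only [Function.comp_apply]
    rw [e, ← Finset.sum_Ioc_consecutive _ (Nat.zero_le M) hN, add_sub_cancel_left]
    exact hb N
  have hcont : Filter.Tendsto (fun s : ℝ => ‖χ.LFunction s - ∑ n ∈ Finset.Ioc 0 M, χ (n : ZMod k) * ((((n : ℝ) ^ (-s)) : ℝ) : ℂ)‖)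
      (nhdsWithin 1 (Set.Ioi 1)) (nhds ‖χ.LFunction ((1 : ℝ) : ℂ) - ∑ n ∈ Finset.Ioc 0 M, χ (n : ZMod k) * ((((n : ℝ) ^ (-(1 : ℝ))) : ℝ) : ℂ)‖) := by
    apply Filter.Tendsto.norm
    apply Filter.Tendsto.mono_left _ nhdsWithin_le_nhds
    apply Filter.Tendsto.sub
    · have h1 : Continuous χ.LFunction := (DirichletCharacter.differentiable_LFunction hχ).continuous
      exact (h1.comp Complex.continuous_ofReal).tendsto 1
    · apply tendsto_finsetSum
      intro n hn
      have hn0 : 0 < n := (Finset.mem_Ioc.mp hn).1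
      apply Filter.Tendsto.const_mul
      apply (Complex.continuous_ofReal.tendsto _).comp
      have : Continuous fun s : ℝ => (n : ℝ) ^ (-s) :=
        Continuous.rpow continuous_const continuous_neg (fun _ => Or.inl (by positivity))
      exact this.tendsto 1
  have := le_of_tendsto hcont (by
    filter_upwards [self_mem_nhdsWithin] with s hs'
    exact hs s hs')
  simpa [Real.rpow_neg_one, div_eq_mul_inv] using this

lemma char_log_sum {k : ℕ} [NeZero k] (χ : DirichletCharacter ℂ k) (hχ : χ ≠ 1) :
    ∃ B : ℝ, ∀ N : ℕ, ‖∑ n ∈ Finset.Ioc 0 N, χ (n : ZMod k) * ((Real.log n / n : ℝ) : ℂ)‖ ≤ B := by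
  have h3 : ∀ N : ℕ, ‖∑ n ∈ Finset.Ioc (2 : ℕ) N, χ (n : ZMod k) * ((Real.log n / n : ℝ) : ℂ)‖ ≤ 2 * k * (Real.log (2 + 1 : ℕ) / (2 + 1 : ℕ)) := by
    intro N
    apply abel_bound (fun n => χ (n : ZMod k)) (fun n => Real.log n / n) 2 (2 * k) _ _ (fun j => char_sum_Ioc χ hχ 2 j) N
    · intro m n hm hmn
      have hm' : Real.exp 1 ≤ m := by
        have := Real.exp_one_lt_d9
        have h3 : (3 : ℝ) ≤ m := by exact_mod_cast hm
        linarith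
      have hn' : (m : ℝ) ≤ n := by exact_mod_cast hmn
      exact Real.log_div_self_antitoneOn hm' (hm'.trans hn') hn'
    · intro n hn
      have : (1 : ℝ) ≤ n := by exact_mod_cast (by omega : 1 ≤ n)
      have := Real.log_nonneg this
      positivity
  set c := ∑ n ∈ Finset.Ioc (0 : ℕ) 2, ‖χ (n : ZMod k) * ((Real.log n / n : ℝ) : ℂ)‖ with hc
  refine ⟨c + 2 * k * (Real.log (2 + 1 : ℕ) / (2 + 1 : ℕ)), fun N => ?_⟩
  have hlog3 : 0 ≤ Real.log (2 + 1 : ℕ) := Real.log_natCast_nonneg _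
  rcases le_or_gt 2 N with h | h
  · rw [← Finset.sum_Ioc_consecutive _ (Nat.zero_le 2) h]
    exact (norm_add_le _ _).trans (add_le_add (norm_sum_le _ _) (h3 N))
  · have h1 : ‖∑ n ∈ Finset.Ioc 0 N, χ (n : ZMod k) * ((Real.log n / n : ℝ) : ℂ)‖ ≤ c := by
      refine (norm_sum_le _ _).trans ?_
      apply Finset.sum_le_sum_of_subset_of_nonneg
      · intro x; simp; omega
      · intros; positivity
    have : 0 ≤ 2 * k * (Real.log (2 + 1 : ℕ) / (2 + 1 : ℕ)) := by positivity
    linarith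

open ArithmeticFunction in
lemma char_Lambda_sum {k : ℕ} [NeZero k] (χ : DirichletCharacter ℂ k) (hχ : χ ≠ 1) :
    ∃ B : ℝ, ∀ N : ℕ, ‖∑ n ∈ Finset.Ioc 0 N, χ (n : ZMod k) * ((vonMangoldt n / n : ℝ) : ℂ)‖ ≤ B := by
  obtain ⟨B, hB⟩ := char_log_sum χ hχ
  have hL : χ.LFunction 1 ≠ 0 := DirichletCharacter.LFunction_apply_one_ne_zero hχ
  set L := χ.LFunction 1
  have hLn : 0 < ‖L‖ := norm_pos_iff.mpr hL
  refine ⟨(B + 2 * k * (Real.log 4 + 4)) / ‖L‖, fun N => ?_⟩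
  rcases Nat.eq_zero_or_pos N with rfl | hN
  · simp
    have : 0 ≤ B := (norm_nonneg _).trans (hB 0)
    have : 0 ≤ Real.log 4 := Real.log_nonneg (by norm_num)
    positivity
  have hNr : (0 : ℝ) < N := by exact_mod_cast hN
  let f : ArithmeticFunction ℂ := ⟨fun n => χ (n : ZMod k) * ((vonMangoldt n / n : ℝ) : ℂ), by simp⟩
  let g : ArithmeticFunction ℂ := ⟨fun n => χ (n : ZMod k) / n, by simp⟩
  have hfg : ∀ n, (f * g) n = χ (n : ZMod k) * ((Real.log n / n : ℝ) : ℂ) := by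
    intro n
    rw [mul_apply]
    have : ∀ x ∈ n.divisorsAntidiagonal, f x.1 * g x.2 = χ (n : ZMod k) * ((vonMangoldt x.1 : ℝ) : ℂ) / n := by
      intro x hx
      have hx := (Nat.mem_divisorsAntidiagonal.mp hx).1
      change χ (x.1 : ZMod k) * ((vonMangoldt x.1 / x.1 : ℝ) : ℂ) * (χ (x.2 : ZMod k) / x.2) = _
      rw [← hx]
      push_cast
      rw [map_mul]
      ring
    rw [Finset.sum_congr rfl this, ← Finset.sum_div, ← Finset.mul_sum,
      Nat.sum_divisorsAntidiagonal (f := fun a _ => ((vonMangoldt a : ℝ) : ℂ)), ← Complex.ofReal_sum, vonMangoldt_sum]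
    push_cast; ring
  have key := sum_Ioc_mul_eq_sum_sum f g N
  simp_rw [hfg] at key
  have h2 : ‖L * ∑ n ∈ Finset.Ioc 0 N, f n - ∑ n ∈ Finset.Ioc 0 N, f n * ∑ m ∈ Finset.Ioc 0 (N / n), g m‖
      ≤ 2 * k * (Real.log 4 + 4) := by
    rw [Finset.mul_sum, ← Finset.sum_sub_distrib]
    have hpsi := Chebyshev.psi_le_const_mul_self hNr.le
    calc _ ≤ ∑ n ∈ Finset.Ioc 0 N, vonMangoldt n * (2 * k / N) := by
          apply norm_sum_le_of_le
          intro n hn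
          have hn0 : 0 < n := (Finset.mem_Ioc.mp hn).1
          have hn0r : (0 : ℝ) < n := by exact_mod_cast hn0
          have e : L * f n - f n * ∑ m ∈ Finset.Ioc 0 (N / n), g m = f n * (L - ∑ m ∈ Finset.Ioc 0 (N / n), g m) := by ring
          rw [e, norm_mul]
          have t := char_L_tail χ hχ (N / n)
          have hfn : ‖f n‖ ≤ vonMangoldt n / n := by
            change ‖χ (n : ZMod k) * ((vonMangoldt n / n : ℝ) : ℂ)‖ ≤ _
            have hv : 0 ≤ vonMangoldt n / n := div_nonneg vonMangoldt_nonneg hn0r.le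
            rw [norm_mul, Complex.norm_real, Real.norm_eq_abs, abs_of_nonneg hv]
            exact mul_le_of_le_one_left hv (χ.norm_le_one _)
          have hfl : (N : ℝ) / n ≤ ((N / n : ℕ) : ℝ) + 1 := by
            rw [← Nat.floor_div_eq_div (K := ℝ)]
            exact (Nat.lt_floor_add_one _).le
          have hv : 0 ≤ vonMangoldt n / n := div_nonneg vonMangoldt_nonneg hn0r.le
          calc ‖f n‖ * ‖L - ∑ m ∈ Finset.Ioc 0 (N / n), g m‖ ≤ (vonMangoldt n / n) * (2 * k / ((N : ℝ) / n)) := by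
                apply mul_le_mul hfn _ (norm_nonneg _) hv
                refine t.trans ?_
                gcongr
            _ = vonMangoldt n * (2 * k / N) := by field_simp
      _ = Chebyshev.psi N * (2 * k / N) := by
          rw [← Finset.sum_mul, Chebyshev.psi]; simp
      _ ≤ ((Real.log 4 + 4) * N) * (2 * k / N) := by gcongr
      _ = _ := by field_simp
  have h3 : ‖L‖ * ‖∑ n ∈ Finset.Ioc 0 N, f n‖ ≤ B + 2 * k * (Real.log 4 + 4) := by
    rw [← norm_mul]
    rw [← key] at h2
    have := norm_add_le (L * ∑ n ∈ Finset.Ioc 0 N, f n - ∑ n ∈ Finset.Ioc 0 N, χ (n : ZMod k) * ((Real.log n / n : ℝ) : ℂ)) (∑ n ∈ Finset.Ioc 0 N, χ (n : ZMod k) * ((Real.log n / n : ℝ) : ℂ))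
    rw [sub_add_cancel] at this
    have := hB N
    linarith
  rw [le_div_iff₀ hLn, mul_comm]
  exact h3


open ArithmeticFunction in
lemma mertens_Lambda : ∃ B > (0 : ℝ), ∀ N : ℕ, |∑ n ∈ Finset.Ioc 0 N, vonMangoldt n / n - Real.log N| ≤ B := by
  have hl4 : 0 ≤ Real.log 4 := Real.log_nonneg (by norm_num)
  refine ⟨Real.log 4 + 5, by positivity, fun N => ?_⟩
  rcases Nat.eq_zero_or_pos N with rfl | hN
  · simp; positivity
  have hNr : (0 : ℝ) < N := by exact_mod_cast hN
  have h1 := sum_Ioc_mul_zeta_eq_sum (vonMangoldt) N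
  rw [vonMangoldt_mul_zeta] at h1
  simp only [log_apply] at h1
  set A := ∑ n ∈ Finset.Ioc 0 N, vonMangoldt n / n with hA
  have hpsi := Chebyshev.psi_le_const_mul_self hNr.le
  have hpsi' : Chebyshev.psi N = ∑ n ∈ Finset.Ioc 0 N, vonMangoldt n := by
    rw [Chebyshev.psi]; simp
  have hup : ∑ n ∈ Finset.Ioc 0 N, vonMangoldt n * ((N / n : ℕ) : ℝ) ≤ N * A := by
    rw [hA, Finset.mul_sum]
    apply Finset.sum_le_sum
    intro n hn
    have : ((N / n : ℕ) : ℝ) ≤ (N : ℝ) / n := Nat.cast_div_le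
    calc _ ≤ vonMangoldt n * ((N : ℝ) / n) := mul_le_mul_of_nonneg_left this vonMangoldt_nonneg
      _ = _ := by ring
  have hlo : N * A - Chebyshev.psi N ≤ ∑ n ∈ Finset.Ioc 0 N, vonMangoldt n * ((N / n : ℕ) : ℝ) := by
    rw [hA, Finset.mul_sum, hpsi', ← Finset.sum_sub_distrib]
    apply Finset.sum_le_sum
    intro n hn
    have hfl : (N : ℝ) / n ≤ ((N / n : ℕ) : ℝ) + 1 := by
      rw [← Nat.floor_div_eq_div (K := ℝ)]
      exact (Nat.lt_floor_add_one _).le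
    calc _ = vonMangoldt n * ((N : ℝ) / n - 1) := by ring
      _ ≤ _ := mul_le_mul_of_nonneg_left (by linarith) vonMangoldt_nonneg
  have hlogup : ∑ n ∈ Finset.Ioc 0 N, Real.log n ≤ N * Real.log N := by
    calc _ ≤ ∑ n ∈ Finset.Ioc 0 N, Real.log N := by
          apply Finset.sum_le_sum
          intro n hn
          have := Finset.mem_Ioc.mp hn
          apply Real.log_le_log (by exact_mod_cast this.1) (by exact_mod_cast this.2)
      _ = _ := by simp
  have hloglo : N * Real.log N - N ≤ ∑ n ∈ Finset.Ioc 0 N, Real.log n := by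
    clear * -
    induction N with
    | zero => simp
    | succ N ih =>
      rw [Finset.sum_Ioc_succ_top (Nat.zero_le N)]
      rcases Nat.eq_zero_or_pos N with rfl | hN
      · simp
      have hNr : (0 : ℝ) < N := by exact_mod_cast hN
      have : N * (Real.log (N + 1) - Real.log N) ≤ 1 := by
        rw [← Real.log_div (by positivity) (by positivity)]
        have := Real.log_le_sub_one_of_pos (show 0 < ((N : ℝ) + 1) / N by positivity)
        calc _ ≤ N * (((N : ℝ) + 1) / N - 1) := by gcongr
          _ = 1 := by field_simp; ring
      push_cast
      linarith
  rw [h1] at hlogup hloglo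
  rw [abs_le]
  constructor
  · have : N * (Real.log N - 1) ≤ N * A := by linarith
    have := le_of_mul_le_mul_left this hNr
    linarith
  · have : N * A ≤ N * (Real.log N + (Real.log 4 + 4)) := by linarith
    have := le_of_mul_le_mul_left this hNr
    linarith

open ArithmeticFunction in
lemma nonprime_Lambda : ∃ B ≥ (0 : ℝ), ∀ s : Finset ℕ, ∑ n ∈ s, (if n.Prime then 0 else vonMangoldt n) / (n : ℝ) ≤ B := by
  have h := vonMangoldt.summable_residueClass_non_primes_div (q := 1) (0 : ZMod 1)
  have e : ∀ n, vonMangoldt.residueClass (0 : ZMod 1) n = vonMangoldt n := by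
    intro n
    simp only [vonMangoldt.residueClass]
    apply Set.indicator_of_mem
    exact Subsingleton.elim _ _
  simp only [e] at h
  have h0 : ∀ n : ℕ, 0 ≤ (if n.Prime then 0 else vonMangoldt n) / (n : ℝ) := by
    intro n
    split_ifs
    · simp
    · exact div_nonneg vonMangoldt_nonneg (Nat.cast_nonneg _)
  exact ⟨_, tsum_nonneg h0, fun s => h.sum_le_tsum s (fun n _ => h0 n)⟩

open ArithmeticFunction in
lemma trivchar_Lambda (k : ℕ) [NeZero k] : ∃ B : ℝ, ∀ N : ℕ,
    ‖∑ n ∈ Finset.Ioc 0 N, (1 : DirichletCharacter ℂ k) (n : ZMod k) * ((vonMangoldt n / n : ℝ) : ℂ) - (Real.log N : ℝ)‖ ≤ B := by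
  obtain ⟨B1, -, h1⟩ := mertens_Lambda
  obtain ⟨B2, -, h2⟩ := nonprime_Lambda
  set B3 := ∑ n ∈ Finset.Ioc 0 k, vonMangoldt n / n
  refine ⟨B1 + (B2 + B3), fun N => ?_⟩
  have e : ∑ n ∈ Finset.Ioc 0 N, (1 : DirichletCharacter ℂ k) (n : ZMod k) * ((vonMangoldt n / n : ℝ) : ℂ)
      = ((∑ n ∈ Finset.Ioc 0 N, vonMangoldt n / n - ∑ n ∈ (Finset.Ioc 0 N).filter (fun n => ¬ n.Coprime k), vonMangoldt n / n : ℝ) : ℂ) := by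
    rw [← Finset.sum_filter_add_sum_filter_not (Finset.Ioc 0 N) (fun n => ¬ n.Coprime k) (fun n => (vonMangoldt n / n : ℝ)), add_sub_cancel_left, Complex.ofReal_sum,
      Finset.sum_filter]
    apply Finset.sum_congr rfl
    intro n _
    by_cases hc : n.Coprime k
    · simp [hc, MulChar.one_apply ((ZMod.isUnit_iff_coprime n k).mpr hc)]
    · have : ¬ IsUnit (n : ZMod k) := fun h => hc ((ZMod.isUnit_iff_coprime n k).mp h)
      simp [hc, MulChar.map_nonunit _ this]
  rw [e, ← Complex.ofReal_sub, Complex.norm_real, Real.norm_eq_abs]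
  have h3 : ∑ n ∈ (Finset.Ioc 0 N).filter (fun n => ¬ n.Coprime k), vonMangoldt n / (n : ℝ) ≤ B2 + B3 := by
    have h0 : ∀ n : ℕ, 0 ≤ vonMangoldt n / (n : ℝ) := fun n => div_nonneg vonMangoldt_nonneg (Nat.cast_nonneg _)
    rw [← Finset.sum_filter_add_sum_filter_not _ (fun n => ¬ n.Prime)]
    apply add_le_add
    · refine le_trans (le_of_eq ?_) (h2 (((Finset.Ioc 0 N).filter (fun n => ¬ n.Coprime k)).filter (fun n => ¬ n.Prime)))
      apply Finset.sum_congr rfl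
      intro n hn
      rw [if_neg (Finset.mem_filter.mp hn).2]
    · apply Finset.sum_le_sum_of_subset_of_nonneg
      · intro n hn
        simp only [Finset.mem_filter, not_not, Finset.mem_Ioc] at hn ⊢
        refine ⟨hn.1.1.1, ?_⟩
        have := (Nat.Prime.coprime_iff_not_dvd hn.2).not.mp hn.1.2
        exact Nat.le_of_dvd (Nat.pos_of_ne_zero (NeZero.ne k)) (not_not.mp this)
      · intro n _ _; exact h0 n
  have h4 : 0 ≤ ∑ n ∈ (Finset.Ioc 0 N).filter (fun n => ¬ n.Coprime k), vonMangoldt n / (n : ℝ) :=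
    Finset.sum_nonneg (fun n _ => div_nonneg vonMangoldt_nonneg (Nat.cast_nonneg _))
  have := abs_le.mp (h1 N)
  rw [abs_le]
  constructor <;> linarith

open ArithmeticFunction in
lemma mertens_AP (k : ℕ) [NeZero k] (l : ℕ) (hl : l.Coprime k) : ∃ B > (0 : ℝ), ∀ N : ℕ,
    |∑ n ∈ Finset.Ioc 0 N, (if n.Prime ∧ n ≡ l [MOD k] then Real.log n / n else 0) - Real.log N / k.totient| ≤ B := by
  classical
  have hu : IsUnit (l : ZMod k) := (ZMod.isUnit_iff_coprime l k).mpr hl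
  have hall : ∀ χ : DirichletCharacter ℂ k, ∃ B : ℝ, ∀ N : ℕ,
      ‖∑ n ∈ Finset.Ioc 0 N, χ (n : ZMod k) * ((vonMangoldt n / n : ℝ) : ℂ) - (if χ = 1 then (Real.log N : ℂ) else 0)‖ ≤ B := by
    intro χ
    by_cases h : χ = 1
    · subst h
      simpa using trivchar_Lambda k
    · simpa [h] using char_Lambda_sum χ h
  choose B hB using hall
  obtain ⟨B2, hB20, h2⟩ := nonprime_Lambda
  have hφ : 0 < (k.totient : ℝ) := by exact_mod_cast Nat.totient_pos.mpr (Nat.pos_of_ne_zero (NeZero.ne k))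
  have hφC : (k.totient : ℂ) ≠ 0 := by exact_mod_cast hφ.ne'
  set S := ∑ χ, B χ with hS
  have hS0 : 0 ≤ S := Finset.sum_nonneg (fun χ _ => (norm_nonneg _).trans (hB χ 0))
  refine ⟨S / k.totient + B2 + 1, by positivity, fun N => ?_⟩
  have e : ((∑ n ∈ Finset.Ioc 0 N, vonMangoldt.residueClass (l : ZMod k) n / n - Real.log N / k.totient : ℝ) : ℂ)
      = (k.totient : ℂ)⁻¹ * ∑ χ : DirichletCharacter ℂ k, χ (l : ZMod k)⁻¹ *
        (∑ n ∈ Finset.Ioc 0 N, χ (n : ZMod k) * ((vonMangoldt n / n : ℝ) : ℂ) - (if χ = 1 then (Real.log N : ℂ) else 0)) := by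
    simp_rw [mul_sub, Finset.sum_sub_distrib, mul_sub]
    push_cast
    congr 1
    · simp_rw [vonMangoldt.residueClass_apply hu, Finset.mul_sum]
      rw [Finset.sum_comm]
      simp_rw [Finset.sum_div]
      apply Finset.sum_congr rfl; intro χ _
      apply Finset.sum_congr rfl; intro n _
      ring
    · have : ∀ χ : DirichletCharacter ℂ k, χ (l : ZMod k)⁻¹ * (if χ = 1 then (Complex.log N : ℂ) else 0) = if χ = 1 then (Complex.log N : ℂ) else 0 := by
        intro χ
        by_cases h : χ = 1
        · subst h
          have : IsUnit ((l : ZMod k)⁻¹) := by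
            rw [← ZMod.coe_unitOfCoprime l hl, ZMod.inv_coe_unit]; exact Units.isUnit _
          simp [MulChar.one_apply this]
        · simp [h]
      rw [Finset.sum_congr rfl (fun χ _ => this χ)]
      simp
      field_simp
  have h5 : |∑ n ∈ Finset.Ioc 0 N, vonMangoldt.residueClass (l : ZMod k) n / n - Real.log N / k.totient| ≤ S / k.totient := by
    rw [← Real.norm_eq_abs, ← Complex.norm_real, e, norm_mul, norm_inv, Complex.norm_natCast, div_eq_inv_mul]
    gcongr
    apply norm_sum_le_of_le
    intro χ _
    rw [norm_mul]
    exact (mul_le_of_le_one_left (norm_nonneg _) (χ.norm_le_one _)).trans (hB χ N)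
  have h6 : ∑ n ∈ Finset.Ioc 0 N, vonMangoldt.residueClass (l : ZMod k) n / n - ∑ n ∈ Finset.Ioc 0 N, (if n.Prime ∧ n ≡ l [MOD k] then Real.log n / n else 0)
    = ∑ n ∈ Finset.Ioc 0 N, (if n.Prime then 0 else vonMangoldt.residueClass (l : ZMod k) n) / n := by
    rw [← Finset.sum_sub_distrib]
    apply Finset.sum_congr rfl
    intro n _
    have hm : n ≡ l [MOD k] ↔ (n : ZMod k) = l := (ZMod.natCast_eq_natCast_iff n l k).symm
    by_cases hp : n.Prime
    · simp only [hp, true_and, if_true, zero_div, vonMangoldt.residueClass, Set.indicator_apply, Set.mem_ofPred_eq, hm]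
      split_ifs
      · rw [vonMangoldt_apply_prime hp]; simp
      · simp
    · simp [hp]
  have h7 : ∑ n ∈ Finset.Ioc 0 N, (if n.Prime then 0 else vonMangoldt.residueClass (l : ZMod k) n) / n ≤ B2 := by
    refine le_trans (Finset.sum_le_sum ?_) (h2 (Finset.Ioc 0 N))
    intro n _
    split_ifs
    · exact le_rfl
    · exact div_le_div_of_nonneg_right (vonMangoldt.residueClass_le _ n) (Nat.cast_nonneg _)
  have h8 : 0 ≤ ∑ n ∈ Finset.Ioc 0 N, (if n.Prime then 0 else vonMangoldt.residueClass (l : ZMod k) n) / n := by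
    apply Finset.sum_nonneg
    intro n _
    split_ifs
    · simp
    · exact div_nonneg (vonMangoldt.residueClass_nonneg _ n) (Nat.cast_nonneg _)
  rw [abs_le] at h5 ⊢
  constructor <;> linarith


/-- deviation of the residue class indicator from its mean, on primes -/
noncomputable def aa (k l n : ℕ) : ℝ :=
  if n.Prime then (if n ≡ l [MOD k] then 1 else 0) - 1 / (k.totient : ℝ) else 0

lemma mertens_prime : ∃ B > (0 : ℝ), ∀ N : ℕ,
    |∑ n ∈ Finset.Ioc 0 N, (if n.Prime then Real.log n / n else 0) - Real.log N| ≤ B := by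
  obtain ⟨B, hB, h⟩ := mertens_AP 1 0 (by simp)
  refine ⟨B, hB, fun N => ?_⟩
  simpa [Nat.modEq_one] using h N

lemma log_inv_anti (M : ℕ) (hM : 1 ≤ M) : ∀ m n : ℕ, M + 1 ≤ m → m ≤ n → 1 / Real.log n ≤ 1 / Real.log m := by
  intro m n hm hmn
  have h1 : 0 < Real.log m := Real.log_pos (by exact_mod_cast (by omega : 1 < m))
  apply one_div_le_one_div_of_le h1
  apply Real.log_le_log (by exact_mod_cast (by omega : 0 < m)) (by exact_mod_cast hmn)

lemma Ioc_sub (c : ℕ → ℝ) (M N : ℕ) (h : M ≤ N) : ∑ n ∈ Finset.Ioc M N, c n = ∑ n ∈ Finset.Ioc 0 N, c n - ∑ n ∈ Finset.Ioc 0 M, c n := by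
  rw [← Finset.sum_Ioc_consecutive _ (Nat.zero_le M) h]; ring

lemma Ioc_bound_of (c : ℕ → ℝ) (B : ℝ) (h : ∀ N, |∑ n ∈ Finset.Ioc 0 N, c n| ≤ B) (M N : ℕ) :
    |∑ n ∈ Finset.Ioc M N, c n| ≤ 2 * B := by
  have hB : 0 ≤ B := (abs_nonneg _).trans (h 0)
  rcases le_or_gt M N with h1 | h1
  · rw [Ioc_sub c M N h1]
    have := abs_le.mp (h N)
    have := abs_le.mp (h M)
    rw [abs_le]
    constructor <;> linarith
  · rw [Finset.Ioc_eq_empty (by omega)]; simp [hB]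

lemma aa_sum (k : ℕ) [NeZero k] (l : ℕ) (hl : l.Coprime k) : ∃ C > (0 : ℝ), ∀ M N : ℕ, 1 ≤ M →
    |∑ n ∈ Finset.Ioc M N, aa k l n / n| ≤ C / Real.log (M + 1) := by
  obtain ⟨B1, hB1, h1⟩ := mertens_AP k l hl
  obtain ⟨B2, hB2, h2⟩ := mertens_prime
  have hφ : 0 < (k.totient : ℝ) := by exact_mod_cast Nat.totient_pos.mpr (Nat.pos_of_ne_zero (NeZero.ne k))
  refine ⟨2 * (B1 + B2 / k.totient), by positivity, fun M N hM => ?_⟩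
  have hpart : ∀ N, |∑ n ∈ Finset.Ioc 0 N, aa k l n / n * Real.log n| ≤ B1 + B2 / k.totient := by
    intro N
    have e : ∑ n ∈ Finset.Ioc 0 N, aa k l n / n * Real.log n =
        (∑ n ∈ Finset.Ioc 0 N, (if n.Prime ∧ n ≡ l [MOD k] then Real.log n / n else 0) - Real.log N / k.totient)
        - (∑ n ∈ Finset.Ioc 0 N, (if n.Prime then Real.log n / n else 0) - Real.log N) / k.totient := by
      rw [sub_div, sub_sub_sub_cancel_right, Finset.sum_div, ← Finset.sum_sub_distrib]
      apply Finset.sum_congr rfl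
      intro n _
      unfold aa
      by_cases hp : n.Prime <;> by_cases hm : n ≡ l [MOD k] <;> simp [hp, hm] <;> ring
    rw [e]
    refine (abs_sub _ _).trans (add_le_add (h1 N) ?_)
    rw [abs_div, abs_of_pos hφ]
    gcongr
    exact h2 N
  have := abel_bound_real (fun n => aa k l n / n * Real.log n) (fun n => 1 / Real.log n) M (2 * (B1 + B2 / k.totient))
    (log_inv_anti M hM) (fun n hn => by
      have : 0 ≤ Real.log n := Real.log_natCast_nonneg _
      positivity) (fun j => Ioc_bound_of _ _ hpart M j) N
  have e2 : ∑ n ∈ Finset.Ioc M N, aa k l n / n = ∑ n ∈ Finset.Ioc M N, aa k l n / n * Real.log n * (1 / Real.log n) := by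
    apply Finset.sum_congr rfl
    intro n hn
    have : 0 < Real.log n := Real.log_pos (by exact_mod_cast (by have := (Finset.mem_Ioc.mp hn).1; omega : 1 < n))
    field_simp
  rw [e2]
  refine this.trans (le_of_eq ?_)
  push_cast
  ring

lemma prime_recip_Ioc : ∃ C > (0 : ℝ), ∀ M N : ℕ, 2 ≤ M → M ≤ N →
    ∑ p ∈ (Finset.Ioc M N).filter Nat.Prime, 1 / (p : ℝ) ≤ Real.log (Real.log N / Real.log M) + C := by
  obtain ⟨B2, hB2, h2⟩ := mertens_prime
  have hl2 : 0 < Real.log 2 := Real.log_pos (by norm_num)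
  refine ⟨2 * (B2 + 1) * (1 / Real.log 2), by positivity, fun M N hM hMN => ?_⟩
  have hpart : ∀ N : ℕ, |∑ n ∈ Finset.Ioc 0 N, ((if n.Prime then Real.log n / n else 0) - 1 / (n : ℝ))| ≤ B2 + 1 := by
    intro N
    rw [Finset.sum_sub_distrib]
    have hh : ∑ n ∈ Finset.Ioc 0 N, 1 / (n : ℝ) = (harmonic N : ℝ) := by
      rw [harmonic_eq_sum_Icc]
      push_cast
      simp only [one_div]
      rfl
    rw [hh]
    have a1 := abs_le.mp (h2 N)
    have a2 := harmonic_le_one_add_log N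
    have a3 := log_add_one_le_harmonic N
    have a4 : Real.log N ≤ Real.log (N + 1 : ℕ) := by
      rcases Nat.eq_zero_or_pos N with rfl | h
      · simp
      · apply Real.log_le_log (by exact_mod_cast h) (by push_cast; linarith)
    rw [abs_le]
    constructor <;> linarith
  have := abel_bound_real _ (fun n => 1 / Real.log n) M (2 * (B2 + 1))
    (log_inv_anti M (by omega)) (fun n hn => by
      have : 0 ≤ Real.log n := Real.log_natCast_nonneg _
      positivity) (fun j => Ioc_bound_of _ _ hpart M j) N
  have e2 : ∑ n ∈ Finset.Ioc M N, ((if n.Prime then Real.log n / n else 0) - 1 / (n : ℝ)) * (1 / Real.log n)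
     = ∑ p ∈ (Finset.Ioc M N).filter Nat.Prime, 1 / (p : ℝ) - ∑ n ∈ Finset.Ioc M N, 1 / (n * Real.log n) := by
    rw [Finset.sum_filter, ← Finset.sum_sub_distrib]
    apply Finset.sum_congr rfl
    intro n hn
    have : 0 < Real.log n := Real.log_pos (by exact_mod_cast (by have := (Finset.mem_Ioc.mp hn).1; omega : 1 < n))
    split_ifs <;> field_simp <;> simp
  rw [e2] at this
  have h3 : ∑ n ∈ Finset.Ioc M N, 1 / (n * Real.log n) ≤ Real.log (Real.log N / Real.log M) := by
    clear this e2
    induction N, hMN using Nat.le_induction with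
    | base => 
      have : 0 < Real.log M := Real.log_pos (by exact_mod_cast (by omega : 1 < M))
      simp [this.ne']
    | succ N hN ih =>
      rw [Finset.sum_Ioc_succ_top hN]
      have p1 : 0 < Real.log M := Real.log_pos (by exact_mod_cast (by omega : 1 < M))
      have p2 : 0 < Real.log N := Real.log_pos (by exact_mod_cast (by omega : 1 < N))
      have p3 : 0 < Real.log (N + 1 : ℕ) := Real.log_pos (by exact_mod_cast (by omega : 1 < N + 1))
      rw [Real.log_div p2.ne' p1.ne'] at ih
      rw [Real.log_div p3.ne' p1.ne']
      have hN0 : (0 : ℝ) < N := by exact_mod_cast (by omega : 0 < N)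
      have q1 := Real.log_le_sub_one_of_pos (div_pos p2 p3)
      rw [Real.log_div p2.ne' p3.ne'] at q1
      have q2 : 1 / ((N + 1 : ℕ) : ℝ) ≤ Real.log (N + 1 : ℕ) - Real.log N := by
        have := Real.log_le_sub_one_of_pos (show 0 < (N : ℝ) / (N + 1 : ℕ) by positivity)
        rw [Real.log_div (by positivity) (by positivity)] at this
        have e : (N : ℝ) / (N + 1 : ℕ) - 1 = - (1 / ((N + 1 : ℕ) : ℝ)) := by push_cast; field_simp; ring
        linarith
      have q3 : 1 / (((N + 1 : ℕ) : ℝ) * Real.log (N + 1 : ℕ)) ≤ 1 - Real.log N / Real.log (N + 1 : ℕ) := by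
        rw [← div_div, div_le_iff₀ p3, sub_mul, div_mul_cancel₀ _ p3.ne']
        linarith
      linarith
  have h4 : 1 / Real.log (M + 1 : ℕ) ≤ 1 / Real.log 2 := by
    apply one_div_le_one_div_of_le hl2
    apply Real.log_le_log (by norm_num)
    exact_mod_cast (by omega : 2 ≤ M + 1)
  have h5 := (abs_le.mp this).2
  have h6 : 2 * (B2 + 1) * (1 / Real.log (M + 1 : ℕ)) ≤ 2 * (B2 + 1) * (1 / Real.log 2) := by gcongr
  linarith

lemma prime_recip_le : ∃ C > (0 : ℝ), ∀ N : ℕ, 2 ≤ N →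
    ∑ p ∈ (Finset.Ioc 0 N).filter Nat.Prime, 1 / (p : ℝ) ≤ Real.log (Real.log N) + C := by
  obtain ⟨C, hC, h⟩ := prime_recip_Ioc
  refine ⟨C + 2 + |Real.log (Real.log 2)|, by positivity, fun N hN => ?_⟩
  have h1 := h 2 N le_rfl hN
  have p2 : 0 < Real.log 2 := Real.log_pos (by norm_num)
  have p3 : 0 < Real.log N := Real.log_pos (by exact_mod_cast (by omega : 1 < N))
  push_cast at h1
  rw [Real.log_div p3.ne' p2.ne'] at h1
  have h2 : ∑ p ∈ (Finset.Ioc 0 N).filter Nat.Prime, 1 / (p : ℝ) =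
    ∑ p ∈ (Finset.Ioc 0 2).filter Nat.Prime, 1 / (p : ℝ) + ∑ p ∈ (Finset.Ioc 2 N).filter Nat.Prime, 1 / (p : ℝ) := by
    rw [Finset.sum_filter, Finset.sum_filter, Finset.sum_filter, Finset.sum_Ioc_consecutive _ (by omega) hN]
  have h3 : ∑ p ∈ (Finset.Ioc 0 2).filter Nat.Prime, 1 / (p : ℝ) ≤ 2 := by
    rw [Finset.sum_filter]
    have : Finset.Ioc 0 2 = {1, 2} := by decide
    rw [this]
    simp [Nat.prime_two, Nat.not_prime_one]
    norm_num
  have := neg_abs_le (Real.log (Real.log 2))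
  linarith

lemma prime_log_le : ∃ C > (0 : ℝ), ∀ N : ℕ,
    ∑ p ∈ (Finset.Ioc 0 N).filter Nat.Prime, Real.log p / (p : ℝ) ≤ Real.log N + C := by
  obtain ⟨B2, hB2, h2⟩ := mertens_prime
  refine ⟨B2, hB2, fun N => ?_⟩
  rw [Finset.sum_filter]
  have := abs_le.mp (h2 N)
  linarith

/-- dyadic window -/
lemma prime_log_window (Y : ℝ) (hY : 0 < Y) (s : Finset ℕ) (hs : ∀ p ∈ s, p.Prime ∧ Y ≤ p ∧ (p : ℝ) ≤ 2 * Y) :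
    ∑ p ∈ s, Real.log p / (p : ℝ) ≤ 2 * Real.log 4 := by
  have hth := Chebyshev.theta_le_log4_mul_x (x := 2 * Y) (by positivity)
  have h1 : ∑ p ∈ s, Real.log p ≤ Chebyshev.theta (2 * Y) := by
    rw [Chebyshev.theta]
    apply Finset.sum_le_sum_of_subset_of_nonneg
    · intro p hp
      have := hs p hp
      simp only [Finset.mem_filter, Finset.mem_Ioc]
      exact ⟨⟨this.1.pos, Nat.le_floor this.2.2⟩, this.1⟩
    · intro i _ _; exact Real.log_natCast_nonneg _
  calc _ ≤ ∑ p ∈ s, Real.log p / Y := by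
        apply Finset.sum_le_sum
        intro p hp
        have := hs p hp
        apply div_le_div_of_nonneg_left (Real.log_natCast_nonneg _) hY this.2.1
    _ = (∑ p ∈ s, Real.log p) / Y := by rw [Finset.sum_div]
    _ ≤ (Real.log 4 * (2 * Y)) / Y := by gcongr; linarith
    _ = _ := by field_simp


lemma sum_inv_sq_bdd : ∃ C > (0 : ℝ), ∀ s : Finset ℕ, ∑ n ∈ s, 1 / (n : ℝ) ^ 2 ≤ C := by
  have h : Summable (fun n : ℕ => 1 / (n : ℝ) ^ 2) := Real.summable_one_div_nat_pow.mpr (by norm_num)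
  refine ⟨∑' n : ℕ, 1 / (n : ℝ) ^ 2 + 1, ?_, fun s => ?_⟩
  · have : 0 ≤ ∑' n : ℕ, 1 / (n : ℝ) ^ 2 := tsum_nonneg (fun n => by positivity)
    linarith
  · have := h.sum_le_tsum s (fun n _ => by positivity)
    linarith

lemma euler_bd (f : ℕ →* ℝ) (hf0 : ∀ n, 0 ≤ f n) (hf1 : ∀ p : ℕ, p.Prime → f p < 1) (s : Finset ℕ)
    (hs : ∀ p ∈ s, p.Prime → f p ≤ 5 / 6) (t : Finset ℕ) (ht : ∀ n ∈ t, n ∈ Nat.factoredNumbers s) :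
    ∑ n ∈ t, f n ≤ Real.exp (∑ p ∈ s.filter Nat.Prime, (f p + 6 * (f p) ^ 2)) := by
  have h := (EulerProduct.summable_and_hasSum_factoredNumbers_prod_filter_prime_geometric (f := f)
    (fun {p} hp => by rw [Real.norm_eq_abs, abs_of_nonneg (hf0 p)]; exact hf1 p hp) s).2
  have h1 : ∑ n ∈ t, f n ≤ ∏ p ∈ s with p.Prime, (1 - f p)⁻¹ := by
    have e : ∑ n ∈ t, f n = ∑ n ∈ t.attach.map ⟨fun n => (⟨n.1, ht n.1 n.2⟩ : Nat.factoredNumbers s), fun a b hab => by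
        exact Subtype.ext (congrArg (fun x => x.1) hab)⟩, f n := by
      rw [Finset.sum_map]
      exact (Finset.sum_attach t (fun n => f n)).symm
    rw [e]
    exact sum_le_hasSum _ (fun n _ => hf0 n) h
  refine h1.trans ?_
  rw [Real.exp_sum]
  apply Finset.prod_le_prod
  · intro p hp
    have := hf1 p (Finset.mem_filter.mp hp).2
    exact inv_nonneg.mpr (by linarith)
  · intro p hp
    have hp' := Finset.mem_filter.mp hp
    have a1 := hs p hp'.1 hp'.2
    have a0 := hf0 p
    have a2 := Real.add_one_le_exp (f p + 6 * (f p) ^ 2)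
    refine le_trans ?_ a2
    rw [inv_le_iff_one_le_mul₀ (by linarith)]
    nlinarith [mul_nonneg a0 a0, mul_nonneg (mul_nonneg a0 a0) (by linarith : 0 ≤ 5 / 6 - f p)]

/-- Sum of reciprocals of integers with all prime factors in `(v, N]`. -/
lemma rough_sum : ∃ C > (0 : ℝ), ∀ v N : ℕ, 2 ≤ v → v ≤ N → ∀ t : Finset ℕ,
    (∀ n ∈ t, n ∈ Nat.factoredNumbers (Finset.Ioc v N)) →
    ∑ n ∈ t, 1 / (n : ℝ) ≤ C * (Real.log N / Real.log v) := by
  obtain ⟨C1, hC1, h1⟩ := prime_recip_Ioc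
  obtain ⟨C2, hC2, h2⟩ := sum_inv_sq_bdd
  refine ⟨Real.exp (C1 + 6 * C2), Real.exp_pos _, fun v N hv hN t ht => ?_⟩
  let f : ℕ →* ℝ := ⟨⟨fun n => 1 / (n : ℝ), by simp⟩, fun a b => by push_cast; ring⟩
  have hfv : ∀ n : ℕ, f n = 1 / (n : ℝ) := fun n => rfl
  have hp : ∀ p : ℕ, p.Prime → f p ≤ 1 / 2 := by
    intro p hp
    rw [hfv]
    apply one_div_le_one_div_of_le (by norm_num)
    exact_mod_cast hp.two_le
  have hlv : 0 < Real.log v := Real.log_pos (by exact_mod_cast (by omega : 1 < v))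
  have hlN : 0 < Real.log N := Real.log_pos (by exact_mod_cast (by omega : 1 < N))
  have := euler_bd f (fun n => by rw [hfv]; positivity) (fun p h => by have := hp p h; linarith)
    (Finset.Ioc v N) (fun p _ h => by have := hp p h; linarith) t ht
  refine this.trans ?_
  rw [← Real.exp_log (div_pos hlN hlv), ← Real.exp_add]
  apply Real.exp_le_exp.mpr
  rw [Finset.sum_add_distrib, ← Finset.mul_sum]
  have a := h1 v N hv hN
  have b := h2 ((Finset.Ioc v N).filter Nat.Prime)
  have c : ∑ p ∈ (Finset.Ioc v N).filter Nat.Prime, (f p) ^ 2 = ∑ p ∈ (Finset.Ioc v N).filter Nat.Prime, 1 / (p : ℝ) ^ 2 := by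
    apply Finset.sum_congr rfl
    intro p _
    rw [hfv, div_pow, one_pow]
  rw [c]
  simp only [hfv]
  linarith

lemma exp_half_lt : Real.exp (1 / 2) ≤ 5 / 3 := by
  have h : Real.exp (1 / 2) ^ 2 = Real.exp 1 := by
    rw [← Real.exp_nat_mul]; norm_num
  have := Real.exp_one_lt_d9
  by_contra hc
  push Not at hc
  nlinarith

/-- Rankin sum. -/
lemma rankin_sum : ∃ C > (0 : ℝ), ∀ z : ℕ, 2 ≤ z → ∀ t : Finset ℕ,
    (∀ n ∈ t, n ∈ Nat.factoredNumbers (Finset.Ioc 0 z)) →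
    ∑ n ∈ t, (n : ℝ) ^ (-1 + 1 / (2 * Real.log z)) ≤ C * Real.log z := by
  obtain ⟨C1, hC1, h1⟩ := prime_recip_le
  obtain ⟨C2, hC2, h2⟩ := sum_inv_sq_bdd
  obtain ⟨C3, hC3, h3⟩ := prime_log_le
  have hl2 := Real.log_two_gt_d9
  refine ⟨Real.exp (C1 + 1 + C3 / Real.log 2 + 18 * C2), Real.exp_pos _, fun z hz t ht => ?_⟩
  have hlz2 : Real.log 2 ≤ Real.log z := Real.log_le_log (by norm_num) (by exact_mod_cast hz)
  have hlz : 0 < Real.log z := by linarith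
  set ε := 1 / (2 * Real.log z) with hε
  have hε0 : 0 < ε := by positivity
  have hε1 : ε < 1 := by
    rw [hε, div_lt_one (by positivity)]; linarith
  let f : ℕ →* ℝ := ⟨⟨fun n => (n : ℝ) ^ (-1 + ε), by simp⟩, fun a b => by
    push_cast; exact Real.mul_rpow (Nat.cast_nonneg _) (Nat.cast_nonneg _)⟩
  have hfv : ∀ n : ℕ, f n = (n : ℝ) ^ (-1 + ε) := fun n => rfl
  have hpz : ∀ p ∈ (Finset.Ioc 0 z).filter Nat.Prime, f p ≤ 1 / (p : ℝ) + (1 / Real.log z) * (Real.log p / p) ∧ f p ≤ (5 / 3) * (1 / p) := by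
    intro p hp
    simp only [Finset.mem_filter, Finset.mem_Ioc] at hp
    have hp0 : (0 : ℝ) < p := by exact_mod_cast hp.1.1
    have hlp : 0 ≤ Real.log p := Real.log_natCast_nonneg _
    have hlpz : Real.log p ≤ Real.log z := Real.log_le_log hp0 (by exact_mod_cast hp.1.2)
    have hu : ε * Real.log p ≤ 1 / 2 := by
      rw [hε, div_mul_eq_mul_div, div_le_div_iff₀ (by positivity) (by norm_num)]; linarith
    have hu0 : 0 ≤ ε * Real.log p := by positivity
    have hfe : f p = Real.exp (ε * Real.log p) * (1 / p) := by
      rw [hfv, Real.rpow_add hp0, Real.rpow_neg_one, mul_comm, Real.rpow_def_of_pos hp0, mul_comm (Real.log p), one_div]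
    constructor
    · have hexp : Real.exp (ε * Real.log p) ≤ 1 + 2 * (ε * Real.log p) := by
        set u := ε * Real.log p
        have := Real.add_one_le_exp (-u)
        rw [Real.exp_neg] at this
        have hpos := Real.exp_pos u
        have h4 : (1 - u) * Real.exp u ≤ 1 := by
          calc (1 - u) * Real.exp u ≤ (Real.exp u)⁻¹ * Real.exp u := by gcongr; linarith
            _ = 1 := inv_mul_cancel₀ hpos.ne'
        by_contra hc
        push Not at hc
        nlinarith [mul_nonneg hu0 (by linarith : 0 ≤ 1 / 2 - u)]
      rw [hfe]
      calc _ ≤ (1 + 2 * (ε * Real.log p)) * (1 / p) := by gcongr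
        _ = _ := by rw [hε]; field_simp
    · rw [hfe]
      gcongr
      exact (Real.exp_le_exp.mpr hu).trans exp_half_lt
  have := euler_bd f (fun n => by rw [hfv]; positivity) (fun p hp => by
      rw [hfv]
      exact Real.rpow_lt_one_of_one_lt_of_neg (by exact_mod_cast hp.one_lt) (by linarith))
    (Finset.Ioc 0 z) (fun p hp h => by
      have := (hpz p (Finset.mem_filter.mpr ⟨hp, h⟩)).2
      have h2 : 1 / (p : ℝ) ≤ 1 / 2 := one_div_le_one_div_of_le (by norm_num) (by exact_mod_cast h.two_le)
      linarith) t ht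
  refine this.trans ?_
  conv_rhs => rw [← Real.exp_log hlz, ← Real.exp_add]
  apply Real.exp_le_exp.mpr
  have hb : ∑ p ∈ (Finset.Ioc 0 z).filter Nat.Prime, (f p + 6 * (f p) ^ 2) ≤
      ∑ p ∈ (Finset.Ioc 0 z).filter Nat.Prime, (1 / (p : ℝ) + (1 / Real.log z) * (Real.log p / p) + 18 * (1 / (p : ℝ) ^ 2)) := by
    apply Finset.sum_le_sum
    intro p hp
    obtain ⟨q1, q2⟩ := hpz p hp
    have q0 : 0 ≤ f p := by rw [hfv]; positivity
    have q3 : (f p) ^ 2 ≤ ((5 / 3) * (1 / (p : ℝ))) ^ 2 := by gcongr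
    have q4 : ((5 / 3) * (1 / (p : ℝ))) ^ 2 = 25 / 9 * (1 / (p : ℝ) ^ 2) := by ring
    have q5 : 0 ≤ 1 / (p : ℝ) ^ 2 := by positivity
    linarith
  refine hb.trans ?_
  rw [Finset.sum_add_distrib, Finset.sum_add_distrib, ← Finset.mul_sum, ← Finset.mul_sum]
  have a := h1 z hz
  have b := h2 ((Finset.Ioc 0 z).filter Nat.Prime)
  have c := h3 z
  have d : 1 / Real.log z * ∑ p ∈ (Finset.Ioc 0 z).filter Nat.Prime, Real.log p / (p : ℝ) ≤ 1 + C3 / Real.log 2 := by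
    calc _ ≤ 1 / Real.log z * (Real.log z + C3) := by gcongr
      _ = 1 + C3 / Real.log z := by field_simp
      _ ≤ _ := by gcongr
  linarith

lemma proper_pp : ∃ C > (0 : ℝ), ∀ s : Finset ℕ, (∀ d ∈ s, IsPrimePow d ∧ ¬ d.Prime) →
    ∑ d ∈ s, Real.log d / (d : ℝ) ≤ C := by
  have hs1 : Summable (fun j : ℕ => (j : ℝ) * (1 / 2 : ℝ) ^ j) := by
    simpa using summable_pow_mul_geometric_of_norm_lt_one 1 (r := (1 / 2 : ℝ)) (by norm_num)
  have hs2 : Summable (fun p : ℕ => Real.log p / (p : ℝ) ^ 2) := by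
    have : Summable (fun p : ℕ => 2 * (1 / (p : ℝ) ^ (3 / 2 : ℝ))) :=
      (Real.summable_one_div_nat_rpow.mpr (by norm_num)).mul_left 2
    refine this.of_nonneg_of_le (fun p => div_nonneg (Real.log_natCast_nonneg _) (by positivity)) (fun p => ?_)
    rcases Nat.eq_zero_or_pos p with rfl | hp
    · simp
    have hp0 : (0 : ℝ) < p := by exact_mod_cast hp
    have := Real.log_le_rpow_div hp0.le (show (0 : ℝ) < 1 / 2 by norm_num)
    calc _ ≤ ((p : ℝ) ^ (1 / 2 : ℝ) / (1 / 2)) / (p : ℝ) ^ 2 := by gcongr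
      _ = 2 * ((p : ℝ) ^ (1 / 2 : ℝ) / (p : ℝ) ^ (2 : ℝ)) := by
        rw [Real.rpow_two]; ring
      _ = _ := by
        rw [← Real.rpow_sub hp0, one_div ((p : ℝ) ^ (3 / 2 : ℝ)), ← Real.rpow_neg hp0.le]; norm_num
  set A := ∑' j : ℕ, (j : ℝ) * (1 / 2 : ℝ) ^ j
  set B := ∑' p : ℕ, Real.log p / (p : ℝ) ^ 2
  have hA : 0 ≤ A := tsum_nonneg (fun j => by positivity)
  have hB : 0 ≤ B := tsum_nonneg (fun p => div_nonneg (Real.log_natCast_nonneg _) (by positivity))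
  refine ⟨4 * (B * A) + 1, by positivity, fun s hs => ?_⟩
  have hch : ∀ d ∈ s, ∃ q : ℕ × ℕ, 2 ≤ q.1 ∧ 2 ≤ q.2 ∧ d = q.1 ^ q.2 := by
    intro d hd
    obtain ⟨⟨p, j, hp, hj, e⟩, h2⟩ := hs d hd
    refine ⟨(p, j), hp.nat_prime.two_le, ?_, e.symm⟩
    by_contra hc
    have : j = 1 := by simp at hc; omega
    subst this
    rw [pow_one] at e
    exact h2 (e ▸ hp.nat_prime)
  choose! q hq1 hq2 hq3 using hch
  set T1 := s.image (fun d => (q d).1)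
  set T2 := s.image (fun d => (q d).2)
  have hterm : ∀ d ∈ s, Real.log d / (d : ℝ) ≤ 4 * ((Real.log (q d).1 / ((q d).1 : ℝ) ^ 2) * (((q d).2 : ℝ) * (1 / 2) ^ (q d).2)) := by
    intro d hd
    have e := hq3 d hd
    have e1 := hq1 d hd
    have e2 := hq2 d hd
    generalize (q d).1 = p at e e1 ⊢
    generalize (q d).2 = j at e e2 ⊢
    obtain ⟨i, rfl⟩ : ∃ i, j = i + 2 := ⟨j - 2, by omega⟩
    rw [e]
    push_cast
    rw [Real.log_pow]
    have hp2 : (2 : ℝ) ≤ p := by exact_mod_cast e1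
    have hlp : 0 ≤ Real.log p := Real.log_natCast_nonneg _
    have h1 : 1 / (p : ℝ) ^ i ≤ (1 / 2) ^ i := by
      rw [div_pow, one_pow]
      gcongr
    calc _ = (Real.log p / (p : ℝ) ^ 2) * ((i + 2 : ℕ) * (1 / (p : ℝ) ^ i)) := by
          rw [pow_add]; field_simp
      _ ≤ (Real.log p / (p : ℝ) ^ 2) * ((i + 2 : ℕ) * ((1 / 2) ^ i)) := by gcongr
      _ = _ := by rw [pow_add]; push_cast; ring
  calc _ ≤ ∑ d ∈ s, 4 * ((Real.log (q d).1 / ((q d).1 : ℝ) ^ 2) * (((q d).2 : ℝ) * (1 / 2) ^ (q d).2)) := Finset.sum_le_sum hterm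
    _ = 4 * ∑ d ∈ s, ((Real.log (q d).1 / ((q d).1 : ℝ) ^ 2) * (((q d).2 : ℝ) * (1 / 2) ^ (q d).2)) := by rw [Finset.mul_sum]
    _ = 4 * ∑ x ∈ s.image q, (Real.log x.1 / (x.1 : ℝ) ^ 2) * ((x.2 : ℝ) * (1 / 2) ^ x.2) := by
        rw [Finset.sum_image]
        intro a ha b hb hab
        rw [hq3 a ha, hq3 b hb, hab]
    _ ≤ 4 * ∑ x ∈ T1 ×ˢ T2, (Real.log x.1 / (x.1 : ℝ) ^ 2) * ((x.2 : ℝ) * (1 / 2) ^ x.2) := by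
        refine mul_le_mul_of_nonneg_left ?_ (by norm_num)
        apply Finset.sum_le_sum_of_subset_of_nonneg
        · intro x hx
          obtain ⟨d, hd, rfl⟩ := Finset.mem_image.mp hx
          exact Finset.mem_product.mpr ⟨Finset.mem_image_of_mem _ hd, Finset.mem_image_of_mem (fun d => (q d).2) hd⟩
        · intro x _ _
          have := Real.log_natCast_nonneg x.1
          positivity
    _ = 4 * ((∑ p ∈ T1, Real.log p / (p : ℝ) ^ 2) * (∑ j ∈ T2, (j : ℝ) * (1 / 2) ^ j)) := by
        rw [Finset.sum_product, Finset.sum_mul_sum]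
    _ ≤ 4 * (B * A) := by
        gcongr
        · exact hs2.sum_le_tsum _ (fun p _ => div_nonneg (Real.log_natCast_nonneg _) (by positivity))
        · exact hs1.sum_le_tsum _ (fun p _ => by positivity)
    _ ≤ _ := by linarith


open Classical in
noncomputable def KK (v : ℝ) : ℝ :=
  ∑ d ∈ (Finset.Ioc 0 ⌊v⌋₊).filter (fun d => IsPrimePow d), (1 / (d : ℝ)) * |mm (v / d)|

lemma KK_nonneg (v : ℝ) : 0 ≤ KK v := Finset.sum_nonneg (fun d _ => by positivity)

/-- primes at most `v`, reciprocal sum is `O((1+log v)^{1/3})`. -/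
lemma prime_recip_third : ∃ C > (0 : ℝ), ∀ v : ℝ, 1 ≤ v →
    ∑ p ∈ (Finset.Ioc 0 ⌊v⌋₊).filter Nat.Prime, 1 / (p : ℝ) ≤ C * (1 + Real.log v) ^ ((1 : ℝ) / 3) := by
  obtain ⟨C1, hC1, h1⟩ := prime_recip_le
  refine ⟨3 + C1, by positivity, fun v hv => ?_⟩
  have hlv : 0 ≤ Real.log v := Real.log_nonneg hv
  have hone : (1 : ℝ) ≤ (1 + Real.log v) ^ ((1 : ℝ) / 3) := Real.one_le_rpow (by linarith) (by norm_num)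
  by_cases hN : 2 ≤ ⌊v⌋₊
  · refine (h1 _ hN).trans ?_
    have hfl : (⌊v⌋₊ : ℝ) ≤ v := Nat.floor_le (by linarith)
    have hl0 : 0 < Real.log ⌊v⌋₊ := Real.log_pos (by exact_mod_cast (by omega : 1 < ⌊v⌋₊))
    have hll : Real.log ⌊v⌋₊ ≤ 1 + Real.log v := by
      have := Real.log_le_log (by exact_mod_cast (by omega : 0 < ⌊v⌋₊)) hfl
      linarith
    have h2 : Real.log (Real.log ⌊v⌋₊) ≤ 3 * (1 + Real.log v) ^ ((1 : ℝ) / 3) := by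
      have := Real.log_le_rpow_div hl0.le (show (0 : ℝ) < 1 / 3 by norm_num)
      refine this.trans ?_
      rw [div_eq_mul_inv, mul_comm]
      norm_num
      gcongr
    nlinarith
  · have : (Finset.Ioc 0 ⌊v⌋₊).filter Nat.Prime = ∅ := by
      apply Finset.filter_eq_empty_iff.mpr
      intro p hp hpp
      have := hpp.two_le
      have := (Finset.mem_Ioc.mp hp).2
      omega
    rw [this, Finset.sum_empty]
    positivity

lemma sum_rpow_bdd : ∃ C > (0 : ℝ), ∀ s : Finset ℕ, ∑ i ∈ s, (1 + (i : ℝ)) ^ (-(4 : ℝ) / 3) ≤ C := by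
  have h : Summable (fun n : ℕ => ((n + 1 : ℕ) : ℝ) ^ (-(4 : ℝ) / 3)) :=
    (summable_nat_add_iff 1).mpr (Real.summable_nat_rpow.mpr (by norm_num))
  have e : (fun n : ℕ => ((n + 1 : ℕ) : ℝ) ^ (-(4 : ℝ) / 3)) = fun n : ℕ => (1 + (n : ℝ)) ^ (-(4 : ℝ) / 3) := by
    ext n; push_cast; rw [add_comm]
  rw [e] at h
  have h0 : ∀ n : ℕ, 0 ≤ (1 + (n : ℝ)) ^ (-(4 : ℝ) / 3) := fun n => by positivity
  refine ⟨∑' n : ℕ, (1 + (n : ℝ)) ^ (-(4 : ℝ) / 3) + 1, ?_, fun s => ?_⟩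
  · have : 0 ≤ ∑' n : ℕ, (1 + (n : ℝ)) ^ (-(4 : ℝ) / 3) := tsum_nonneg h0
    linarith
  · have := h.sum_le_tsum s (fun n _ => h0 n)
    linarith

lemma KK_small : ∃ C > (0 : ℝ), ∀ v : ℝ, 1 ≤ v → ∀ s : Finset ℕ,
    (∀ d ∈ s, IsPrimePow d ∧ (d : ℝ) ≤ Real.sqrt v) →
    ∑ d ∈ s, (1 / (d : ℝ)) * |mm (v / d)| ≤ C / (1 + Real.log v) := by
  obtain ⟨C0, hC0, h0⟩ := mm_bound
  obtain ⟨C1, hC1, h1⟩ := prime_recip_third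
  obtain ⟨C2, hC2, h2⟩ := proper_pp
  set c := ((1 : ℝ) / 2) ^ (-(4 : ℝ) / 3) with hc
  have hc0 : 0 < c := by positivity
  refine ⟨(C1 + 2 * C2) * (C0 * c), by positivity, fun v hv s hs => ?_⟩
  have hlv : 0 ≤ Real.log v := Real.log_nonneg hv
  set L := 1 + Real.log v with hL
  have hL1 : 1 ≤ L := by linarith
  have hL0 : 0 < L := by linarith
  have hsq1 : 1 ≤ Real.sqrt v := Real.one_le_sqrt.mpr hv
  have hmm : ∀ d ∈ s, |mm (v / d)| ≤ C0 * c * L ^ (-(4 : ℝ) / 3) := by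
    intro d hd
    obtain ⟨a, b⟩ := hs d hd
    have hd0 : (0 : ℝ) < d := by exact_mod_cast a.pos
    have hge : Real.sqrt v ≤ v / d := by
      rw [le_div_iff₀ hd0]
      calc Real.sqrt v * d ≤ Real.sqrt v * Real.sqrt v := by gcongr
        _ = v := Real.mul_self_sqrt (by linarith)
    refine (h0 (v / d) (hsq1.trans hge)).trans ?_
    rw [mul_assoc, hc, ← Real.mul_rpow (by norm_num) hL0.le]
    refine mul_le_mul_of_nonneg_left ?_ hC0.le
    apply Real.rpow_le_rpow_of_nonpos (by positivity) _ (by norm_num)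
    have := Real.log_le_log (by linarith) hge
    rw [Real.log_sqrt (by linarith)] at this
    linarith
  have hrec : ∑ d ∈ s, 1 / (d : ℝ) ≤ (C1 + 2 * C2) * L ^ ((1 : ℝ) / 3) := by
    have hone : (1 : ℝ) ≤ L ^ ((1 : ℝ) / 3) := Real.one_le_rpow hL1 (by norm_num)
    rw [← Finset.sum_filter_add_sum_filter_not s Nat.Prime]
    have p1 : ∑ d ∈ s.filter Nat.Prime, 1 / (d : ℝ) ≤ C1 * L ^ ((1 : ℝ) / 3) := by
      refine le_trans ?_ (h1 v hv)
      apply Finset.sum_le_sum_of_subset_of_nonneg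
      · intro d hd
        rw [Finset.mem_filter] at hd
        simp only [Finset.mem_filter, Finset.mem_Ioc]
        refine ⟨⟨hd.2.pos, Nat.le_floor ((hs d hd.1).2.trans ?_)⟩, hd.2⟩
        exact (Real.sqrt_le_left (by linarith)).mpr (by nlinarith)
      · intros; positivity
    have p2 : ∑ d ∈ s.filter (fun d => ¬ d.Prime), 1 / (d : ℝ) ≤ 2 * C2 := by
      have := h2 (s.filter (fun d => ¬ d.Prime)) (fun d hd => by
        rw [Finset.mem_filter] at hd
        exact ⟨(hs d hd.1).1, hd.2⟩)
      refine le_trans ?_ (mul_le_mul_of_nonneg_left this (by norm_num))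
      rw [Finset.mul_sum]
      apply Finset.sum_le_sum
      intro d hd
      rw [Finset.mem_filter] at hd
      have hd2 : (2 : ℝ) ≤ d := by exact_mod_cast (hs d hd.1).1.two_le
      have hl := Real.log_le_log (by norm_num) hd2
      have := Real.log_two_gt_d9
      rw [← mul_div_assoc]
      gcongr
      linarith
    nlinarith
  calc _ ≤ ∑ d ∈ s, (1 / (d : ℝ)) * (C0 * c * L ^ (-(4 : ℝ) / 3)) := by
        apply Finset.sum_le_sum
        intro d hd
        gcongr
        exact hmm d hd
    _ = (∑ d ∈ s, 1 / (d : ℝ)) * (C0 * c * L ^ (-(4 : ℝ) / 3)) := by rw [Finset.sum_mul]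
    _ ≤ ((C1 + 2 * C2) * L ^ ((1 : ℝ) / 3)) * (C0 * c * L ^ (-(4 : ℝ) / 3)) := by gcongr
    _ = (C1 + 2 * C2) * (C0 * c) * (L ^ ((1 : ℝ) / 3) * L ^ (-(4 : ℝ) / 3)) := by ring
    _ = _ := by
      rw [← Real.rpow_add hL0]
      rw [show (1 : ℝ) / 3 + -(4 : ℝ) / 3 = -1 by norm_num, Real.rpow_neg_one, div_eq_mul_inv]

lemma KK_proper : ∃ C > (0 : ℝ), ∀ v : ℝ, 1 ≤ v → ∀ s : Finset ℕ,
    (∀ d ∈ s, (IsPrimePow d ∧ ¬ d.Prime) ∧ Real.sqrt v ≤ d) →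
    ∑ d ∈ s, (1 / (d : ℝ)) * |mm (v / d)| ≤ C / (1 + Real.log v) := by
  obtain ⟨C2, hC2, h2⟩ := proper_pp
  refine ⟨8 * C2, by positivity, fun v hv s hs => ?_⟩
  have hlv : 0 ≤ Real.log v := Real.log_nonneg hv
  have hL0 : 0 < 1 + Real.log v := by linarith
  have h3 := h2 s (fun d hd => (hs d hd).1)
  calc _ ≤ ∑ d ∈ s, (8 / (1 + Real.log v)) * (Real.log d / d) := by
        apply Finset.sum_le_sum
        intro d hd
        obtain ⟨⟨a, _⟩, b⟩ := hs d hd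
        have hd0 : (0 : ℝ) < d := by exact_mod_cast a.pos
        have hd2 : (2 : ℝ) ≤ d := by exact_mod_cast a.two_le
        have hl := Real.log_le_log (by norm_num) hd2
        have l2 := Real.log_two_gt_d9
        have hl3 := Real.log_le_log (by positivity) b
        rw [Real.log_sqrt (by linarith)] at hl3
        have : 1 + Real.log v ≤ 4 * Real.log d := by linarith
        calc 1 / (d : ℝ) * |mm (v / d)| ≤ 1 / (d : ℝ) * 2 := by gcongr; exact abs_mm_le _
          _ = 2 * (1 + Real.log v) / ((1 + Real.log v) * d) := by field_simp
          _ ≤ 2 * (4 * Real.log d) / ((1 + Real.log v) * d) := by gcongr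
          _ = _ := by field_simp; ring
    _ = (8 / (1 + Real.log v)) * ∑ d ∈ s, (Real.log d / d) := by rw [Finset.mul_sum]
    _ ≤ (8 / (1 + Real.log v)) * C2 := by gcongr
    _ = _ := by ring

lemma KK_prime : ∃ C > (0 : ℝ), ∀ v : ℝ, 1 ≤ v → ∀ s : Finset ℕ,
    (∀ d ∈ s, d.Prime ∧ Real.sqrt v ≤ d ∧ (d : ℝ) ≤ v) →
    ∑ d ∈ s, (1 / (d : ℝ)) * |mm (v / d)| ≤ C / (1 + Real.log v) := by
  obtain ⟨C0, hC0, h0⟩ := mm_bound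
  obtain ⟨C1, hC1, h1⟩ := sum_rpow_bdd
  have l2 := Real.log_two_gt_d9
  have hl4 : 0 < Real.log 4 := Real.log_pos (by norm_num)
  set c := (Real.log 2) ^ (-(4 : ℝ) / 3) with hc
  have hc0 : 0 < c := by rw [hc]; apply Real.rpow_pos_of_pos; linarith
  refine ⟨C1 * (C0 * c * (4 * (2 * Real.log 4))), by positivity, fun v hv s hs => ?_⟩
  have hv0 : 0 < v := by linarith
  have hlv : 0 ≤ Real.log v := Real.log_nonneg hv
  have hL0 : 0 < 1 + Real.log v := by linarith
  let w : ℕ → ℕ := fun d => Nat.log 2 ⌊v / d⌋₊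
  have hw : ∀ d ∈ s, (2 : ℝ) ^ (w d) ≤ v / d ∧ v / d ≤ 2 ^ (w d + 1) := by
    intro d hd
    obtain ⟨a, b, hdv⟩ := hs d hd
    have hd0 : (0 : ℝ) < d := by exact_mod_cast a.pos
    have hge : 1 ≤ v / d := by rw [le_div_iff₀ hd0]; linarith
    have hf : ⌊v / d⌋₊ ≠ 0 := by
      have := Nat.le_floor (n := 1) (by simpa using hge)
      omega
    constructor
    · have := Nat.pow_log_le_self 2 hf
      calc (2 : ℝ) ^ (w d) ≤ (⌊v / d⌋₊ : ℝ) := by exact_mod_cast this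
        _ ≤ _ := Nat.floor_le (by positivity)
    · have h5 := Nat.lt_pow_succ_log_self (b := 2) (by norm_num) ⌊v / d⌋₊
      have h6 : ⌊v / d⌋₊ + 1 ≤ 2 ^ (w d + 1) := h5
      calc v / d ≤ (⌊v / d⌋₊ : ℝ) + 1 := (Nat.lt_floor_add_one _).le
        _ ≤ _ := by exact_mod_cast h6
  have hfib : ∀ i ∈ s.image w, ∑ d ∈ s.filter (fun d => w d = i), (1 / (d : ℝ)) * |mm (v / d)|
      ≤ (1 + (i : ℝ)) ^ (-(4 : ℝ) / 3) * (C0 * c * (4 * (2 * Real.log 4)) / (1 + Real.log v)) := by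
    intro i _
    have hwin := prime_log_window (v / 2 ^ (i + 1)) (by positivity) (s.filter (fun d => w d = i)) (fun d hd => by
      rw [Finset.mem_filter] at hd
      obtain ⟨a, b, hdv⟩ := hs d hd.1
      have hd0 : (0 : ℝ) < d := by exact_mod_cast a.pos
      obtain ⟨q1, q2⟩ := hw d hd.1
      rw [hd.2] at q1 q2
      refine ⟨a, ?_, ?_⟩
      · rw [div_le_iff₀ (by positivity)]
        rw [div_le_iff₀ hd0] at q2
        linarith
      · rw [pow_succ, ← div_div, mul_div_cancel₀ _ (by norm_num), le_div_iff₀ (by positivity)]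
        rw [le_div_iff₀ hd0] at q1
        linarith)
    calc _ ≤ ∑ d ∈ s.filter (fun d => w d = i), ((1 + (i : ℝ)) ^ (-(4 : ℝ) / 3) * (C0 * c * 4 / (1 + Real.log v))) * (Real.log d / d) := by
          apply Finset.sum_le_sum
          intro d hd
          rw [Finset.mem_filter] at hd
          obtain ⟨a, b, hdv⟩ := hs d hd.1
          have hd0 : (0 : ℝ) < d := by exact_mod_cast a.pos
          obtain ⟨q1, q2⟩ := hw d hd.1
          rw [hd.2] at q1 q2
          have hm : |mm (v / d)| ≤ C0 * (c * (1 + (i : ℝ)) ^ (-(4 : ℝ) / 3)) := by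
            have : (1 : ℝ) ≤ 2 ^ i := one_le_pow₀ (by norm_num)
            refine (h0 _ (this.trans q1)).trans ?_
            rw [hc, ← Real.mul_rpow (by linarith) (by positivity)]
            refine mul_le_mul_of_nonneg_left ?_ hC0.le
            apply Real.rpow_le_rpow_of_nonpos (by positivity) _ (by norm_num)
            have h7 := Real.log_le_log (by positivity) q1
            rw [Real.log_pow] at h7
            have := Real.log_two_lt_d9
            linarith
          have hd2 : (2 : ℝ) ≤ d := by exact_mod_cast a.two_le
          have hl := Real.log_le_log (by norm_num) hd2
          have hl3 := Real.log_le_log (by positivity) b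
          rw [Real.log_sqrt (by linarith)] at hl3
          have h8 : 1 + Real.log v ≤ 4 * Real.log d := by linarith
          calc 1 / (d : ℝ) * |mm (v / d)| ≤ 1 / (d : ℝ) * (C0 * (c * (1 + (i : ℝ)) ^ (-(4 : ℝ) / 3))) := by gcongr
            _ = (C0 * (c * (1 + (i : ℝ)) ^ (-(4 : ℝ) / 3))) * (1 + Real.log v) / ((1 + Real.log v) * d) := by field_simp
            _ ≤ (C0 * (c * (1 + (i : ℝ)) ^ (-(4 : ℝ) / 3))) * (4 * Real.log d) / ((1 + Real.log v) * d) := by gcongr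
            _ = _ := by field_simp
      _ = ((1 + (i : ℝ)) ^ (-(4 : ℝ) / 3) * (C0 * c * 4 / (1 + Real.log v))) * ∑ d ∈ s.filter (fun d => w d = i), (Real.log d / d) := by rw [Finset.mul_sum]
      _ ≤ ((1 + (i : ℝ)) ^ (-(4 : ℝ) / 3) * (C0 * c * 4 / (1 + Real.log v))) * (2 * Real.log 4) := by gcongr
      _ = _ := by ring
  calc _ = ∑ i ∈ s.image w, ∑ d ∈ s.filter (fun d => w d = i), (1 / (d : ℝ)) * |mm (v / d)| :=
        (Finset.sum_fiberwise_of_maps_to (fun d hd => Finset.mem_image_of_mem w hd) _).symm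
    _ ≤ ∑ i ∈ s.image w, (1 + (i : ℝ)) ^ (-(4 : ℝ) / 3) * (C0 * c * (4 * (2 * Real.log 4)) / (1 + Real.log v)) := Finset.sum_le_sum hfib
    _ = (∑ i ∈ s.image w, (1 + (i : ℝ)) ^ (-(4 : ℝ) / 3)) * (C0 * c * (4 * (2 * Real.log 4)) / (1 + Real.log v)) := by rw [Finset.sum_mul]
    _ ≤ C1 * (C0 * c * (4 * (2 * Real.log 4)) / (1 + Real.log v)) := by
        gcongr
        exact h1 _
    _ = _ := by ring

lemma KK_bound : ∃ C > (0 : ℝ), ∀ v : ℝ, 1 ≤ v → |mm v| + KK v ≤ C / (1 + Real.log v) := by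
  classical
  obtain ⟨C0, hC0, h0⟩ := mm_bound
  obtain ⟨C1, hC1, h1⟩ := KK_small
  obtain ⟨C2, hC2, h2⟩ := KK_proper
  obtain ⟨C3, hC3, h3⟩ := KK_prime
  refine ⟨C0 + (C1 + (C2 + C3)), by positivity, fun v hv => ?_⟩
  have hlv : 0 ≤ Real.log v := Real.log_nonneg hv
  have hL0 : 0 < 1 + Real.log v := by linarith
  rw [add_div, add_div, add_div]
  have hm : |mm v| ≤ C0 / (1 + Real.log v) := by
    refine (h0 v hv).trans ?_
    have hh : (1 + Real.log v) ^ (-(4 : ℝ) / 3) ≤ (1 + Real.log v) ^ (-1 : ℝ) :=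
      Real.rpow_le_rpow_of_exponent_le (by linarith) (by norm_num)
    rw [Real.rpow_neg_one] at hh
    rw [div_eq_mul_inv]
    exact mul_le_mul_of_nonneg_left hh hC0.le
  refine add_le_add hm ?_
  unfold KK
  rw [← Finset.sum_filter_add_sum_filter_not _ (fun d : ℕ => (d : ℝ) ≤ Real.sqrt v)]
  have hfl := Nat.floor_le (by linarith : 0 ≤ v)
  apply add_le_add
  · apply h1 v hv
    intro d hd
    simp only [Finset.mem_filter] at hd
    exact ⟨hd.1.2, hd.2⟩
  · rw [← Finset.sum_filter_add_sum_filter_not _ (fun d : ℕ => ¬ d.Prime)]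
    apply add_le_add
    · apply h2 v hv
      intro d hd
      simp only [Finset.mem_filter, not_le] at hd
      exact ⟨⟨hd.1.1.2, hd.2⟩, hd.1.2.le⟩
    · apply h3 v hv
      intro d hd
      simp only [Finset.mem_filter, not_le, not_not, Finset.mem_Ioc] at hd
      refine ⟨hd.2, hd.1.2.le, ?_⟩
      have : (d : ℝ) ≤ ⌊v⌋₊ := by exact_mod_cast hd.1.1.1.2
      linarith


open Classical in
lemma pp_moebius (m : ℕ) : ∑ d ∈ m.divisors.filter IsPrimePow, ArithmeticFunction.moebius (m / d)
    = - (ArithmeticFunction.moebius m * (m.primeFactors.card : ℤ)) := by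
  refine Nat.recOnPrimeCoprime ?_ ?_ ?_ m
  · simp
  · intro p k hp
    rw [Finset.sum_filter, Nat.sum_divisors_prime_pow hp, Finset.sum_range_succ']
    simp only [pow_zero, not_isPrimePow_one, if_false, add_zero]
    have h1 : ∀ i ∈ Finset.range k, (if IsPrimePow (p ^ (i + 1)) then
        ArithmeticFunction.moebius (p ^ k / p ^ (i + 1)) else 0) =
        ArithmeticFunction.moebius (p ^ (k - 1 - i)) := by
      intro i hi
      rw [if_pos (hp.isPrimePow.pow (Nat.succ_ne_zero i)), Nat.pow_div (by
        have := Finset.mem_range.mp hi; omega) hp.pos]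
      congr 2
      omega
    rw [Finset.sum_congr rfl h1, Finset.sum_range_reflect (fun i => ArithmeticFunction.moebius (p ^ i)) k]
    rcases k with _ | _ | k
    · simp
    · simp [ArithmeticFunction.moebius_apply_prime hp, hp.primeFactors]
    · rw [Finset.sum_range_succ', Finset.sum_range_succ']
      have h2 : ∀ i ∈ Finset.range k, ArithmeticFunction.moebius (p ^ (i + 1 + 1)) = 0 := by
        intro i _
        rw [ArithmeticFunction.moebius_apply_prime_pow hp (by omega), if_neg (by omega)]
      have h4 : ArithmeticFunction.moebius (p ^ (k + 1 + 1)) = 0 := by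
        rw [ArithmeticFunction.moebius_apply_prime_pow hp (by omega), if_neg (by omega)]
      rw [Finset.sum_congr rfl h2, h4]
      simp [ArithmeticFunction.moebius_apply_prime hp]
  · intro a b ha hb hab iha ihb
    rw [Nat.mul_divisors_filter_prime_pow hab, Finset.filter_union,
      Finset.sum_union (Nat.disjoint_divisors_filter_isPrimePow hab)]
    have e1 : ∑ d ∈ a.divisors.filter IsPrimePow, ArithmeticFunction.moebius (a * b / d) =
        (∑ d ∈ a.divisors.filter IsPrimePow, ArithmeticFunction.moebius (a / d)) *
          ArithmeticFunction.moebius b := by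
      rw [Finset.sum_mul]
      apply Finset.sum_congr rfl
      intro d hd
      have hda : d ∣ a := Nat.dvd_of_mem_divisors (Finset.mem_filter.mp hd).1
      rw [Nat.mul_comm a b, Nat.mul_div_assoc _ hda, mul_comm,
        ArithmeticFunction.isMultiplicative_moebius.map_mul_of_coprime
          (Nat.Coprime.coprime_dvd_left (Nat.div_dvd_of_dvd hda) hab)]
    have e2 : ∑ d ∈ b.divisors.filter IsPrimePow, ArithmeticFunction.moebius (a * b / d) =
        ArithmeticFunction.moebius a * ∑ d ∈ b.divisors.filter IsPrimePow, ArithmeticFunction.moebius (b / d) := by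
      rw [Finset.mul_sum]
      apply Finset.sum_congr rfl
      intro d hd
      have hda : d ∣ b := Nat.dvd_of_mem_divisors (Finset.mem_filter.mp hd).1
      rw [Nat.mul_div_assoc _ hda,
        ArithmeticFunction.isMultiplicative_moebius.map_mul_of_coprime
          (Nat.Coprime.coprime_dvd_right (Nat.div_dvd_of_dvd hda) hab)]
    rw [e1, e2, iha, ihb, ArithmeticFunction.isMultiplicative_moebius.map_mul_of_coprime hab,
      hab.primeFactors_mul, Finset.card_union_of_disjoint hab.disjoint_primeFactors]
    push_cast
    ring

lemma dsum (y : ℕ) (f : ℕ → ℕ → ℝ) : ∑ m ∈ Finset.Icc 1 y, ∑ d ∈ m.divisors, f d (m / d) =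
    ∑ d ∈ Finset.Icc 1 y, ∑ e ∈ Finset.Icc 1 (y / d), f d e := by
  rw [Finset.sum_sigma', Finset.sum_sigma']
  refine Finset.sum_bij' (fun a _ => ⟨a.2, a.1 / a.2⟩) (fun a _ => ⟨a.1 * a.2, a.1⟩) ?_ ?_ ?_ ?_ ?_
  · rintro ⟨m, d⟩ h
    simp only [Finset.mem_sigma, Finset.mem_Icc, Nat.mem_divisors] at h ⊢
    obtain ⟨⟨h1, h2⟩, ⟨e, rfl⟩, h4⟩ := h
    have hd : 0 < d := Nat.pos_of_ne_zero (by rintro rfl; simp at h4)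
    have he : 0 < e := Nat.pos_of_ne_zero (by rintro rfl; simp at h4)
    rw [Nat.mul_div_cancel_left _ hd]
    refine ⟨⟨hd, ?_⟩, he, ?_⟩
    · nlinarith
    · rw [Nat.le_div_iff_mul_le hd]; linarith
  · rintro ⟨d, e⟩ h
    simp only [Finset.mem_sigma, Finset.mem_Icc, Nat.mem_divisors] at h ⊢
    obtain ⟨⟨h1, h2⟩, h3, h4⟩ := h
    rw [Nat.le_div_iff_mul_le (by omega)] at h4
    have : 0 < d * e := Nat.mul_pos (by omega) (by omega)
    exact ⟨⟨this, by linarith⟩, Dvd.intro _ rfl, this.ne'⟩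
  · rintro ⟨m, d⟩ h
    simp only [Finset.mem_sigma, Finset.mem_Icc, Nat.mem_divisors] at h ⊢
    rw [Nat.mul_div_cancel' h.2.1]
  · rintro ⟨d, e⟩ h
    simp only [Finset.mem_sigma, Finset.mem_Icc] at h ⊢
    rw [Nat.mul_div_cancel_left _ (by omega)]
  · rintro ⟨m, d⟩ h
    rfl

/-- all prime factors exceed `z` -/
def Rough (z m : ℕ) : Prop := ∀ p ∈ m.primeFactors, z < p
/-- all prime factors at most `z` -/
def Smooth (z m : ℕ) : Prop := ∀ p ∈ m.primeFactors, p ≤ z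

lemma rough_mul {z a b : ℕ} (ha : a ≠ 0) (hb : b ≠ 0) : Rough z (a * b) ↔ Rough z a ∧ Rough z b := by
  unfold Rough
  rw [Nat.primeFactors_mul ha hb]
  simp only [Finset.mem_union]
  constructor
  · intro h; exact ⟨fun p hp => h p (Or.inl hp), fun p hp => h p (Or.inr hp)⟩
  · rintro ⟨h1, h2⟩ p (hp | hp)
    · exact h1 p hp
    · exact h2 p hp

open Classical in
lemma smooth_moebius (z m : ℕ) (hm : m ≠ 0) :
    ∑ n ∈ m.divisors.filter (Smooth z), ArithmeticFunction.moebius (m / n) =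
      if Rough z m then ArithmeticFunction.moebius m else 0 := by
  obtain ⟨a, b, h, ha, hb⟩ := factor_split (fun p => p ≤ z) m hm
  have ha0 : a ≠ 0 := by rintro rfl; simp at h; exact hm h
  have hb0 : b ≠ 0 := by rintro rfl; simp at h; exact hm h
  have hab : a.Coprime b := by
    rw [← Nat.disjoint_primeFactors ha0 hb0, Finset.disjoint_left]
    intro p hp hq
    exact hb p hq (ha p hp)
  have h1 : m.divisors.filter (Smooth z) = a.divisors := by
    ext d
    simp only [Finset.mem_filter, Nat.mem_divisors]
    constructor
    · rintro ⟨⟨h1, -⟩, h2⟩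
      refine ⟨?_, ha0⟩
      have hd0 : d ≠ 0 := by rintro rfl; simp at h1; exact hm h1
      rw [h] at h1
      apply Nat.Coprime.dvd_of_dvd_mul_right _ h1
      rw [← Nat.disjoint_primeFactors hd0 hb0, Finset.disjoint_left]
      intro p hp hq
      exact hb p hq (h2 p hp)
    · rintro ⟨h1, -⟩
      refine ⟨⟨h ▸ Dvd.dvd.mul_right h1 b, hm⟩, ?_⟩
      intro p hp
      exact ha p (Nat.primeFactors_mono h1 ha0 hp)
  rw [h1]
  have h2 : ∀ d ∈ a.divisors, ArithmeticFunction.moebius (m / d) =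
      ArithmeticFunction.moebius (a / d) * ArithmeticFunction.moebius b := by
    intro d hd
    have hda : d ∣ a := Nat.dvd_of_mem_divisors hd
    rw [h, Nat.mul_comm a b, Nat.mul_div_assoc _ hda, mul_comm,
        ArithmeticFunction.isMultiplicative_moebius.map_mul_of_coprime
          (Nat.Coprime.coprime_dvd_left (Nat.div_dvd_of_dvd hda) hab)]
  rw [Finset.sum_congr rfl h2, ← Finset.sum_mul, Nat.sum_div_divisors a (fun d => ArithmeticFunction.moebius d)]
  have h3 : ∑ d ∈ a.divisors, ArithmeticFunction.moebius d = if a = 1 then 1 else 0 := by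
    have := ArithmeticFunction.coe_mul_zeta_apply (f := ArithmeticFunction.moebius) (x := a)
    rw [← this, ArithmeticFunction.moebius_mul_coe_zeta, ArithmeticFunction.one_apply]
  rw [h3]
  by_cases ha1 : a = 1
  · subst ha1
    rw [one_mul] at h
    subst h
    rw [if_pos rfl, if_pos (show Rough z m from fun p hp => not_le.mp (hb p hp)), one_mul]
  · rw [if_neg ha1, if_neg, zero_mul]
    intro hr
    obtain ⟨p, hp, hpa⟩ := Nat.exists_prime_and_dvd ha1
    have hpa' : p ∈ a.primeFactors := Nat.mem_primeFactors.mpr ⟨hp, hpa, ha0⟩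
    have := ha p hpa'
    have := hr p (Nat.primeFactors_mono (h ▸ Dvd.intro b rfl) hm hpa')
    omega

open Classical in
/-- rough Möbius sum -/
noncomputable def MR (y z : ℕ) : ℝ :=
  ∑ m ∈ (Finset.Icc 1 y).filter (Rough z), (ArithmeticFunction.moebius m : ℝ) / m

open Classical in
/-- rough Möbius sum weighted by omega -/
noncomputable def WR (y z : ℕ) : ℝ :=
  ∑ m ∈ (Finset.Icc 1 y).filter (Rough z), (ArithmeticFunction.moebius m : ℝ) * (m.primeFactors.card : ℝ) / m

lemma mm_nat_div (y d : ℕ) : mm (y / d : ℕ) = mm ((y : ℝ) / d) := by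
  unfold mm
  rw [Nat.floor_div_eq_div, Nat.floor_natCast]

open Classical in
lemma MR_eq (y z : ℕ) : MR y z = ∑ n ∈ (Finset.Icc 1 y).filter (Smooth z), (1 / (n : ℝ)) * mm ((y : ℝ) / n) := by
  have h := dsum y (fun n e => if Smooth z n then (1 / (n : ℝ)) * ((ArithmeticFunction.moebius e : ℝ) / e) else 0)
  have hl : ∑ m ∈ Finset.Icc 1 y, ∑ d ∈ m.divisors, (if Smooth z d then (1 / (d : ℝ)) *
      ((ArithmeticFunction.moebius (m / d) : ℝ) / ((m / d : ℕ) : ℝ)) else 0) = MR y z := by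
    unfold MR
    rw [Finset.sum_filter]
    apply Finset.sum_congr rfl
    intro m hm
    have hm0 : m ≠ 0 := by have := Finset.mem_Icc.mp hm; omega
    have := smooth_moebius z m hm0
    rw [← Finset.sum_filter]
    have h2 : ∀ d ∈ m.divisors.filter (Smooth z), (1 / (d : ℝ)) *
      ((ArithmeticFunction.moebius (m / d) : ℝ) / ((m / d : ℕ) : ℝ)) =
      (ArithmeticFunction.moebius (m / d) : ℝ) * (1 / (m : ℝ)) := by
      intro d hd
      have hdm := Nat.dvd_of_mem_divisors (Finset.mem_filter.mp hd).1
      have hd0 : (d : ℝ) ≠ 0 := by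
        have := Nat.pos_of_dvd_of_pos hdm (by omega)
        positivity
      have hm0' : (m : ℝ) ≠ 0 := by exact_mod_cast hm0
      rw [Nat.cast_div hdm hd0]
      field_simp
    rw [Finset.sum_congr rfl h2, ← Finset.sum_mul, ← Int.cast_sum, this]
    split_ifs <;> simp [div_eq_mul_inv]
  rw [← hl, h, Finset.sum_filter]
  apply Finset.sum_congr rfl
  intro n hn
  split_ifs
  · rw [← Finset.mul_sum, ← mm_nat_div]
    simp [mm]
  · simp

open Classical in
lemma WR_eq (y z : ℕ) : WR y z = - ∑ d ∈ (Finset.Icc 1 y).filter (fun d => IsPrimePow d ∧ Rough z d),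
    (1 / (d : ℝ)) * MR (y / d) z := by
  have h := dsum y (fun n e => if IsPrimePow n ∧ Rough z n then (if Rough z e then (1 / (n : ℝ)) * ((ArithmeticFunction.moebius e : ℝ) / e) else 0) else 0)
  have hl : ∑ m ∈ Finset.Icc 1 y, ∑ d ∈ m.divisors, (if IsPrimePow d ∧ Rough z d then (if Rough z (m / d) then (1 / (d : ℝ)) *
      ((ArithmeticFunction.moebius (m / d) : ℝ) / ((m / d : ℕ) : ℝ)) else 0) else 0) = - WR y z := by
    unfold WR
    rw [Finset.sum_filter, ← Finset.sum_neg_distrib]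
    apply Finset.sum_congr rfl
    intro m hm
    have hm0 : m ≠ 0 := by have := Finset.mem_Icc.mp hm; omega
    have hpp := pp_moebius m
    have h2 : ∀ d ∈ m.divisors, (if IsPrimePow d ∧ Rough z d then (if Rough z (m / d) then (1 / (d : ℝ)) *
      ((ArithmeticFunction.moebius (m / d) : ℝ) / ((m / d : ℕ) : ℝ)) else 0) else 0) =
      (if IsPrimePow d then ((ArithmeticFunction.moebius (m / d) : ℤ) : ℝ) else 0) * (if Rough z m then (1 / (m : ℝ)) else 0) := by
      intro d hd
      have hdm := Nat.dvd_of_mem_divisors hd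
      have hdpos := Nat.pos_of_dvd_of_pos hdm (by omega)
      have hd0 : (d : ℝ) ≠ 0 := by positivity
      have hm0' : (m : ℝ) ≠ 0 := by exact_mod_cast hm0
      have hr : Rough z m ↔ Rough z d ∧ Rough z (m / d) := by
        rw [← rough_mul hdpos.ne' (Nat.div_pos (Nat.le_of_dvd (by omega) hdm) hdpos).ne', Nat.mul_div_cancel' hdm]
      rw [Nat.cast_div hdm hd0]
      simp only [hr]
      split_ifs <;> first | (exfalso; tauto) | simp
      field_simp
    rw [Finset.sum_congr rfl h2, ← Finset.sum_mul, ← Finset.sum_filter, ← Int.cast_sum, hpp]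
    split_ifs
    · push_cast; ring
    · simp
  rw [← neg_neg (WR y z), ← hl, h, Finset.sum_filter]
  congr 1
  apply Finset.sum_congr rfl
  intro n hn
  split_ifs
  · unfold MR
    rw [← Finset.sum_filter, Finset.mul_sum]
  · simp

open Classical in
lemma MR_WR_le (y z : ℕ) : |MR y z| + |WR y z| ≤
    ∑ n ∈ (Finset.Icc 1 y).filter (Smooth z), (1 / (n : ℝ)) * (|mm ((y : ℝ) / n)| + KK ((y : ℝ) / n)) := by
  simp only [mul_add]
  rw [Finset.sum_add_distrib]
  have hM : ∀ y : ℕ, |MR y z| ≤ ∑ n ∈ (Finset.Icc 1 y).filter (Smooth z), (1 / (n : ℝ)) * |mm ((y : ℝ) / n)| := by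
    intro y
    rw [MR_eq]
    refine (Finset.abs_sum_le_sum_abs _ _).trans (le_of_eq ?_)
    apply Finset.sum_congr rfl
    intro n _
    rw [abs_mul, abs_of_nonneg (by positivity)]
  refine add_le_add (hM y) ?_
  rw [WR_eq, abs_neg]
  calc _ ≤ ∑ d ∈ (Finset.Icc 1 y).filter (fun d => IsPrimePow d ∧ Rough z d), (1 / (d : ℝ)) * |MR (y / d) z| := by
        refine (Finset.abs_sum_le_sum_abs _ _).trans (le_of_eq ?_)
        apply Finset.sum_congr rfl
        intro n _
        rw [abs_mul, abs_of_nonneg (by positivity)]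
    _ ≤ ∑ d ∈ (Finset.Icc 1 y).filter IsPrimePow, (1 / (d : ℝ)) * |MR (y / d) z| := by
        apply Finset.sum_le_sum_of_subset_of_nonneg
        · intro d hd
          simp only [Finset.mem_filter] at hd ⊢
          exact ⟨hd.1, hd.2.1⟩
        · intros; positivity
    _ ≤ ∑ d ∈ (Finset.Icc 1 y).filter IsPrimePow, (1 / (d : ℝ)) * ∑ n ∈ (Finset.Icc 1 (y / d)).filter (Smooth z), (1 / (n : ℝ)) * |mm (((y / d : ℕ) : ℝ) / n)| := by
        apply Finset.sum_le_sum
        intro d _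
        exact mul_le_mul_of_nonneg_left (hM _) (by positivity)
    _ = ∑ n ∈ (Finset.Icc 1 y).filter (Smooth z), ∑ d ∈ (Finset.Ioc 0 ⌊(y : ℝ) / n⌋₊).filter (fun d => IsPrimePow d), (1 / (n : ℝ)) * ((1 / (d : ℝ)) * |mm ((y : ℝ) / n / d)|) := by
        simp only [Finset.mul_sum]
        rw [Finset.sum_comm' (t' := (Finset.Icc 1 y).filter (Smooth z))
          (s' := fun n => (Finset.Ioc 0 ⌊(y : ℝ) / n⌋₊).filter (fun d => IsPrimePow d))]
        · apply Finset.sum_congr rfl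
          intro n _
          apply Finset.sum_congr rfl
          intro d _
          rw [← mm_nat_div, Nat.div_div_eq_div_mul, mm_nat_div]
          push_cast
          rw [div_div, mul_comm (d : ℝ) n]
          ring
        · intro d n
          rw [Nat.floor_div_eq_div]
          simp only [Finset.mem_filter, Finset.mem_Icc, Finset.mem_Ioc]
          constructor
          · rintro ⟨⟨⟨a1, a2⟩, a3⟩, ⟨a4, a5⟩, a6⟩
            rw [Nat.le_div_iff_mul_le (by omega)] at a5
            refine ⟨⟨⟨by omega, ?_⟩, a3⟩, ⟨a4, ?_⟩, a6⟩
            · rw [Nat.le_div_iff_mul_le (by omega)]; linarith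
            · nlinarith
          · rintro ⟨⟨⟨a1, a2⟩, a3⟩, ⟨a4, a5⟩, a6⟩
            rw [Nat.le_div_iff_mul_le (by omega)] at a2
            refine ⟨⟨⟨by omega, ?_⟩, a3⟩, ⟨a4, ?_⟩, a6⟩
            · nlinarith
            · rw [Nat.le_div_iff_mul_le (by omega)]; linarith
    _ = _ := by
        apply Finset.sum_congr rfl
        intro n _
        unfold KK
        rw [Finset.mul_sum]


lemma MR_abs_le (y z : ℕ) : |MR y z| ≤ 2 := by
  have := abs_sum_moebius_Q_le (fun p => z < p) (y : ℝ)
  rw [Nat.floor_natCast] at this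
  unfold MR
  convert this using 3
  ext n
  simp [Rough]

lemma WR_crude : ∃ C > (0 : ℝ), ∀ N y z : ℕ, 2 ≤ N → y ≤ N →
    |WR y z| ≤ 2 * Real.log (Real.log N) + C := by
  classical
  obtain ⟨C1, hC1, h1⟩ := prime_recip_le
  obtain ⟨C2, hC2, h2⟩ := proper_pp
  refine ⟨2 * C1 + 4 * C2, by positivity, fun N y z hN hy => ?_⟩
  rw [WR_eq, abs_neg]
  have hA : ∑ d ∈ (Finset.Icc 1 y).filter (fun d => IsPrimePow d ∧ Rough z d), (1 / (d : ℝ)) ≤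
      (Real.log (Real.log N) + C1) + 2 * C2 := by
    rw [← Finset.sum_filter_add_sum_filter_not _ (fun d : ℕ => d.Prime)]
    apply add_le_add
    · refine le_trans ?_ (h1 N hN)
      apply Finset.sum_le_sum_of_subset_of_nonneg
      · intro d hd
        simp only [Finset.mem_filter, Finset.mem_Icc, Finset.mem_Ioc] at hd ⊢
        exact ⟨⟨by omega, by omega⟩, hd.2⟩
      · intros; positivity
    · have := h2 (((Finset.Icc 1 y).filter (fun d => IsPrimePow d ∧ Rough z d)).filter (fun d => ¬ d.Prime)) (by
        intro d hd
        simp only [Finset.mem_filter] at hd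
        exact ⟨hd.1.2.1, hd.2⟩)
      refine le_trans ?_ (mul_le_mul_of_nonneg_left this (by norm_num : (0:ℝ) ≤ 2))
      rw [Finset.mul_sum]
      apply Finset.sum_le_sum
      intro d hd
      simp only [Finset.mem_filter] at hd
      have hd2 : (2 : ℝ) ≤ d := by exact_mod_cast hd.1.2.1.two_le
      have hl : (1 : ℝ) ≤ 2 * Real.log d := by
        have a1 := Real.log_two_gt_d9
        have a2 := Real.log_le_log (by norm_num) hd2
        linarith
      rw [← mul_div_assoc]
      gcongr
  calc _ ≤ ∑ d ∈ (Finset.Icc 1 y).filter (fun d => IsPrimePow d ∧ Rough z d), (1 / (d : ℝ)) * 2 := by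
        refine (Finset.abs_sum_le_sum_abs _ _).trans (Finset.sum_le_sum ?_)
        intro n _
        rw [abs_mul, abs_of_nonneg (by positivity)]
        exact mul_le_mul_of_nonneg_left (MR_abs_le _ _) (by positivity)
    _ ≤ _ := by
        rw [← Finset.sum_mul]
        linarith

lemma MW_fine : ∃ C > (0 : ℝ), ∀ y z : ℕ, 2 ≤ y → 2 ≤ z →
    |MR y z| + |WR y z| ≤ C * Real.log z * (1 / Real.log y + (y : ℝ) ^ (-(1 / (4 * Real.log z)))) := by
  classical
  obtain ⟨C1, hC1, h1⟩ := KK_bound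
  obtain ⟨C2, hC2, h2⟩ := rankin_sum
  refine ⟨2 * C1 * C2, by positivity, fun y z hy hz => ?_⟩
  have hy1 : (1 : ℝ) < y := by exact_mod_cast hy
  have hz1 : (1 : ℝ) < z := by exact_mod_cast hz
  have hly : 0 < Real.log y := Real.log_pos hy1
  have hlz : 0 < Real.log z := Real.log_pos hz1
  set ε := 1 / (2 * Real.log z) with hε
  have hε0 : 0 < ε := by positivity
  set B := 1 / Real.log y + (y : ℝ) ^ (-(1 / (4 * Real.log z))) with hB
  have hB0 : 0 < B := by positivity
  have hterm : ∀ n ∈ (Finset.Icc 1 y).filter (Smooth z),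
      (1 / (n : ℝ)) * (|mm ((y : ℝ) / n)| + KK ((y : ℝ) / n)) ≤ (n : ℝ) ^ (-1 + ε) * (2 * C1 * B) := by
    intro n hn
    simp only [Finset.mem_filter, Finset.mem_Icc] at hn
    have hn1 : (1 : ℝ) ≤ n := by exact_mod_cast hn.1.1
    have hn0 : (0 : ℝ) < n := by linarith
    have hny : (n : ℝ) ≤ y := by exact_mod_cast hn.1.2
    have hv : 1 ≤ (y : ℝ) / n := by rwa [le_div_iff₀ hn0, one_mul]
    have hb := h1 _ hv
    have hlv : 0 ≤ Real.log ((y : ℝ) / n) := Real.log_nonneg hv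
    have e1 : (n : ℝ) ^ (-1 + ε) = (1 / n) * (n : ℝ) ^ ε := by
      rw [Real.rpow_add hn0, Real.rpow_neg_one, one_div]
    rw [e1, mul_assoc]
    refine mul_le_mul_of_nonneg_left (hb.trans ?_) (by positivity)
    by_cases hsq : 2 * Real.log n ≤ Real.log y
    · have hl2 : Real.log y / 2 ≤ Real.log ((y : ℝ) / n) := by
        rw [Real.log_div (by positivity) (by positivity)]; linarith
      have hne : 1 ≤ (n : ℝ) ^ ε := Real.one_le_rpow hn1 hε0.le
      calc C1 / (1 + Real.log ((y : ℝ) / n)) ≤ C1 / (Real.log y / 2) := by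
            gcongr; linarith
        _ = 2 * C1 * (1 / Real.log y) := by field_simp
        _ ≤ 2 * C1 * B := by
            gcongr
            rw [hB]
            have : 0 ≤ (y : ℝ) ^ (-(1 / (4 * Real.log z))) := by positivity
            linarith
        _ ≤ (n : ℝ) ^ ε * (2 * C1 * B) := le_mul_of_one_le_left (by positivity) hne
    · push Not at hsq
      have hk : 1 ≤ (n : ℝ) ^ ε * (y : ℝ) ^ (-(1 / (4 * Real.log z))) := by
        rw [Real.rpow_def_of_pos hn0, Real.rpow_def_of_pos (by linarith), ← Real.exp_add]
        apply Real.one_le_exp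
        have : Real.log n * ε + Real.log y * (-(1 / (4 * Real.log z))) =
          (2 * Real.log n - Real.log y) * (1 / (4 * Real.log z)) := by
          rw [hε]; field_simp; ring
        rw [this]
        apply mul_nonneg (by linarith) (by positivity)
      calc C1 / (1 + Real.log ((y : ℝ) / n)) ≤ C1 / 1 := by
            gcongr; linarith
        _ = C1 * 1 := by ring
        _ ≤ C1 * ((n : ℝ) ^ ε * (y : ℝ) ^ (-(1 / (4 * Real.log z)))) := by gcongr
        _ ≤ (2 * C1) * ((n : ℝ) ^ ε * B) := by
            gcongr
            · linarith
            · rw [hB]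
              have : 0 ≤ 1 / Real.log y := by positivity
              linarith
        _ = _ := by ring
  refine (MR_WR_le y z).trans ((Finset.sum_le_sum hterm).trans ?_)
  rw [← Finset.sum_mul]
  have h3 := h2 z hz ((Finset.Icc 1 y).filter (Smooth z)) (by
    intro n hn
    simp only [Finset.mem_filter, Finset.mem_Icc] at hn
    rw [Nat.mem_factoredNumbers]
    refine ⟨by omega, fun p hp => ?_⟩
    rw [Finset.mem_Ioc]
    exact ⟨(Nat.prime_of_mem_primeFactorsList hp).pos, hn.2 p (List.mem_toFinset.mpr hp)⟩)
  calc _ ≤ (C2 * Real.log z) * (2 * C1 * B) := by gcongr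
    _ = _ := by ring

lemma S1_bound : ∃ C > (0 : ℝ), ∀ N : ℕ, 1 ≤ N → |WR N 0| ≤ C / (1 + Real.log N) := by
  classical
  obtain ⟨C1, hC1, h1⟩ := KK_bound
  refine ⟨C1, hC1, fun N hN => ?_⟩
  have h := MR_WR_le N 0
  have hf : (Finset.Icc 1 N).filter (Smooth 0) = {1} := by
    ext n
    simp only [Finset.mem_filter, Finset.mem_Icc, Finset.mem_singleton]
    constructor
    · rintro ⟨⟨h1, h2⟩, h3⟩
      by_contra hne
      obtain ⟨p, hp, hpn⟩ := Nat.exists_prime_and_dvd hne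
      have := h3 p (Nat.mem_primeFactors.mpr ⟨hp, hpn, by omega⟩)
      have := hp.pos
      omega
    · rintro rfl
      exact ⟨⟨le_rfl, hN⟩, by simp [Smooth]⟩
  rw [hf, Finset.sum_singleton] at h
  simp only [Nat.cast_one, div_one, one_mul] at h
  have h2 := h1 N (by exact_mod_cast hN)
  have := abs_nonneg (MR N 0)
  linarith

open Classical in
/-- fibres of the smallest prime factor -/
lemma minfac_fiber (f : ℕ → ℝ) (hf : ∀ n, ¬ Squarefree n → f n = 0) (p N : ℕ) (hp : p.Prime) :
    ∑ n ∈ (Finset.Icc 2 N).filter (fun n => n.minFac = p), f n =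
      ∑ m ∈ (Finset.Icc 1 (N / p)).filter (Rough p), f (p * m) := by
  rw [← Finset.sum_image (s := (Finset.Icc 1 (N / p)).filter (Rough p)) (g := fun m => p * m) (f := f)
    (fun a _ b _ h => Nat.eq_of_mul_eq_mul_left hp.pos h)]
  symm
  apply Finset.sum_subset
  · intro n hn
    simp only [Finset.mem_image, Finset.mem_filter, Finset.mem_Icc] at hn ⊢
    obtain ⟨m, ⟨⟨h1, h2⟩, h3⟩, rfl⟩ := hn
    rw [Nat.le_div_iff_mul_le hp.pos] at h2
    have := hp.two_le
    refine ⟨⟨by nlinarith, by linarith⟩, ?_⟩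
    apply le_antisymm
    · exact Nat.minFac_le_of_dvd hp.two_le (Dvd.intro m rfl)
    · have hne : p * m ≠ 1 := by nlinarith
      have hq := Nat.minFac_prime hne
      rcases (hq.dvd_mul).mp (Nat.minFac_dvd (p * m)) with h | h
      · exact ((Nat.prime_dvd_prime_iff_eq hq hp).mp h).ge
      · exact (h3 _ (Nat.mem_primeFactors.mpr ⟨hq, h, by omega⟩)).le
  · intro n hn hn2
    simp only [Finset.mem_image, Finset.mem_filter, Finset.mem_Icc] at hn hn2
    obtain ⟨⟨h1, h2⟩, h3⟩ := hn
    apply hf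
    intro hsq
    apply hn2
    obtain ⟨m, hm⟩ : p ∣ n := h3 ▸ Nat.minFac_dvd n
    have hm0 : m ≠ 0 := by rintro rfl; omega
    refine ⟨m, ⟨⟨by omega, ?_⟩, ?_⟩, hm.symm⟩
    · rw [Nat.le_div_iff_mul_le hp.pos]; linarith
    · intro q hq
      have hq' := Nat.mem_primeFactors.mp hq
      have h5 : p ≤ q := by
        rw [← h3]
        exact Nat.minFac_le_of_dvd hq'.1.two_le (hm ▸ Dvd.dvd.mul_left hq'.2.1 p)
      rcases h5.lt_or_eq with h | h
      · exact h
      · exfalso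
        subst h
        have hd : p * p ∣ n := hm ▸ Nat.mul_dvd_mul_left p hq'.2.1
        exact hp.not_isUnit (hsq p hd)

lemma mu_prime_mul {p m : ℕ} (hp : p.Prime) (hm : m ≠ 0) (hr : Rough p m) :
    ArithmeticFunction.moebius (p * m) = - ArithmeticFunction.moebius m ∧
    (p * m).primeFactors.card = 1 + m.primeFactors.card := by
  have hc : p.Coprime m := by
    rw [hp.coprime_iff_not_dvd]
    intro h
    exact lt_irrefl _ (hr p (Nat.mem_primeFactors.mpr ⟨hp, h, hm⟩))
  constructor
  · rw [ArithmeticFunction.isMultiplicative_moebius.map_mul_of_coprime hc,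
      ArithmeticFunction.moebius_apply_prime hp]; ring
  · rw [hc.primeFactors_mul, Finset.card_union_of_disjoint hc.disjoint_primeFactors, hp.primeFactors]
    simp

/-- decomposition according to the smallest prime factor -/
lemma decomp (F : ℕ → ℝ) (N : ℕ) :
    ∑ n ∈ Finset.Icc 2 N, F n.minFac * ((ArithmeticFunction.moebius n : ℝ) * (n.primeFactors.card : ℝ) / n)
      = - ∑ p ∈ (Finset.Ioc 0 N).filter Nat.Prime, F p / p * (MR (N / p) p + WR (N / p) p) := by
  classical
  rw [← Finset.sum_fiberwise_of_maps_to (t := (Finset.Ioc 0 N).filter Nat.Prime) (g := fun n => n.minFac),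
    ← Finset.sum_neg_distrib]
  · apply Finset.sum_congr rfl
    intro p hp
    have hpp := (Finset.mem_filter.mp hp).2
    have h1 : ∀ n ∈ (Finset.Icc 2 N).filter (fun n => n.minFac = p), F n.minFac * ((ArithmeticFunction.moebius n : ℝ) * (n.primeFactors.card : ℝ) / n) =
      F p * ((ArithmeticFunction.moebius n : ℝ) * (n.primeFactors.card : ℝ) / n) := by
      intro n hn
      rw [(Finset.mem_filter.mp hn).2]
    rw [Finset.sum_congr rfl h1, ← Finset.mul_sum, minfac_fiber (fun n => (ArithmeticFunction.moebius n : ℝ) * (n.primeFactors.card : ℝ) / n) _ p N hpp]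
    · unfold MR WR
      rw [← Finset.sum_add_distrib, Finset.mul_sum, Finset.mul_sum, ← Finset.sum_neg_distrib]
      apply Finset.sum_congr rfl
      intro m hm
      simp only [Finset.mem_filter, Finset.mem_Icc] at hm
      obtain ⟨e1, e2⟩ := mu_prime_mul hpp (by omega) hm.2
      rw [e1, e2]
      have hp0 : (p : ℝ) ≠ 0 := by exact_mod_cast hpp.ne_zero
      have hm0 : (m : ℝ) ≠ 0 := by
        have : m ≠ 0 := by omega
        exact_mod_cast this
      push_cast
      field_simp
    · intro n hn
      simp only [ArithmeticFunction.moebius_eq_zero_of_not_squarefree hn, Int.cast_zero, zero_mul, zero_div]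
  · intro n hn
    simp only [Finset.mem_filter, Finset.mem_Icc, Finset.mem_Ioc] at hn ⊢
    exact ⟨⟨Nat.minFac_pos n, (Nat.minFac_le (by omega)).trans hn.2⟩, Nat.minFac_prime (by omega)⟩


/-- `μ(m)(1+ω(m))/m` -/
noncomputable def gg (m : ℕ) : ℝ :=
  (ArithmeticFunction.moebius m : ℝ) * (1 + (m.primeFactors.card : ℝ)) / m

open Classical in
lemma sum_gg (y z : ℕ) : ∑ m ∈ (Finset.Icc 1 y).filter (Rough z), gg m = MR y z + WR y z := by
  unfold MR WR gg
  rw [← Finset.sum_add_distrib]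
  apply Finset.sum_congr rfl
  intro m _
  ring

lemma rough_iff {p m : ℕ} (hm : 2 ≤ m) : Rough p m ↔ p < m.minFac := by
  constructor
  · intro h
    exact h _ (Nat.mem_primeFactors.mpr ⟨Nat.minFac_prime (by omega), Nat.minFac_dvd m, by omega⟩)
  · intro h q hq
    have hq' := Nat.mem_primeFactors.mp hq
    exact h.trans_le (Nat.minFac_le_of_dvd hq'.1.two_le hq'.2.1)

lemma rough_one (p : ℕ) : Rough p 1 := by simp [Rough]

lemma rough_mono {p q m : ℕ} (h : q ≤ p) (hr : Rough p m) : Rough q m :=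
  fun r hr' => h.trans_lt (hr r hr')

open Classical in
lemma D_swap (a : ℕ → ℝ) (N W : ℕ) (hW : W < N) :
    ∑ p ∈ Finset.Ioc W N, a p * (MR (N / p) p + WR (N / p) p) =
      (∑ p ∈ Finset.Ioc W N, a p) * (MR (N / (W + 1)) W + WR (N / (W + 1)) W)
      - ∑ m ∈ (Finset.Icc 2 (N / (W + 1))).filter (Rough W),
        gg m * ∑ p ∈ Finset.Ioc (min (N / m) (m.minFac - 1)) N, a p := by
  set Y := N / (W + 1) with hY
  set t : ℕ → ℕ := fun m => if m = 1 then N else min (N / m) (m.minFac - 1) with ht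
  have hY1 : 1 ≤ Y := by rw [hY, Nat.le_div_iff_mul_le (by omega)]; omega
  have h1 : ∑ p ∈ Finset.Ioc W N, a p * (MR (N / p) p + WR (N / p) p) =
      ∑ m ∈ (Finset.Icc 1 Y).filter (Rough W), ∑ p ∈ Finset.Ioc W (t m), a p * gg m := by
    simp only [← sum_gg, Finset.mul_sum]
    apply Finset.sum_comm'
    intro p m
    simp only [Finset.mem_filter, Finset.mem_Icc, Finset.mem_Ioc]
    constructor
    · rintro ⟨⟨h1, h2⟩, ⟨h3, h4⟩, h5⟩
      rw [Nat.le_div_iff_mul_le (by omega)] at h4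
      refine ⟨⟨h1, ?_⟩, ⟨h3, ?_⟩, rough_mono h1.le h5⟩
      · by_cases hm : m = 1
        · simp [ht, hm, h2]
        · simp only [ht, if_neg hm]
          rw [rough_iff (by omega)] at h5
          apply le_min
          · rw [Nat.le_div_iff_mul_le (by omega)]; linarith
          · omega
      · rw [hY, Nat.le_div_iff_mul_le (by omega)]
        nlinarith
    · rintro ⟨⟨h1, h2⟩, ⟨h3, h4⟩, h5⟩
      by_cases hm : m = 1
      · subst hm
        simp only [ht, if_true] at h2
        refine ⟨⟨h1, h2⟩, ⟨le_rfl, ?_⟩, rough_one p⟩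
        rw [Nat.le_div_iff_mul_le (by omega)]; omega
      · simp only [ht, if_neg hm] at h2
        have h6 := h2.trans (min_le_left _ _)
        have h7 := h2.trans (min_le_right _ _)
        rw [Nat.le_div_iff_mul_le (by omega)] at h6
        refine ⟨⟨h1, ?_⟩, ⟨h3, ?_⟩, ?_⟩
        · nlinarith
        · rw [Nat.le_div_iff_mul_le (by omega)]; linarith
        · rw [rough_iff (by omega)]; omega
  have h2 : ∀ m ∈ (Finset.Icc 1 Y).filter (Rough W), ∑ p ∈ Finset.Ioc W (t m), a p * gg m =
      (∑ p ∈ Finset.Ioc W N, a p) * gg m - gg m * ∑ p ∈ Finset.Ioc (t m) N, a p := by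
    intro m hm
    simp only [Finset.mem_filter, Finset.mem_Icc] at hm
    obtain ⟨⟨h1, h2⟩, h3⟩ := hm
    have ht1 : W ≤ t m := by
      by_cases hm : m = 1
      · simp [ht, hm, hW.le]
      · simp only [ht, if_neg hm]
        rw [rough_iff (by omega)] at h3
        rw [hY, Nat.le_div_iff_mul_le (by omega)] at h2
        apply le_min
        · rw [Nat.le_div_iff_mul_le (by omega)]; nlinarith
        · omega
    have ht2 : t m ≤ N := by
      by_cases hm : m = 1
      · simp [ht, hm]
      · simp only [ht, if_neg hm]
        exact (min_le_left _ _).trans (Nat.div_le_self _ _)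
    rw [← Finset.sum_Ioc_consecutive a ht1 ht2, ← Finset.sum_mul]
    ring
  rw [h1, Finset.sum_congr rfl h2, Finset.sum_sub_distrib, ← Finset.mul_sum, sum_gg]
  congr 1
  symm
  apply Finset.sum_subset_zero_on_sdiff
  · intro m hm
    simp only [Finset.mem_filter, Finset.mem_Icc] at hm ⊢
    exact ⟨⟨by omega, by omega⟩, hm.2⟩
  · intro m hm
    simp only [Finset.mem_sdiff, Finset.mem_filter, Finset.mem_Icc, not_and] at hm
    have : m = 1 := by
      by_contra hne
      exact hm.2 ⟨by omega, hm.1.1.2⟩ hm.1.2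
    simp [ht, this]
  · intro m hm
    simp only [Finset.mem_filter, Finset.mem_Icc] at hm
    simp only [ht]
    rw [if_neg (by omega)]

lemma gg_sqfree {n : ℕ} (h : ¬ Squarefree n) : gg n = 0 := by
  simp [gg, ArithmeticFunction.moebius_eq_zero_of_not_squarefree h]

open Classical in
lemma B_eq (E : ℕ → ℝ) (N W : ℕ) :
    ∑ m ∈ (Finset.Icc 2 N).filter (fun m => W < m.minFac ∧ m.minFac * m ≤ N), gg m * E (m.minFac - 1) =
      - ∑ r ∈ (Finset.Ioc W N).filter Nat.Prime, E (r - 1) / r * (2 * MR (N / r / r) r + WR (N / r / r) r) := by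
  rw [← Finset.sum_fiberwise_of_maps_to (t := (Finset.Ioc W N).filter Nat.Prime) (g := fun n => n.minFac),
    ← Finset.sum_neg_distrib]
  · apply Finset.sum_congr rfl
    intro r hr
    simp only [Finset.mem_filter, Finset.mem_Ioc] at hr
    have hs : ((Finset.Icc 2 N).filter (fun m => W < m.minFac ∧ m.minFac * m ≤ N)).filter (fun n => n.minFac = r)
        = (Finset.Icc 2 (N / r)).filter (fun n => n.minFac = r) := by
      ext m
      simp only [Finset.mem_filter, Finset.mem_Icc]
      have := hr.2.pos
      constructor
      · rintro ⟨⟨⟨h1, h2⟩, h3, h4⟩, rfl⟩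
        refine ⟨⟨h1, ?_⟩, rfl⟩
        rw [Nat.le_div_iff_mul_le (by omega)]; linarith
      · rintro ⟨⟨h1, h2⟩, rfl⟩
        rw [Nat.le_div_iff_mul_le (by omega)] at h2
        refine ⟨⟨⟨h1, ?_⟩, hr.1.1, by linarith⟩, rfl⟩
        nlinarith
    rw [hs]
    have h1 : ∀ n ∈ (Finset.Icc 2 (N / r)).filter (fun n => n.minFac = r), gg n * E (n.minFac - 1) = gg n * E (r - 1) := by
      intro n hn
      rw [(Finset.mem_filter.mp hn).2]
    rw [Finset.sum_congr rfl h1, ← Finset.sum_mul, minfac_fiber gg (fun n => gg_sqfree) r (N / r) hr.2]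
    unfold MR WR
    rw [Finset.mul_sum, ← Finset.sum_add_distrib, Finset.mul_sum, ← Finset.sum_neg_distrib, Finset.sum_mul]
    apply Finset.sum_congr rfl
    intro m hm
    simp only [Finset.mem_filter, Finset.mem_Icc] at hm
    obtain ⟨e1, e2⟩ := mu_prime_mul hr.2 (by omega) hm.2
    unfold gg
    rw [e1, e2]
    have hp0 : (r : ℝ) ≠ 0 := by exact_mod_cast hr.2.ne_zero
    have hm0 : (m : ℝ) ≠ 0 := by
      have : m ≠ 0 := by omega
      exact_mod_cast this
    push_cast
    field_simp
    ring
  · intro n hn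
    simp only [Finset.mem_filter, Finset.mem_Icc, Finset.mem_Ioc] at hn ⊢
    exact ⟨⟨hn.2.1, (Nat.minFac_le (by omega)).trans hn.1.2⟩, Nat.minFac_prime (by omega)⟩

open Classical in
lemma B_bound : ∃ C > (0 : ℝ), ∀ (E : ℕ → ℝ) (K : ℝ) (N W : ℕ), 0 ≤ K → 16 ≤ N → 2 ≤ W →
    (∀ t, 1 ≤ t → |E t| ≤ K / Real.log (t + 1)) →
    |∑ m ∈ (Finset.Icc 2 N).filter (fun m => W < m.minFac ∧ m.minFac * m ≤ N), gg m * E (m.minFac - 1)|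
      ≤ C * K * (1 + Real.log (Real.log N)) ^ 2 / Real.log W := by
  obtain ⟨C1, hC1, h1⟩ := prime_recip_le
  obtain ⟨C2, hC2, h2⟩ := WR_crude
  refine ⟨(1 + C1) * (6 + C2), by positivity, fun E K N W hK hN hW hE => ?_⟩
  have hl : 0 ≤ Real.log (Real.log N) := by
    apply Real.log_nonneg
    rw [Real.le_log_iff_exp_le (by positivity)]
    have := Real.exp_one_lt_d9
    have : (16 : ℝ) ≤ N := by exact_mod_cast hN
    linarith
  set LL := Real.log (Real.log N) with hLL
  have hlW : 0 < Real.log W := Real.log_pos (by exact_mod_cast hW)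
  rw [B_eq, abs_neg]
  calc _ ≤ ∑ r ∈ (Finset.Ioc W N).filter Nat.Prime, (1 / (r : ℝ)) * (K / Real.log W * (4 + (2 * LL + C2))) := by
        refine (Finset.abs_sum_le_sum_abs _ _).trans (Finset.sum_le_sum ?_)
        intro r hr
        simp only [Finset.mem_filter, Finset.mem_Ioc] at hr
        rw [abs_mul, abs_div, Nat.abs_cast]
        have e1 : |E (r - 1)| ≤ K / Real.log W := by
          refine (hE (r - 1) (by omega)).trans ?_
          have : ((r - 1 : ℕ) : ℝ) + 1 = r := by
            rw [Nat.cast_sub (by omega)]; simp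
          rw [this]
          gcongr
          exact_mod_cast hr.1.1.le
        have e2 : |2 * MR (N / r / r) r + WR (N / r / r) r| ≤ 4 + (2 * LL + C2) := by
          refine (abs_add_le _ _).trans (add_le_add ?_ ?_)
          · rw [abs_mul]
            have := MR_abs_le (N / r / r) r
            norm_num
            linarith
          · exact h2 N _ _ (by omega) ((Nat.div_le_self _ _).trans (Nat.div_le_self _ _))
        calc _ ≤ K / Real.log W / r * (4 + (2 * LL + C2)) := by gcongr
          _ = _ := by ring
    _ = (∑ r ∈ (Finset.Ioc W N).filter Nat.Prime, (1 / (r : ℝ))) * (K / Real.log W * (4 + (2 * LL + C2))) := by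
        rw [Finset.sum_mul]
    _ ≤ (LL + C1) * (K / Real.log W * (4 + (2 * LL + C2))) := by
        apply mul_le_mul_of_nonneg_right _ (by positivity)
        refine le_trans ?_ (h1 N (by omega))
        apply Finset.sum_le_sum_of_subset_of_nonneg
        · intro d hd
          simp only [Finset.mem_filter, Finset.mem_Ioc] at hd ⊢
          exact ⟨⟨by omega, by omega⟩, hd.2⟩
        · intros; positivity
    _ = (LL + C1) * (4 + (2 * LL + C2)) * (K / Real.log W) := by ring
    _ ≤ (((1 + C1) * (1 + LL)) * ((6 + C2) * (1 + LL))) * (K / Real.log W) := by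
        apply mul_le_mul_of_nonneg_right _ (by positivity)
        apply mul_le_mul
        · nlinarith [mul_nonneg hC1.le hl]
        · nlinarith [mul_nonneg hC2.le hl]
        · positivity
        · positivity
    _ = _ := by ring


lemma pair_sum (s t : Finset ℕ)
    (ht : ∀ m ∈ s, ∀ q ∈ m.primeFactors, m / q ∈ t) (F : ℕ → ℕ → ℝ) (B : ℕ → ℝ)
    (hB : ∀ m' ∈ t, ∀ u : Finset ℕ, (∀ q ∈ u, q.Prime ∧ q * m' ∈ s) → ∑ q ∈ u, F q m' ≤ B m') :
    ∑ m ∈ s, ∑ q ∈ m.primeFactors, F q (m / q) ≤ ∑ m' ∈ t, B m' := by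
  classical
  rw [Finset.sum_sigma']
  rw [← Finset.sum_fiberwise_of_maps_to (t := t) (g := fun a : (_ : ℕ) × ℕ => a.1 / a.2)]
  · apply Finset.sum_le_sum
    intro m' hm'
    set fib := (s.sigma fun m => m.primeFactors).filter (fun a : (_ : ℕ) × ℕ => a.1 / a.2 = m') with hfib
    have hmem : ∀ a ∈ fib, a.2.Prime ∧ a.1 = a.2 * m' ∧ a.1 ∈ s := by
      intro a ha
      simp only [hfib, Finset.mem_filter, Finset.mem_sigma] at ha
      obtain ⟨⟨h1, h2⟩, h3⟩ := ha
      have h2' := Nat.mem_primeFactors.mp h2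
      exact ⟨h2'.1, by rw [← h3, Nat.mul_div_cancel' h2'.2.1], h1⟩
    have hinj : Set.InjOn (fun a : (_ : ℕ) × ℕ => a.2) (fib : Set ((_ : ℕ) × ℕ)) := by
      rintro ⟨a1, a2⟩ ha ⟨b1, b2⟩ hb h
      have h1 := (hmem _ (Finset.mem_coe.mp ha)).2.1
      have h2 := (hmem _ (Finset.mem_coe.mp hb)).2.1
      simp only at h h1 h2
      subst h
      rw [h1, h2]
    have h1 : ∑ a ∈ fib, F a.2 (a.1 / a.2) = ∑ q ∈ fib.image (fun a => a.2), F q m' := by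
      rw [Finset.sum_image hinj]
      apply Finset.sum_congr rfl
      intro a ha
      rw [(Finset.mem_filter.mp ha).2]
    rw [h1]
    apply hB m' hm'
    intro q hq
    obtain ⟨a, ha, rfl⟩ := Finset.mem_image.mp hq
    obtain ⟨h1, h2, h3⟩ := hmem a ha
    exact ⟨h1, h2 ▸ h3⟩
  · rintro ⟨m, q⟩ h
    simp only [Finset.mem_sigma] at h
    exact ht m h.1 q h.2

open Classical in
lemma rough_omega : ∃ C > (0 : ℝ), ∀ v N : ℕ, 2 ≤ v → v ≤ N → 16 ≤ N →
    ∑ m ∈ (Finset.Icc 1 N).filter (Rough v), (2 + (m.primeFactors.card : ℝ)) / m ≤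
      C * (1 + Real.log (Real.log N)) * (Real.log N / Real.log v) := by
  obtain ⟨C1, hC1, h1⟩ := prime_recip_le
  obtain ⟨C2, hC2, h2⟩ := rough_sum
  refine ⟨(2 + C1) * C2, by positivity, fun v N hv hvN hN => ?_⟩
  have hl : 0 ≤ Real.log (Real.log N) := by
    apply Real.log_nonneg
    rw [Real.le_log_iff_exp_le (by positivity)]
    have := Real.exp_one_lt_d9
    have : (16 : ℝ) ≤ N := by exact_mod_cast hN
    linarith
  set LL := Real.log (Real.log N) with hLL
  set R := (Finset.Icc 1 N).filter (Rough v) with hR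
  have hRpos : ∀ m ∈ R, m ≠ 0 := by
    intro m hm
    simp only [hR, Finset.mem_filter, Finset.mem_Icc] at hm
    omega
  have hA : ∑ m ∈ R, 1 / (m : ℝ) ≤ C2 * (Real.log N / Real.log v) := by
    apply h2 v N hv hvN
    intro n hn
    simp only [hR, Finset.mem_filter, Finset.mem_Icc] at hn
    rw [Nat.mem_factoredNumbers]
    refine ⟨by omega, fun p hp => ?_⟩
    rw [Finset.mem_Ioc]
    exact ⟨hn.2 p (List.mem_toFinset.mpr hp), (Nat.le_of_mem_primeFactorsList hp).trans hn.1.2⟩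
  have hBB : ∑ m ∈ R, ∑ q ∈ m.primeFactors, (1 / (q : ℝ)) * (1 / ((m / q : ℕ) : ℝ)) ≤
      ∑ m ∈ R, (LL + C1) * (1 / (m : ℝ)) := by
    apply pair_sum R R _ (fun q m => (1 / (q : ℝ)) * (1 / (m : ℝ)))
    · intro m' hm' u hu
      rw [← Finset.sum_mul]
      apply mul_le_mul_of_nonneg_right _ (by positivity)
      refine le_trans ?_ (h1 N (by omega))
      apply Finset.sum_le_sum_of_subset_of_nonneg
      · intro q hq
        obtain ⟨a1, a2⟩ := hu q hq
        simp only [hR, Finset.mem_filter, Finset.mem_Ioc, Finset.mem_Icc] at a2 hm' ⊢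
        exact ⟨⟨a1.pos, by nlinarith⟩, a1⟩
      · intros; positivity
    · intro m hm q hq
      simp only [hR, Finset.mem_filter, Finset.mem_Icc] at hm ⊢
      obtain ⟨b1, b2, b3⟩ := Nat.mem_primeFactors.mp hq
      refine ⟨⟨Nat.div_pos (Nat.le_of_dvd (by omega) b2) b1.pos, (Nat.div_le_self _ _).trans hm.1.2⟩, ?_⟩
      intro p hp
      exact hm.2 p (Nat.primeFactors_mono (Nat.div_dvd_of_dvd b2) b3 hp)
  have e1 : ∀ m ∈ R, ∑ q ∈ m.primeFactors, (1 / (q : ℝ)) * (1 / ((m / q : ℕ) : ℝ)) = (m.primeFactors.card : ℝ) / m := by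
    intro m hm
    have : ∀ q ∈ m.primeFactors, (1 / (q : ℝ)) * (1 / ((m / q : ℕ) : ℝ)) = 1 / (m : ℝ) := by
      intro q hq
      obtain ⟨b1, b2, b3⟩ := Nat.mem_primeFactors.mp hq
      have hq0 : (q : ℝ) ≠ 0 := by exact_mod_cast b1.ne_zero
      have hm0 : (m : ℝ) ≠ 0 := by exact_mod_cast b3
      rw [Nat.cast_div b2 hq0]
      field_simp
    rw [Finset.sum_congr rfl this, Finset.sum_const, nsmul_eq_mul]
    ring
  rw [Finset.sum_congr rfl e1, ← Finset.mul_sum] at hBB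
  have e2 : ∑ m ∈ R, (2 + (m.primeFactors.card : ℝ)) / m = 2 * ∑ m ∈ R, 1 / (m : ℝ) + ∑ m ∈ R, (m.primeFactors.card : ℝ) / m := by
    rw [Finset.mul_sum, ← Finset.sum_add_distrib]
    apply Finset.sum_congr rfl
    intro m _
    ring
  rw [e2]
  calc _ ≤ 2 * ∑ m ∈ R, 1 / (m : ℝ) + (LL + C1) * ∑ m ∈ R, 1 / (m : ℝ) := by linarith
    _ = (2 + LL + C1) * ∑ m ∈ R, 1 / (m : ℝ) := by ring
    _ ≤ (2 + LL + C1) * (C2 * (Real.log N / Real.log v)) := mul_le_mul_of_nonneg_left hA (by positivity)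
    _ ≤ ((2 + C1) * (1 + LL)) * (C2 * (Real.log N / Real.log v)) := by
        apply mul_le_mul_of_nonneg_right
        · nlinarith [mul_nonneg hC1.le hl]
        · have : 0 ≤ Real.log v := Real.log_natCast_nonneg v
          have : 0 ≤ Real.log N := Real.log_natCast_nonneg N
          positivity
    _ = _ := by ring

lemma class_bound : ∃ C > (0 : ℝ), ∀ i N : ℕ, 1 ≤ i → 16 ≤ N → 2 ^ i ≤ N → ∀ s : Finset ℕ,
    (∀ m ∈ s, 2 ≤ m ∧ Squarefree m ∧ 2 ^ i * m ≤ N ∧ N < 2 ^ (i + 1) * m ∧ Rough (2 ^ i) m ∧ N ≤ m * m) →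
    ∑ m ∈ s, (1 + (m.primeFactors.card : ℝ)) / m ≤ C * (1 + Real.log (Real.log N)) / i := by
  classical
  obtain ⟨C1, hC1, h1⟩ := rough_omega
  have hl4 : 0 < Real.log 4 := Real.log_pos (by norm_num)
  have hl2 : 0 < Real.log 2 := Real.log_pos (by norm_num)
  refine ⟨4 * Real.log 4 * C1 / Real.log 2, by positivity, fun i N hi hN hiN s hs => ?_⟩
  have hlN : 0 < Real.log N := Real.log_pos (by exact_mod_cast (by omega : 1 < N))
  set R := (Finset.Icc 1 N).filter (Rough (2 ^ i)) with hR
  have hpair : ∑ m ∈ s, ∑ q ∈ m.primeFactors, (Real.log q / q) * ((2 + ((m / q).primeFactors.card : ℝ)) / ((m / q : ℕ) : ℝ)) ≤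
      ∑ m ∈ R, (2 * Real.log 4) * ((2 + (m.primeFactors.card : ℝ)) / m) := by
    apply pair_sum s R _
      (fun q m => (Real.log q / q) * ((2 + (m.primeFactors.card : ℝ)) / m))
    · intro m' hm' u hu
      rw [← Finset.sum_mul]
      apply mul_le_mul_of_nonneg_right _ (by positivity)
      simp only [hR, Finset.mem_filter, Finset.mem_Icc] at hm'
      have hm0 : (0 : ℝ) < m' := by exact_mod_cast (by omega : 0 < m')
      have hN0 : (0 : ℝ) < N := by exact_mod_cast (by omega : 0 < N)
      apply prime_log_window ((N : ℝ) / (2 ^ (i + 1) * m')) (by positivity)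
      intro q hq
      obtain ⟨a1, a2⟩ := hu q hq
      obtain ⟨b1, b2, b3, b4, b5, b6⟩ := hs _ a2
      refine ⟨a1, ?_, ?_⟩
      · rw [div_le_iff₀ (by positivity)]
        have : (N : ℝ) ≤ 2 ^ (i + 1) * (q * m') := by exact_mod_cast b4.le
        linarith
      · have : (2 : ℝ) ^ i * (q * m') ≤ N := by exact_mod_cast b3
        rw [← mul_div_assoc, le_div_iff₀ (by positivity), pow_succ]
        linarith
    · intro m hm q hq
      obtain ⟨c1, c2, c3, c4, c5, c6⟩ := hs m hm
      simp only [hR, Finset.mem_filter, Finset.mem_Icc]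
      obtain ⟨b1, b2, b3⟩ := Nat.mem_primeFactors.mp hq
      have hmN : m ≤ N := le_trans (Nat.le_mul_of_pos_left m (by positivity)) c3
      refine ⟨⟨Nat.div_pos (Nat.le_of_dvd (by omega) b2) b1.pos, (Nat.div_le_self _ _).trans hmN⟩, ?_⟩
      intro p hp
      exact c5 p (Nat.primeFactors_mono (Nat.div_dvd_of_dvd b2) b3 hp)
  have hterm : ∀ m ∈ s, (1 + (m.primeFactors.card : ℝ)) / m ≤ (2 / Real.log N) *
      ∑ q ∈ m.primeFactors, (Real.log q / q) * ((2 + ((m / q).primeFactors.card : ℝ)) / ((m / q : ℕ) : ℝ)) := by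
    intro m hm
    obtain ⟨c1, c2, c3, c4, c5, c6⟩ := hs m hm
    have hm0 : (0 : ℝ) < m := by exact_mod_cast (by omega : 0 < m)
    have h3 : Real.log N ≤ 2 * Real.log m := by
      have : (N : ℝ) ≤ m * m := by exact_mod_cast c6
      have h4 := Real.log_le_log (by exact_mod_cast (by omega : 0 < N)) this
      rw [Real.log_mul hm0.ne' hm0.ne'] at h4
      linarith
    have h5 : Real.log m = ∑ q ∈ m.primeFactors, Real.log q := by
      conv_lhs => rw [← Nat.prod_primeFactors_of_squarefree c2]
      rw [Nat.cast_prod, Real.log_prod]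
      intro q hq
      exact_mod_cast (Nat.prime_of_mem_primeFactors hq).ne_zero
    have h6 : ∑ q ∈ m.primeFactors, Real.log q * ((1 + (m.primeFactors.card : ℝ)) / m) ≤
        ∑ q ∈ m.primeFactors, (Real.log q / q) * ((2 + ((m / q).primeFactors.card : ℝ)) / ((m / q : ℕ) : ℝ)) := by
      apply Finset.sum_le_sum
      intro q hq
      obtain ⟨b1, b2, b3⟩ := Nat.mem_primeFactors.mp hq
      have hq0 : (0 : ℝ) < q := by exact_mod_cast b1.pos
      have hcard : m.primeFactors.card ≤ 1 + (m / q).primeFactors.card := by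
        have hmq : m = q * (m / q) := (Nat.mul_div_cancel' b2).symm
        have hne : m / q ≠ 0 := by
          intro h; rw [h] at hmq; simp at hmq; omega
        conv_lhs => rw [hmq]
        rw [Nat.primeFactors_mul b1.ne_zero hne, b1.primeFactors]
        refine (Finset.card_union_le _ _).trans ?_
        simp
      have hcard' : (m.primeFactors.card : ℝ) ≤ 1 + ((m / q).primeFactors.card : ℝ) := by exact_mod_cast hcard
      have hlq : 0 ≤ Real.log q := Real.log_natCast_nonneg q
      rw [Nat.cast_div b2 hq0.ne']
      have : Real.log q / q * ((2 + ((m / q).primeFactors.card : ℝ)) / ((m : ℝ) / q)) =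
        Real.log q * ((2 + ((m / q).primeFactors.card : ℝ)) / m) := by
        field_simp
      rw [this]
      apply mul_le_mul_of_nonneg_left _ hlq
      exact div_le_div_of_nonneg_right (by linarith) hm0.le
    rw [← Finset.sum_mul, ← h5] at h6
    have h7 : (0 : ℝ) ≤ (1 + (m.primeFactors.card : ℝ)) / m := by positivity
    rw [div_mul_eq_mul_div, le_div_iff₀ hlN]
    nlinarith
  have hp2 : (2 : ℕ) ≤ 2 ^ i := by
    calc 2 = 2 ^ 1 := rfl
      _ ≤ 2 ^ i := Nat.pow_le_pow_right (by norm_num) hi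
  have h8 := h1 (2 ^ i) N hp2 hiN hN
  have hi0 : (0 : ℝ) < i := by exact_mod_cast hi
  calc _ ≤ (2 / Real.log N) * ∑ m ∈ s, ∑ q ∈ m.primeFactors, (Real.log q / q) * ((2 + ((m / q).primeFactors.card : ℝ)) / ((m / q : ℕ) : ℝ)) := by
        rw [Finset.mul_sum]
        exact Finset.sum_le_sum hterm
    _ ≤ (2 / Real.log N) * ((2 * Real.log 4) * (C1 * (1 + Real.log (Real.log N)) * (Real.log N / Real.log ((2 ^ i : ℕ) : ℝ)))) := by
        apply mul_le_mul_of_nonneg_left _ (by positivity)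
        refine hpair.trans ?_
        rw [← Finset.mul_sum]
        exact mul_le_mul_of_nonneg_left h8 (by positivity)
    _ = _ := by
        push_cast
        rw [Real.log_pow]
        field_simp
        ring

open Classical in
lemma C_bound : ∃ C > (0 : ℝ), ∀ (E : ℕ → ℝ) (K : ℝ) (N W : ℕ), 0 ≤ K → 16 ≤ N → 2 ≤ W → W < N →
    (∀ t, 1 ≤ t → |E t| ≤ K / Real.log (t + 1)) →
    |∑ m ∈ (Finset.Icc 2 (N / (W + 1))).filter (fun m => Rough W m ∧ ¬ m.minFac * m ≤ N), gg m * E (N / m)|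
      ≤ C * K * (1 + Real.log (Real.log N)) / Real.log W := by
  obtain ⟨C1, hC1, h1⟩ := class_bound
  have hl2 : 0 < Real.log 2 := Real.log_pos (by norm_num)
  refine ⟨4 * C1, by positivity, fun E K N W hK hN hW hWN hE => ?_⟩
  have hl : 0 ≤ Real.log (Real.log N) := by
    apply Real.log_nonneg
    rw [Real.le_log_iff_exp_le (by positivity)]
    have := Real.exp_one_lt_d9
    have : (16 : ℝ) ≤ N := by exact_mod_cast hN
    linarith
  set LL := Real.log (Real.log N) with hLL
  have hlW : 0 < Real.log W := Real.log_pos (by exact_mod_cast hW)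
  set S := (Finset.Icc 2 (N / (W + 1))).filter (fun m => Rough W m ∧ ¬ m.minFac * m ≤ N) with hS
  set S' := S.filter Squarefree with hS'
  have e0 : ∑ m ∈ S, gg m * E (N / m) = ∑ m ∈ S', gg m * E (N / m) := by
    rw [hS', Finset.sum_filter (s := S)]
    apply Finset.sum_congr rfl
    intro m _
    split_ifs with h
    · rfl
    · rw [gg_sqfree h, zero_mul]
  rw [e0]
  set w : ℕ → ℕ := fun m => Nat.log 2 (N / m) with hw
  set i0 := Nat.log 2 (W + 1) with hi0
  have hi01 : 1 ≤ i0 := by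
    rw [hi0]
    exact Nat.log_pos (by norm_num) (by omega)
  have hSm : ∀ m ∈ S', 2 ≤ m ∧ Squarefree m ∧ m * (W + 1) ≤ N ∧ Rough W m ∧ N < m.minFac * m := by
    intro m hm
    simp only [hS', hS, Finset.mem_filter, Finset.mem_Icc, not_le] at hm
    obtain ⟨⟨⟨a1, a2⟩, a3, a4⟩, a5⟩ := hm
    rw [Nat.le_div_iff_mul_le (by omega)] at a2
    exact ⟨a1, a5, a2, a3, a4⟩
  have hwi : ∀ m ∈ S', i0 ≤ w m := by
    intro m hm
    obtain ⟨a1, a2, a3, a4, a5⟩ := hSm m hm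
    apply Nat.log_mono_right
    rw [Nat.le_div_iff_mul_le (by omega)]
    linarith
  have hfib : ∀ i ∈ S'.image w, ∑ m ∈ S'.filter (fun m => w m = i), |gg m * E (N / m)| ≤
      ((i : ℝ) ^ 2)⁻¹ * (C1 * (1 + LL) * K / Real.log 2) := by
    intro i hi
    obtain ⟨m0, hm0, rfl⟩ := Finset.mem_image.mp hi
    have hii := hwi m0 hm0
    set i := w m0
    have hi1 : 1 ≤ i := by omega
    have hir : (0 : ℝ) < i := by exact_mod_cast hi1
    have hprop : ∀ m ∈ S'.filter (fun m => w m = i), 2 ≤ m ∧ Squarefree m ∧ 2 ^ i * m ≤ N ∧ N < 2 ^ (i + 1) * m ∧ Rough (2 ^ i) m ∧ N ≤ m * m := by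
      intro m hm
      obtain ⟨hm1, hm2⟩ := Finset.mem_filter.mp hm
      obtain ⟨a1, a2, a3, a4, a5⟩ := hSm m hm1
      have hu0 : N / m ≠ 0 := by
        have : W + 1 ≤ N / m := by rw [Nat.le_div_iff_mul_le (by omega)]; linarith
        omega
      have b1 : 2 ^ i ≤ N / m := by
        rw [← hm2]; exact Nat.pow_log_le_self 2 hu0
      have b2 : N / m < 2 ^ (i + 1) := by
        rw [← hm2]; exact Nat.lt_pow_succ_log_self (by norm_num) _
      refine ⟨a1, a2, ?_, ?_, ?_, ?_⟩
      · rwa [Nat.le_div_iff_mul_le (by omega)] at b1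
      · rwa [Nat.div_lt_iff_lt_mul (by omega)] at b2
      · rw [rough_iff a1]
        refine lt_of_le_of_lt b1 ?_
        rw [Nat.div_lt_iff_lt_mul (by omega)]
        exact a5
      · refine a5.le.trans (Nat.mul_le_mul_right m (Nat.minFac_le (by omega)))
    have hiN : 2 ^ i ≤ N := by
      obtain ⟨c1, c2, c3, c4, c5, c6⟩ := hprop m0 (Finset.mem_filter.mpr ⟨hm0, rfl⟩)
      exact le_trans (Nat.le_mul_of_pos_right _ (by omega)) c3
    have hcl := h1 i N hi1 hN hiN _ hprop
    calc _ ≤ ∑ m ∈ S'.filter (fun m => w m = i), ((1 + (m.primeFactors.card : ℝ)) / m) * (K / (i * Real.log 2)) := by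
          apply Finset.sum_le_sum
          intro m hm
          obtain ⟨c1, c2, c3, c4, c5, c6⟩ := hprop m hm
          rw [abs_mul]
          have d1 : |gg m| ≤ (1 + (m.primeFactors.card : ℝ)) / m := by
            unfold gg
            rw [abs_div, abs_mul, Nat.abs_cast, abs_of_nonneg (by positivity : (0 : ℝ) ≤ 1 + (m.primeFactors.card : ℝ))]
            have m1 : |(ArithmeticFunction.moebius m : ℝ)| ≤ 1 := by
              exact_mod_cast ArithmeticFunction.abs_moebius_le_one
            gcongr
            exact mul_le_of_le_one_left (by positivity) m1
          have b1 : 2 ^ i ≤ N / m := by rwa [Nat.le_div_iff_mul_le (by omega)]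
          have d2 : |E (N / m)| ≤ K / (i * Real.log 2) := by
            refine (hE (N / m) (le_trans Nat.one_le_two_pow b1)).trans ?_
            have b2 : (2 : ℝ) ^ i ≤ ((N / m : ℕ) : ℝ) + 1 := by
              have : ((2 ^ i : ℕ) : ℝ) ≤ ((N / m : ℕ) : ℝ) := by exact_mod_cast b1
              push_cast at this
              linarith
            rw [← Real.log_pow]
            have : 0 < Real.log ((2 : ℝ) ^ i) := by rw [Real.log_pow]; positivity
            gcongr
          gcongr
      _ = (∑ m ∈ S'.filter (fun m => w m = i), ((1 + (m.primeFactors.card : ℝ)) / m)) * (K / (i * Real.log 2)) := by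
          rw [Finset.sum_mul]
      _ ≤ (C1 * (1 + LL) / i) * (K / (i * Real.log 2)) := by gcongr
      _ = _ := by field_simp
  have hsq : ∑ i ∈ S'.image w, ((i : ℝ) ^ 2)⁻¹ ≤ 2 / i0 := by
    have h3 := sum_Ioo_inv_sq_le (α := ℝ) (i0 - 1) (Nat.log 2 N + 1)
    have e : ((i0 - 1 : ℕ) : ℝ) + 1 = i0 := by rw [Nat.cast_sub hi01]; simp
    rw [e] at h3
    refine le_trans ?_ h3
    apply Finset.sum_le_sum_of_subset_of_nonneg
    · intro i hi
      obtain ⟨m, hm, rfl⟩ := Finset.mem_image.mp hi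
      have := hwi m hm
      have h4 : w m ≤ Nat.log 2 N := Nat.log_mono_right (Nat.div_le_self _ _)
      rw [Finset.mem_Ioo]
      omega
    · intros; positivity
  have hi0r : (0 : ℝ) < i0 := by exact_mod_cast hi01
  have hinv : 1 / (i0 : ℝ) ≤ 2 * Real.log 2 / Real.log W := by
    rw [div_le_div_iff₀ hi0r hlW, one_mul]
    have a1 : W + 1 < 2 ^ (i0 + 1) := Nat.lt_pow_succ_log_self (by norm_num) _
    have a2 : (W : ℝ) ≤ 2 ^ (i0 + 1) := by exact_mod_cast (by omega : W ≤ 2 ^ (i0 + 1))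
    have a3 := Real.log_le_log (by exact_mod_cast (by omega : 0 < W)) a2
    rw [Real.log_pow] at a3
    have a4 : (1 : ℝ) ≤ i0 := by exact_mod_cast hi01
    push_cast at a3
    nlinarith
  calc _ ≤ ∑ m ∈ S', |gg m * E (N / m)| := Finset.abs_sum_le_sum_abs _ _
    _ = ∑ i ∈ S'.image w, ∑ m ∈ S'.filter (fun m => w m = i), |gg m * E (N / m)| :=
        (Finset.sum_fiberwise_of_maps_to (fun m hm => Finset.mem_image_of_mem w hm) _).symm
    _ ≤ ∑ i ∈ S'.image w, ((i : ℝ) ^ 2)⁻¹ * (C1 * (1 + LL) * K / Real.log 2) := Finset.sum_le_sum hfib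
    _ = (∑ i ∈ S'.image w, ((i : ℝ) ^ 2)⁻¹) * (C1 * (1 + LL) * K / Real.log 2) := by rw [Finset.sum_mul]
    _ ≤ (2 / i0) * (C1 * (1 + LL) * K / Real.log 2) := by gcongr
    _ = (1 / i0) * (2 * (C1 * (1 + LL) * K / Real.log 2)) := by ring
    _ ≤ (2 * Real.log 2 / Real.log W) * (2 * (C1 * (1 + LL) * K / Real.log 2)) := by gcongr
    _ = _ := by field_simp; ring


lemma LL_nonneg {N : ℕ} (hN : 16 ≤ N) : 0 ≤ Real.log (Real.log N) := by
  apply Real.log_nonneg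
  rw [Real.le_log_iff_exp_le (by positivity)]
  have := Real.exp_one_lt_d9
  have : (16 : ℝ) ≤ N := by exact_mod_cast hN
  linarith

lemma D_bound : ∃ C > (0 : ℝ), ∀ (a : ℕ → ℝ) (K : ℝ) (N W : ℕ), 0 ≤ K → 16 ≤ N → 2 ≤ W → W < N →
    (∀ M N : ℕ, 1 ≤ M → |∑ n ∈ Finset.Ioc M N, a n| ≤ K / Real.log (M + 1)) →
    |∑ p ∈ Finset.Ioc W N, a p * (MR (N / p) p + WR (N / p) p)|
      ≤ C * K * (1 + Real.log (Real.log N)) ^ 2 / Real.log W := by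
  classical
  obtain ⟨C1, hC1, h1⟩ := B_bound
  obtain ⟨C2, hC2, h2⟩ := C_bound
  obtain ⟨C3, hC3, h3⟩ := WR_crude
  refine ⟨(4 + C3) + (C1 + C2), by positivity, fun a K N W hK hN hW hWN ha => ?_⟩
  have hl := LL_nonneg hN
  have hlW : 0 < Real.log W := Real.log_pos (by exact_mod_cast hW)
  set E : ℕ → ℝ := fun t => ∑ p ∈ Finset.Ioc t N, a p with hEdef
  have hE : ∀ t, 1 ≤ t → |E t| ≤ K / Real.log (t + 1) := fun t ht => ha t N ht
  have hB := h1 E K N W hK hN hW hE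
  have hC := h2 E K N W hK hN hW hWN hE
  rw [D_swap a N W hWN]
  set Y := N / (W + 1) with hY
  set LL := Real.log (Real.log N) with hLL
  have hsplit : ∑ m ∈ (Finset.Icc 2 Y).filter (Rough W), gg m * ∑ p ∈ Finset.Ioc (min (N / m) (m.minFac - 1)) N, a p =
      ∑ m ∈ (Finset.Icc 2 N).filter (fun m => W < m.minFac ∧ m.minFac * m ≤ N), gg m * E (m.minFac - 1) +
      ∑ m ∈ (Finset.Icc 2 Y).filter (fun m => Rough W m ∧ ¬ m.minFac * m ≤ N), gg m * E (N / m) := by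
    rw [← Finset.sum_filter_add_sum_filter_not _ (fun m : ℕ => m.minFac * m ≤ N), Finset.filter_filter, Finset.filter_filter]
    congr 1
    · apply Finset.sum_congr
      · ext m
        simp only [Finset.mem_filter, Finset.mem_Icc]
        constructor
        · rintro ⟨⟨b1, b2⟩, b3, b4⟩
          rw [rough_iff b1] at b3
          exact ⟨⟨b1, b2.trans (Nat.div_le_self _ _)⟩, b3, b4⟩
        · rintro ⟨⟨b1, b2⟩, b3, b4⟩
          refine ⟨⟨b1, ?_⟩, (rough_iff b1).mpr b3, b4⟩
          rw [hY, Nat.le_div_iff_mul_le (by omega)]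
          nlinarith
      · intro m hm
        simp only [Finset.mem_filter, Finset.mem_Icc] at hm
        have : m.minFac ≤ N / m := by rw [Nat.le_div_iff_mul_le (by omega)]; exact hm.2.2
        rw [min_eq_right (by omega)]
    · apply Finset.sum_congr rfl
      intro m hm
      simp only [Finset.mem_filter, Finset.mem_Icc, not_le] at hm
      have : N / m < m.minFac := by rw [Nat.div_lt_iff_lt_mul (by omega)]; exact hm.2.2
      rw [min_eq_left (by omega)]
  rw [hsplit]
  have hA : |E W * (MR Y W + WR Y W)| ≤ (4 + C3) * K * (1 + LL) ^ 2 / Real.log W := by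
    rw [abs_mul]
    have e1 : |E W| ≤ K / Real.log W := by
      refine (hE W (by omega)).trans ?_
      have hW0 : (0 : ℝ) < W := by exact_mod_cast (by omega : 0 < W)
      gcongr
      linarith
    have e2 : |MR Y W + WR Y W| ≤ (4 + C3) * (1 + LL) ^ 2 := by
      have f1 := MR_abs_le Y W
      have f2 := h3 N Y W (by omega) (Nat.div_le_self _ _)
      have f3 := abs_add_le (MR Y W) (WR Y W)
      nlinarith [mul_nonneg hC3.le hl, mul_nonneg hC3.le (sq_nonneg LL), sq_nonneg LL]
    calc _ ≤ (K / Real.log W) * ((4 + C3) * (1 + LL) ^ 2) := by gcongr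
      _ = _ := by ring
  have hC' : C2 * K * (1 + LL) / Real.log W ≤ C2 * K * (1 + LL) ^ 2 / Real.log W := by
    have : (1 + LL) ≤ (1 + LL) ^ 2 := by nlinarith
    gcongr
  set X1 := ∑ m ∈ (Finset.Icc 2 N).filter (fun m => W < m.minFac ∧ m.minFac * m ≤ N), gg m * E (m.minFac - 1)
  set X2 := ∑ m ∈ (Finset.Icc 2 Y).filter (fun m => Rough W m ∧ ¬ m.minFac * m ≤ N), gg m * E (N / m)
  calc |E W * (MR Y W + WR Y W) - (X1 + X2)| ≤ |E W * (MR Y W + WR Y W)| + (|X1| + |X2|) :=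
        (abs_sub _ _).trans (add_le_add le_rfl (abs_add_le _ _))
    _ ≤ (4 + C3) * K * (1 + LL) ^ 2 / Real.log W + (C1 * K * (1 + LL) ^ 2 / Real.log W + C2 * K * (1 + LL) ^ 2 / Real.log W) := by
        linarith
    _ = _ := by ring

/-- contribution of small primes -/
lemma low_bound : ∃ C > (0 : ℝ), ∀ (b : ℕ → ℝ) (N W : ℕ), (∀ p, |b p| ≤ 1) → 16 ≤ Real.log N → 2 ≤ W →
    (W : ℝ) ≤ Real.exp (Real.sqrt (Real.log N)) →
    |∑ p ∈ (Finset.Ioc 0 W).filter Nat.Prime, b p / p * (MR (N / p) p + WR (N / p) p)| ≤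
      C / Real.sqrt (Real.log N) := by
  obtain ⟨C1, hC1, h1⟩ := MW_fine
  obtain ⟨C2, hC2, h2⟩ := prime_log_le
  refine ⟨C1 * 516 * (1 + C2), by positivity, fun b N W hb hN hW hWe => ?_⟩
  set L := Real.log N with hL
  set s := Real.sqrt L with hs
  have hs2 : s ^ 2 = L := Real.sq_sqrt (by linarith)
  have hs4 : 4 ≤ s := by
    rw [hs]; apply Real.le_sqrt_of_sq_le; linarith
  have hN0 : (0 : ℝ) < N := by
    rcases Nat.eq_zero_or_pos N with h | h
    · rw [hL, h] at hN; norm_num at hN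
    · exact_mod_cast h
  have hNe : (N : ℝ) = Real.exp L := (Real.exp_log hN0).symm
  have hT : ∀ p ∈ (Finset.Ioc 0 W).filter Nat.Prime, |b p / p * (MR (N / p) p + WR (N / p) p)| ≤
      (Real.log p / p) * (C1 * 516 / L) := by
    intro p hp
    simp only [Finset.mem_filter, Finset.mem_Ioc] at hp
    have hp0 : (0 : ℝ) < p := by exact_mod_cast hp.2.pos
    have hp2 : (2 : ℝ) ≤ p := by exact_mod_cast hp.2.two_le
    have hlp : 0 < Real.log p := Real.log_pos (by linarith)
    have hpe : (p : ℝ) ≤ Real.exp s := le_trans (by exact_mod_cast hp.1.2) hWe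
    have hlps : Real.log p ≤ s := by
      rwa [Real.log_le_iff_le_exp hp0]
    set y := N / p with hy
    have hyr : Real.exp (L / 4) ≤ y := by
      have f1 : (N : ℝ) / p < (y : ℝ) + 1 := by
        rw [div_lt_iff₀ hp0]
        have := Nat.lt_div_mul_add (a := N) hp.2.pos
        have h3 : N < (N / p + 1) * p := by linarith
        exact_mod_cast h3
      have f2 : Real.exp (L - s) ≤ (N : ℝ) / p := by
        rw [le_div_iff₀ hp0, hNe]
        calc Real.exp (L - s) * p ≤ Real.exp (L - s) * Real.exp s := by gcongr
          _ = Real.exp L := by rw [← Real.exp_add]; congr 1; ring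
      have f3 : Real.exp (L / 4) + 1 ≤ Real.exp (L - s) := by
        have g1 : L / 4 + 1 ≤ L - s := by nlinarith
        have g2 : Real.exp (L / 4 + 1) ≤ Real.exp (L - s) := Real.exp_le_exp.mpr g1
        rw [Real.exp_add] at g2
        have g3 := Real.add_one_le_exp (1 : ℝ)
        have g4 := Real.add_one_le_exp (L / 4)
        nlinarith
      linarith
    have hy0 : (0 : ℝ) < y := lt_of_lt_of_le (Real.exp_pos _) hyr
    have hly : L / 4 ≤ Real.log y := by rwa [Real.le_log_iff_exp_le hy0]
    have hy2 : 2 ≤ y := by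
      have : (2 : ℝ) ≤ y := by
        have := Real.add_one_le_exp (L / 4)
        linarith
      exact_mod_cast this
    have hfine := h1 y p hy2 hp.2.two_le
    have hq1 : 1 / Real.log y ≤ 4 / L := by
      rw [div_le_div_iff₀ (by linarith) (by linarith)]; linarith
    have hq2 : (y : ℝ) ^ (-(1 / (4 * Real.log p))) ≤ 512 / L := by
      rw [Real.rpow_def_of_pos hy0]
      have g1 : Real.log y * (-(1 / (4 * Real.log p))) ≤ -(s / 16) := by
        have : s / 16 ≤ Real.log y * (1 / (4 * Real.log p)) := by
          rw [mul_one_div, le_div_iff₀ (by positivity)]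
          nlinarith
        linarith
      refine (Real.exp_le_exp.mpr g1).trans ?_
      rw [Real.exp_neg, inv_eq_one_div, div_le_div_iff₀ (Real.exp_pos _) (by linarith)]
      have := Real.quadratic_le_exp_of_nonneg (show 0 ≤ s / 16 by linarith)
      nlinarith
    have habs : |MR y p + WR y p| ≤ C1 * Real.log p * (516 / L) := by
      refine (abs_add_le _ _).trans (hfine.trans ?_)
      apply mul_le_mul_of_nonneg_left _ (by positivity)
      have : 516 / L = 4 / L + 512 / L := by ring
      linarith
    rw [abs_mul, abs_div, Nat.abs_cast]
    calc _ ≤ 1 / (p : ℝ) * (C1 * Real.log p * (516 / L)) := by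
          have := hb p
          gcongr
      _ = _ := by ring
  have hlW : Real.log W ≤ s := by
    rwa [Real.log_le_iff_le_exp (by exact_mod_cast (by omega : 0 < W))]
  calc _ ≤ ∑ p ∈ (Finset.Ioc 0 W).filter Nat.Prime, (Real.log p / p) * (C1 * 516 / L) :=
        (Finset.abs_sum_le_sum_abs _ _).trans (Finset.sum_le_sum hT)
    _ = (∑ p ∈ (Finset.Ioc 0 W).filter Nat.Prime, (Real.log p / p)) * (C1 * 516 / L) := by rw [Finset.sum_mul]
    _ ≤ (Real.log W + C2) * (C1 * 516 / L) := by
        apply mul_le_mul_of_nonneg_right (h2 W)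
        have : 0 < L := by linarith
        positivity
    _ ≤ (s * (1 + C2)) * (C1 * 516 / L) := by
        have : 0 < L := by linarith
        apply mul_le_mul_of_nonneg_right _ (by positivity)
        nlinarith
    _ = _ := by
        rw [← hs2]
        have : s ≠ 0 := by linarith
        field_simp

/-- the sum in the theorem -/
noncomputable def SS (k l N : ℕ) : ℝ :=
  ∑ n ∈ (Finset.Icc 2 N).filter (fun n => n.minFac ≡ l [MOD k]),
    (ArithmeticFunction.moebius n : ℝ) * (n.primeFactors.card : ℝ) / n

lemma aa_abs_le (k l n : ℕ) [NeZero k] : |aa k l n| ≤ 1 := by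
  unfold aa
  have h1 : (1 : ℝ) ≤ k.totient := by
    exact_mod_cast Nat.totient_pos.mpr (NeZero.pos k)
  have h2 : 1 / (k.totient : ℝ) ≤ 1 := by
    rw [div_le_one (by linarith)]; exact h1
  have h3 : 0 ≤ 1 / (k.totient : ℝ) := by positivity
  split_ifs <;> rw [abs_le] <;> constructor <;> linarith

lemma SS_eq (k l N : ℕ) : SS k l N =
    ∑ n ∈ Finset.Icc 2 N, aa k l n.minFac * ((ArithmeticFunction.moebius n : ℝ) * (n.primeFactors.card : ℝ) / n)
    + 1 / (k.totient : ℝ) * WR N 0 := by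
  classical
  have h1 : WR N 0 = ∑ n ∈ Finset.Icc 2 N, ((ArithmeticFunction.moebius n : ℝ) * (n.primeFactors.card : ℝ) / n) := by
    unfold WR
    symm
    apply Finset.sum_subset
    · intro n hn
      simp only [Finset.mem_filter, Finset.mem_Icc] at hn ⊢
      exact ⟨⟨by omega, hn.2⟩, fun p hp => (Nat.prime_of_mem_primeFactors hp).pos⟩
    · intro n hn hn2
      simp only [Finset.mem_filter, Finset.mem_Icc, not_and] at hn hn2
      have : n = 1 := by
        by_contra hne
        exact hn2 (by omega) hn.1.2
      simp [this]
  rw [h1, Finset.mul_sum, ← Finset.sum_add_distrib, SS, Finset.sum_filter]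
  apply Finset.sum_congr rfl
  intro n hn
  have hp : n.minFac.Prime := Nat.minFac_prime (by have := Finset.mem_Icc.mp hn; omega)
  unfold aa
  rw [if_pos hp]
  split_ifs <;> ring

lemma SS_large (k l : ℕ) [NeZero k] (hl : l.Coprime k) : ∃ C > (0 : ℝ), ∀ N : ℕ, 16 ≤ Real.log N →
    |SS k l N| ≤ C * (1 + Real.log (Real.log N)) ^ 2 / Real.sqrt (Real.log N) := by
  obtain ⟨K, hK, h0⟩ := aa_sum k l hl
  obtain ⟨C1, hC1, h1⟩ := D_bound
  obtain ⟨C2, hC2, h2⟩ := low_bound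
  obtain ⟨C3, hC3, h3⟩ := S1_bound
  refine ⟨2 * C1 * K + C2 + C3, by positivity, fun N hN => ?_⟩
  set L := Real.log N with hL
  set s := Real.sqrt L with hs
  have hs2 : s ^ 2 = L := Real.sq_sqrt (by linarith)
  have hs4 : 4 ≤ s := by
    rw [hs]; apply Real.le_sqrt_of_sq_le; linarith
  have hN0 : (0 : ℝ) < N := by
    rcases Nat.eq_zero_or_pos N with h | h
    · rw [hL, h] at hN; norm_num at hN
    · exact_mod_cast h
  have hNe : (N : ℝ) = Real.exp L := (Real.exp_log hN0).symm
  have hN16 : 16 ≤ N := by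
    have : (16 : ℝ) ≤ N := by
      rw [hNe]
      have := Real.add_one_le_exp L
      linarith
    exact_mod_cast this
  have hLL := LL_nonneg hN16
  set W := ⌊Real.exp s⌋₊ with hW
  have hes : 5 ≤ Real.exp s := by
    have := Real.add_one_le_exp s
    linarith
  have hWe : (W : ℝ) ≤ Real.exp s := Nat.floor_le (Real.exp_pos _).le
  have hWl : Real.exp s < W + 1 := Nat.lt_floor_add_one _
  have hW2 : 2 ≤ W := by
    have : (2 : ℝ) ≤ W := by linarith
    exact_mod_cast this
  have hWN : W < N := by
    have : (W : ℝ) < N := by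
      refine lt_of_le_of_lt hWe ?_
      rw [hNe]
      apply Real.exp_lt_exp.mpr
      nlinarith
    exact_mod_cast this
  have hlW : s / 2 ≤ Real.log W := by
    rw [Real.le_log_iff_exp_le (by linarith)]
    have e1 : Real.exp s = Real.exp (s / 2) ^ 2 := by
      rw [← Real.exp_nat_mul]; congr 1; push_cast; ring
    have e2 := Real.add_one_le_exp (s / 2)
    nlinarith
  have hD := h1 (fun n => aa k l n / n) K N W hK.le hN16 hW2 hWN h0
  have hlow := h2 (aa k l) N W (fun p => aa_abs_le k l p) hN hW2 hWe
  have hS1 := h3 N (by omega)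
  have hdec := decomp (aa k l) N
  have hsum : ∑ p ∈ (Finset.Ioc 0 N).filter Nat.Prime, aa k l p / p * (MR (N / p) p + WR (N / p) p) =
      ∑ p ∈ (Finset.Ioc 0 W).filter Nat.Prime, aa k l p / p * (MR (N / p) p + WR (N / p) p) +
      ∑ p ∈ Finset.Ioc W N, aa k l p / p * (MR (N / p) p + WR (N / p) p) := by
    have hz : ∀ p : ℕ, ¬ p.Prime → aa k l p / p * (MR (N / p) p + WR (N / p) p) = 0 := by
      intro p hp
      simp [aa, hp]
    have hfil : ∀ t : Finset ℕ, ∑ p ∈ t.filter Nat.Prime, aa k l p / p * (MR (N / p) p + WR (N / p) p) =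
        ∑ p ∈ t, aa k l p / p * (MR (N / p) p + WR (N / p) p) := by
      intro t
      rw [Finset.sum_filter]
      apply Finset.sum_congr rfl
      intro p _
      split_ifs with h
      · rfl
      · exact (hz p h).symm
    rw [hfil, hfil, Finset.sum_Ioc_consecutive _ (Nat.zero_le _) hWN.le]
  rw [SS_eq, hdec, hsum]
  set X1 := ∑ p ∈ (Finset.Ioc 0 W).filter Nat.Prime, aa k l p / p * (MR (N / p) p + WR (N / p) p)
  set X2 := ∑ p ∈ Finset.Ioc W N, aa k l p / p * (MR (N / p) p + WR (N / p) p)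
  have hφ : |1 / (k.totient : ℝ) * WR N 0| ≤ C3 / s := by
    rw [abs_mul]
    have h1 : (1 : ℝ) ≤ k.totient := by
      exact_mod_cast Nat.totient_pos.mpr (NeZero.pos k)
    have h2 : |1 / (k.totient : ℝ)| ≤ 1 := by
      rw [abs_of_nonneg (by positivity), div_le_one (by linarith)]; exact h1
    calc _ ≤ 1 * (C3 / (1 + L)) := by gcongr
      _ ≤ C3 / s := by
        rw [one_mul]
        gcongr
        nlinarith
  set LL := Real.log L with hLLd
  have hone : 1 ≤ (1 + LL) ^ 2 := by nlinarith
  have hD' : |X2| ≤ 2 * C1 * K * (1 + LL) ^ 2 / s := by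
    refine hD.trans ?_
    calc C1 * K * (1 + LL) ^ 2 / Real.log W ≤ C1 * K * (1 + LL) ^ 2 / (s / 2) := by gcongr
      _ = _ := by field_simp
  have e2 : C2 / s ≤ C2 * (1 + LL) ^ 2 / s := by
    gcongr
    exact le_mul_of_one_le_right hC2.le hone
  have e3 : C3 / s ≤ C3 * (1 + LL) ^ 2 / s := by
    gcongr
    exact le_mul_of_one_le_right hC3.le hone
  calc |-(X1 + X2) + 1 / (k.totient : ℝ) * WR N 0| ≤ (|X1| + |X2|) + |1 / (k.totient : ℝ) * WR N 0| := by
        refine (abs_add_le _ _).trans ?_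
        rw [abs_neg]
        exact add_le_add (abs_add_le _ _) le_rfl
    _ ≤ C2 * (1 + LL) ^ 2 / s + 2 * C1 * K * (1 + LL) ^ 2 / s + C3 * (1 + LL) ^ 2 / s := by linarith
    _ = _ := by ring


lemma SS_all (k l : ℕ) [NeZero k] (hl : l.Coprime k) : ∃ C > (0 : ℝ), ∀ x : ℝ, 16 ≤ x →
    |SS k l ⌊x⌋₊| ≤ C * (Real.log (Real.log x)) ^ ((5 : ℝ) / 2) / Real.sqrt (Real.log x) := by
  obtain ⟨C1, hC1, h1⟩ := SS_large k l hl
  set B0 := ∑ n ∈ Finset.Icc 2 ⌊Real.exp 16⌋₊, |(ArithmeticFunction.moebius n : ℝ) * (n.primeFactors.card : ℝ) / n| with hB0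
  have hB0n : 0 ≤ B0 := Finset.sum_nonneg (fun n _ => abs_nonneg _)
  refine ⟨8 * C1 + 8 * B0, by positivity, fun x hx => ?_⟩
  set N := ⌊x⌋₊ with hN
  have hNx : (N : ℝ) ≤ x := Nat.floor_le (by linarith)
  have hxN : x < N + 1 := Nat.lt_floor_add_one x
  have hN16 : 16 ≤ N := Nat.le_floor (by exact_mod_cast hx)
  have hN16r : (16 : ℝ) ≤ N := by exact_mod_cast hN16
  have hl2 := Real.log_two_gt_d9
  have h16 : Real.log 16 = 4 * Real.log 2 := by
    rw [show (16 : ℝ) = 2 ^ 4 by norm_num, Real.log_pow]; norm_num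
  have hlN : Real.exp 1 ≤ Real.log N := by
    have := Real.log_le_log (by norm_num) hN16r
    have := Real.exp_one_lt_d9
    linarith
  have hlNx : Real.log N ≤ Real.log x := Real.log_le_log (by linarith) hNx
  have he := Real.exp_pos 1
  have hLLx : 1 ≤ Real.log (Real.log x) := by
    rw [Real.le_log_iff_exp_le (by linarith)]; linarith
  have hLL : Real.log (Real.log N) ≤ Real.log (Real.log x) := Real.log_le_log (by linarith) hlNx
  have hLL0 := LL_nonneg hN16
  have hx4 : Real.log x ≤ 4 * Real.log N := by
    have a1 : Real.log x ≤ Real.log ((N : ℝ) ^ 4) := by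
      apply Real.log_le_log (by linarith)
      have : (N : ℝ) + 1 ≤ (N : ℝ) ^ 2 := by nlinarith
      have : (N : ℝ) ^ 2 ≤ (N : ℝ) ^ 4 := by
        apply pow_le_pow_right₀ (by linarith) (by norm_num)
      linarith
    rw [Real.log_pow] at a1
    exact_mod_cast a1
  have hsq : Real.sqrt (Real.log x) ≤ 2 * Real.sqrt (Real.log N) := by
    have : (2 : ℝ) = Real.sqrt 4 := by
      rw [show (4 : ℝ) = 2 ^ 2 by norm_num, Real.sqrt_sq (by norm_num)]
    rw [this, ← Real.sqrt_mul (by norm_num)]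
    exact Real.sqrt_le_sqrt hx4
  have hsx : 0 < Real.sqrt (Real.log x) := Real.sqrt_pos.mpr (by linarith)
  have hsN : 0 < Real.sqrt (Real.log N) := Real.sqrt_pos.mpr (by linarith)
  set U := Real.log (Real.log x) with hU
  have hU2 : U ^ 2 ≤ U ^ ((5 : ℝ) / 2) := by
    rw [← Real.rpow_natCast]
    exact Real.rpow_le_rpow_of_exponent_le hLLx (by norm_num)
  have hU1 : 1 ≤ U ^ ((5 : ℝ) / 2) := Real.one_le_rpow hLLx (by norm_num)
  rw [le_div_iff₀ hsx]
  by_cases hbig : 16 ≤ Real.log N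
  · have h2 := h1 N hbig
    rw [le_div_iff₀ hsN] at h2
    have h3 : (1 + Real.log (Real.log N)) ^ 2 ≤ 4 * U ^ 2 := by nlinarith
    calc |SS k l N| * Real.sqrt (Real.log x) ≤ |SS k l N| * (2 * Real.sqrt (Real.log N)) := by gcongr
      _ = 2 * (|SS k l N| * Real.sqrt (Real.log N)) := by ring
      _ ≤ 2 * (C1 * (1 + Real.log (Real.log N)) ^ 2) := by linarith
      _ ≤ 2 * (C1 * (4 * U ^ ((5 : ℝ) / 2))) := by
          gcongr
          linarith
      _ ≤ _ := by nlinarith [mul_nonneg hB0n (by linarith : 0 ≤ U ^ ((5 : ℝ) / 2))]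
  · push Not at hbig
    have hb : |SS k l N| ≤ B0 := by
      unfold SS
      refine (Finset.abs_sum_le_sum_abs _ _).trans ?_
      apply Finset.sum_le_sum_of_subset_of_nonneg
      · intro n hn
        simp only [Finset.mem_filter, Finset.mem_Icc] at hn ⊢
        refine ⟨hn.1.1, hn.1.2.trans ?_⟩
        apply Nat.le_floor
        rw [Real.log_lt_iff_lt_exp (by linarith)] at hbig
        exact hbig.le
      · intros; positivity
    have hs4 : Real.sqrt (Real.log N) ≤ 4 := by
      rw [Real.sqrt_le_left (by norm_num)]
      linarith
    calc |SS k l N| * Real.sqrt (Real.log x) ≤ B0 * 8 := by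
          apply mul_le_mul hb (by linarith) hsx.le hB0n
      _ ≤ _ := by nlinarith [mul_nonneg hB0n (by linarith : 0 ≤ U ^ ((5 : ℝ) / 2) - 1), mul_nonneg hC1.le (by linarith : 0 ≤ U ^ ((5 : ℝ) / 2))]

lemma rate_tendsto (C : ℝ) : Filter.Tendsto (fun x : ℝ => C * (Real.log (Real.log x)) ^ ((5 : ℝ) / 2) / Real.sqrt (Real.log x))
    Filter.atTop (nhds 0) := by
  have h1 := tendsto_rpow_mul_exp_neg_mul_atTop_nhds_zero ((5 : ℝ) / 2) (1 / 2) (by norm_num)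
  have h2 := (h1.comp (Real.tendsto_log_atTop.comp Real.tendsto_log_atTop)).const_mul C
  rw [mul_zero] at h2
  refine h2.congr' ?_
  filter_upwards [Filter.eventually_gt_atTop (1 : ℝ)] with x hx
  have hl : 0 < Real.log x := Real.log_pos hx
  simp only [Function.comp]
  have : Real.exp (-(1 / 2) * Real.log (Real.log x)) = (Real.sqrt (Real.log x))⁻¹ := by
    rw [Real.sqrt_eq_rpow, ← Real.rpow_neg hl.le, Real.rpow_def_of_pos hl]
    congr 1
    ring
  rw [this]
  ring

open Finset ArithmeticFunction Real Filter

/-- For fixed `1 ≤ ℓ ≤ k` with `gcd(ℓ,k) = 1`, there is `C > 0` with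
`|Σ_{2 ≤ n ≤ x, p(n) ≡ ℓ (mod k)} μ(n) ω(n)/n| ≤ C (log log x)^{5/2} / √(log x)`
for all `x ≥ 16`; consequently the partial sums tend to `0` as `x → ∞`, i.e.
`Σ_{n ≥ 2, p(n) ≡ ℓ (mod k)} μ(n) ω(n)/n = 0`. -/
theorem moebius_omega_div_smallest_factor_progression
    (k ℓ : ℕ) (hl : 1 ≤ ℓ) (hlk : ℓ ≤ k) (hgcd : Nat.gcd ℓ k = 1) :
    (∃ C > (0 : ℝ), ∀ x : ℝ, 16 ≤ x →
      |∑ n ∈ (Finset.Icc 2 ⌊x⌋₊).filter (fun n => n.minFac ≡ ℓ [MOD k]),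
          (moebius n : ℝ) * (n.primeFactors.card : ℝ) / n|
        ≤ C * (Real.log (Real.log x)) ^ ((5 : ℝ) / 2) / Real.sqrt (Real.log x)) ∧
    Tendsto (fun x : ℝ =>
        ∑ n ∈ (Finset.Icc 2 ⌊x⌋₊).filter (fun n => n.minFac ≡ ℓ [MOD k]),
          (moebius n : ℝ) * (n.primeFactors.card : ℝ) / n)
      atTop (nhds 0) := by
  haveI : NeZero k := ⟨by omega⟩
  obtain ⟨C, hC, h⟩ := SS_all k ℓ hgcd
  refine ⟨⟨C, hC, h⟩, ?_⟩
  refine squeeze_zero_norm' ?_ (rate_tendsto C)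
  filter_upwards [eventually_ge_atTop (16 : ℝ)] with x hx
  exact h x hx
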